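/- arXiv:1805.01527 — 4 statements merged into one kernel-verified Lean document; each statement's English description precedes it below -/
import Mathlib

section
/- There exists a function f : ℕ → ℕ with the following property: for every positive integer n, every finitely generated subgroup G ≤ GL_n(ℂ) that contains a normal abelian subgroup of finite index all of whose elements are diagonalizable matrices, contains a normal abelian subgroup of finite index all of whose elements are diagonalizable matrices and whose index in G is at most f(n). -/
/-- A matrix is diagonalizable if it is conjugate in `GL n ℂ` to a diagonal matrix. -/
def Matrix.IsDiagonalizable {n : ℕ} (M : Matrix (Fin n) (Fin n) ℂ) : Prop :=
  ∃ P : GL (Fin n) ℂ, ∃ d : Fin n → ℂ,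
    (P : Matrix (Fin n) (Fin n) ℂ) * M * ((P⁻¹ : GL (Fin n) ℂ) : Matrix (Fin n) (Fin n) ℂ) =
      Matrix.diagonal d

/-- A normal abelian finite-index subgroup all of whose elements are diagonalizable matrices. -/
def GoodSubgroup {n : ℕ} (Γ : Subgroup (GL (Fin n) ℂ)) (H : Subgroup ↥Γ) : Prop :=
  H.Normal ∧ H.FiniteIndex ∧ (∀ a b : ↥H, a * b = b * a) ∧
    ∀ h : ↥H, Matrix.IsDiagonalizable (((h : ↥Γ) : GL (Fin n) ℂ) : Matrix (Fin n) (Fin n) ℂ)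

section BoundedRepresentation

open scoped commutatorElement

variable {R F : Type*} [NormedRing R] [Group F]

theorem norm_map_mul_sub_one_le (ρ : F →* R) (hρ : ∀ f, ‖ρ f‖ ≤ 1) (x y : F) :
    ‖ρ (x * y⁻¹) - 1‖ ≤ ‖ρ x - ρ y‖ := by
  have h : ρ (x * y⁻¹) - 1 = (ρ x - ρ y) * ρ y⁻¹ := by
    rw [sub_mul, ← map_mul, ← map_mul, mul_inv_cancel, map_one]
  rw [h]
  exact (norm_mul_le _ _).trans (mul_le_of_le_one_right (norm_nonneg _) (hρ _))

theorem norm_map_commutator_sub_one_le (ρ : F →* R) (hρ : ∀ f, ‖ρ f‖ ≤ 1) (a b : F) :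
    ‖ρ ⁅a, b⁆ - 1‖ ≤ 2 * ‖ρ a - 1‖ * ‖ρ b - 1‖ := by
  have h₁ : ⁅a, b⁆ = (a * b) * (b * a)⁻¹ := by rw [commutatorElement_def]; group
  have h₂ : ρ (a * b) - ρ (b * a) =
      (ρ a - 1) * (ρ b - 1) - (ρ b - 1) * (ρ a - 1) := by
    rw [map_mul, map_mul]; noncomm_ring
  rw [h₁]
  refine (norm_map_mul_sub_one_le ρ hρ _ _).trans ?_
  rw [h₂]
  calc _ ≤ ‖(ρ a - 1) * (ρ b - 1)‖ + ‖(ρ b - 1) * (ρ a - 1)‖ := norm_sub_le _ _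
    _ ≤ ‖ρ a - 1‖ * ‖ρ b - 1‖ + ‖ρ b - 1‖ * ‖ρ a - 1‖ :=
      add_le_add (norm_mul_le _ _) (norm_mul_le _ _)
    _ = _ := by ring

/-- An element of finite order whose powers all stay within distance `c < 1` of `1` is trivial. -/
theorem eq_one_of_norm_pow_sub_one_le [NormedSpace ℝ R] [IsScalarTower ℝ R R]
    [SMulCommClass ℝ R R] {u : R} {m : ℕ} (hm : 0 < m) (hu : u ^ m = 1) {c : ℝ} (hc : c < 1)
    (h : ∀ k : ℕ, ‖u ^ k - 1‖ ≤ c) : u = 1 := by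
  set S : R := ∑ k ∈ Finset.range m, u ^ k
  have hS : (u - 1) * S = 0 := by rw [mul_geom_sum, hu, sub_self]
  have hm' : (m : ℝ) ≠ 0 := by positivity
  have hbound : ‖(m : ℝ)⁻¹ • ∑ k ∈ Finset.range m, (u ^ k - 1)‖ ≤ c := by
    rw [norm_smul, norm_inv, Real.norm_natCast, inv_mul_le_iff₀ (by positivity)]
    refine (norm_sum_le _ _).trans ((Finset.sum_le_sum fun k _ ↦ h k).trans ?_)
    simp
  have key : (u - 1) * ((m : ℝ)⁻¹ • ∑ k ∈ Finset.range m, (u ^ k - 1)) = -(u - 1) := by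
    rw [Finset.sum_sub_distrib, smul_sub, mul_sub, mul_smul_comm, hS, smul_zero, zero_sub]
    congr 1
    rw [Finset.sum_const, Finset.card_range, ← Nat.cast_smul_eq_nsmul ℝ, smul_smul,
      inv_mul_cancel₀ hm', one_smul, mul_one]
  have hle : ‖u - 1‖ ≤ ‖u - 1‖ * c := by
    calc ‖u - 1‖ = ‖(u - 1) * ((m : ℝ)⁻¹ • ∑ k ∈ Finset.range m, (u ^ k - 1))‖ := by
          rw [key, norm_neg]
      _ ≤ _ := (norm_mul_le _ _).trans (by gcongr)
  have : ‖u - 1‖ = 0 := by nlinarith [norm_nonneg (u - 1)]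
  exact sub_eq_zero.mp (norm_eq_zero.mp this)

variable [NormedSpace ℝ R] [IsScalarTower ℝ R R] [SMulCommClass ℝ R R] [Finite F]

theorem commute_of_commute_commutator (ρ : F →* R) (hinj : Function.Injective ρ)
    (hρ : ∀ f, ‖ρ f‖ ≤ 1) {a b : F} (hb : ‖ρ b - 1‖ < 1 / 2) (hab : Commute a ⁅a, b⁆) :
    Commute a b := by
  have hpow (k : ℕ) : ⁅a, b⁆ ^ k = (a ^ k * b * (a ^ k)⁻¹) * b⁻¹ := by
    induction k with
    | zero => simp
    | succ k ih =>
      have hu : ⁅a, b⁆ * a ^ k = a ^ k * ⁅a, b⁆ := (hab.symm.pow_right k).eq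
      rw [pow_succ', ih, ← mul_assoc, ← mul_assoc, ← mul_assoc, hu, commutatorElement_def, pow_succ]
      group
  have hsmall (k : ℕ) : ‖ρ ⁅a, b⁆ ^ k - 1‖ ≤ 2 * ‖ρ b - 1‖ := by
    rw [← map_pow, hpow]
    refine (norm_map_mul_sub_one_le ρ hρ _ _).trans ?_
    have h : ρ (a ^ k * b * (a ^ k)⁻¹) - ρ b =
        ρ (a ^ k) * (ρ b - 1) * ρ (a ^ k)⁻¹ - (ρ b - 1) := by
      rw [mul_sub, sub_mul, mul_one, ← map_mul, ← map_mul, ← map_mul, mul_inv_cancel, map_one]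
      abel
    rw [h]
    have h' : ‖ρ (a ^ k) * (ρ b - 1) * ρ (a ^ k)⁻¹‖ ≤ ‖ρ b - 1‖ :=
      calc _ ≤ ‖ρ (a ^ k)‖ * ‖ρ b - 1‖ * ‖ρ (a ^ k)⁻¹‖ :=
            (norm_mul_le _ _).trans (by gcongr; exact norm_mul_le _ _)
        _ ≤ 1 * ‖ρ b - 1‖ * 1 := by gcongr <;> exact hρ _
        _ = _ := by ring
    linarith [norm_sub_le (ρ (a ^ k) * (ρ b - 1) * ρ (a ^ k)⁻¹) (ρ b - 1)]
  have hone : ρ ⁅a, b⁆ = 1 := by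
    refine eq_one_of_norm_pow_sub_one_le (Nat.card_pos (α := F)) ?_ (by linarith) hsmall
    rw [← map_pow, pow_card_eq_one', map_one]
  exact commutatorElement_eq_one_iff_commute.mp (hinj (hone.trans (map_one ρ).symm))

theorem commute_of_norm_sub_one_lt (ρ : F →* R) (hinj : Function.Injective ρ)
    (hρ : ∀ f, ‖ρ f‖ ≤ 1) {a b : F} (ha : ‖ρ a - 1‖ < 1 / 2) (hb : ‖ρ b - 1‖ < 1 / 2) :
    Commute a b := by
  have hdescend (k : ℕ) : ∀ b : F, ‖ρ b - 1‖ < 1 / 2 → (fun x ↦ ⁅a, x⁆)^[k] b = 1 →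
      Commute a b := by
    induction k with
    | zero =>
      rintro b - rfl
      exact Commute.one_right a
    | succ k ih =>
      intro b hb hk
      refine commute_of_commute_commutator ρ hinj hρ hb (ih _ ?_ hk)
      refine (norm_map_commutator_sub_one_le ρ hρ a b).trans_lt ?_
      nlinarith [norm_nonneg (ρ a - 1), norm_nonneg (ρ b - 1)]
  have hdecay (k : ℕ) :
      ‖ρ ((fun x ↦ ⁅a, x⁆)^[k] b) - 1‖ ≤ (2 * ‖ρ a - 1‖) ^ k * ‖ρ b - 1‖ := by
    induction k with
    | zero => simp
    | succ k ih =>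
      rw [Function.iterate_succ_apply', pow_succ', mul_assoc]
      exact (norm_map_commutator_sub_one_le ρ hρ a _).trans (by gcongr)
  obtain ⟨δ, hδ, hmin⟩ : ∃ δ > 0, ∀ f : F, ‖ρ f - 1‖ < δ → f = 1 := by
    have hfin : (Set.range fun f : {f : F // f ≠ 1} ↦ ‖ρ f - 1‖).Finite := Set.finite_range _
    have h0 : (0 : ℝ) ∉ Set.range fun f : {f : F // f ≠ 1} ↦ ‖ρ f - 1‖ := by
      rintro ⟨f, hf⟩
      exact f.2 (hinj ((sub_eq_zero.mp (norm_eq_zero.mp hf)).trans (map_one ρ).symm))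
    obtain ⟨δ, hδ, hball⟩ := Metric.isOpen_iff.mp hfin.isClosed.isOpen_compl 0 h0
    refine ⟨δ, hδ, fun f hf ↦ by_contra fun hne ↦ ?_⟩
    exact hball (by simpa using hf : ‖ρ f - 1‖ ∈ Metric.ball (0 : ℝ) δ) ⟨⟨f, hne⟩, rfl⟩
  have hlim : Filter.Tendsto (fun k : ℕ ↦ (2 * ‖ρ a - 1‖) ^ k * ‖ρ b - 1‖) Filter.atTop
      (nhds 0) := by
    simpa using (tendsto_pow_atTop_nhds_zero_of_lt_one (by positivity)
      (by linarith : 2 * ‖ρ a - 1‖ < 1)).mul_const ‖ρ b - 1‖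
  obtain ⟨k, hk⟩ := (hlim.eventually (gt_mem_nhds hδ)).exists
  exact hdescend k b hb (hmin _ ((hdecay k).trans_lt hk))

/-- **Jordan's theorem** for a finite group acting faithfully by elements of norm at most one. -/
theorem exists_isMulCommutative_index_le_of_norm_le_one [FiniteDimensional ℝ R] (ρ : F →* R)
    (hinj : Function.Injective ρ) (hρ : ∀ f, ‖ρ f‖ ≤ 1) :
    ∃ B : Subgroup F, IsMulCommutative B ∧ B.index ≤ 5 ^ Module.finrank ℝ R := by
  classical
  have := Fintype.ofFinite F
  let B : Subgroup F := Subgroup.closure {f | ‖ρ f - 1‖ < 1 / 2}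
  refine ⟨B, Subgroup.isMulCommutative_closure fun a ha b hb ↦
    (commute_of_norm_sub_one_lt ρ hinj hρ ha hb).eq, ?_⟩
  have hsep {x y : F} (h : x⁻¹ * y ∉ B) : 1 / 2 ≤ ‖ρ y - ρ x‖ := by
    by_contra! hlt
    refine h (Subgroup.subset_closure ?_)
    have : ρ (x⁻¹ * y) - 1 = ρ x⁻¹ * (ρ y - ρ x) := by
      rw [mul_sub, ← map_mul, ← map_mul, inv_mul_cancel, map_one]
    rw [Set.mem_ofPred_eq, this]
    exact ((norm_mul_le _ _).trans (mul_le_of_le_one_left (norm_nonneg _) (hρ _))).trans_lt hlt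
  let φ : F ⧸ B → R := fun q ↦ (2 : ℝ) • ρ q.out
  have hφ : Function.Injective φ := fun p q h ↦
    Quotient.out_injective (hinj (smul_right_injective R (two_ne_zero (α := ℝ)) h))
  rw [Subgroup.index_eq_card, Nat.card_eq_fintype_card, ← Finset.card_univ,
    ← Finset.card_image_of_injective _ hφ]
  refine Besicovitch.card_le_of_separated _ ?_ ?_
  · simp only [Finset.mem_image, Finset.mem_univ, true_and, forall_exists_index,
      forall_apply_eq_imp_iff]
    intro q
    rw [norm_smul, Real.norm_two]
    linarith [hρ q.out]
  · simp only [Finset.mem_image, Finset.mem_univ, true_and, forall_exists_index,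
      forall_apply_eq_imp_iff]
    intro p q hpq
    have hne : q.out⁻¹ * p.out ∉ B := by
      rw [← QuotientGroup.eq, QuotientGroup.out_eq', QuotientGroup.out_eq']
      rintro rfl
      exact hpq rfl
    rw [← smul_sub, norm_smul, Real.norm_two]
    linarith [hsep hne]

end BoundedRepresentation

open scoped Matrix Matrix.Norms.L2Operator MatrixOrder ComplexOrder in
/-- A finite group of complex matrices is conjugate to a group of unitary matrices. -/
theorem Matrix.exists_conj_mem_unitaryGroup {n F : Type*} [Fintype n] [DecidableEq n] [Group F]
    [Finite F] (ρ : F →* GL n ℂ) :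
    ∃ Q : GL n ℂ, ∀ f, ((Q * ρ f * Q⁻¹ : GL n ℂ) : Matrix n n ℂ) ∈ Matrix.unitaryGroup n ℂ := by
  have := Fintype.ofFinite F
  set H : Matrix n n ℂ := ∑ f : F, (ρ f : Matrix n n ℂ)ᴴ * (ρ f : Matrix n n ℂ) with hHdef
  have hH : H.PosDef := Matrix.posDef_sum Finset.univ_nonempty fun f _ ↦
    Matrix.PosDef.conjTranspose_mul_self _ (Matrix.mulVec_injective_of_isUnit (ρ f).isUnit)
  obtain ⟨q, hq⟩ := CStarAlgebra.nonneg_iff_eq_star_mul_self.mp hH.posSemidef.nonneg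
  have hqu : IsUnit q := by
    have := hH.isUnit
    rw [hq] at this
    exact isUnit_of_mul_isUnit_right this
  obtain ⟨Q, rfl⟩ := hqu
  have hinv (f : F) : (ρ f : Matrix n n ℂ)ᴴ * H * (ρ f : Matrix n n ℂ) = H := by
    rw [hHdef, Finset.mul_sum, Finset.sum_mul]
    refine Fintype.sum_equiv (Equiv.mulRight f) _ _ fun g ↦ ?_
    simp [Matrix.conjTranspose_mul, Matrix.mul_assoc]
  refine ⟨Q, fun f ↦ ?_⟩
  rw [Matrix.mem_unitaryGroup_iff']
  have hQ : (Q : Matrix n n ℂ) * ((Q⁻¹ : GL n ℂ) : Matrix n n ℂ) = 1 := Q.mul_inv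
  have hQ' : star ((Q⁻¹ : GL n ℂ) : Matrix n n ℂ) * star (Q : Matrix n n ℂ) = 1 := by
    rw [← star_mul, hQ, star_one]
  calc _ = star ((Q⁻¹ : GL n ℂ) : Matrix n n ℂ) * (star (ρ f : Matrix n n ℂ) *
          (star (Q : Matrix n n ℂ) * Q) * (ρ f : Matrix n n ℂ)) *
          ((Q⁻¹ : GL n ℂ) : Matrix n n ℂ) := by
        simp only [Units.val_mul, star_mul, mul_assoc]
    _ = star ((Q⁻¹ : GL n ℂ) : Matrix n n ℂ) * H * ((Q⁻¹ : GL n ℂ) : Matrix n n ℂ) := by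
        rw [← hq, Matrix.star_eq_conjTranspose (ρ f : Matrix n n ℂ), hinv]
    _ = (star ((Q⁻¹ : GL n ℂ) : Matrix n n ℂ) * star (Q : Matrix n n ℂ)) *
          ((Q : Matrix n n ℂ) * ((Q⁻¹ : GL n ℂ) : Matrix n n ℂ)) := by
        rw [hq]; simp only [mul_assoc]
    _ = 1 := by rw [hQ, hQ', one_mul]

open scoped Matrix.Norms.L2Operator in
/-- **Jordan's theorem** on finite groups of complex matrices. -/
theorem Matrix.exists_isMulCommutative_index_le {n : ℕ} (hn : 0 < n)
    (F : Subgroup (GL (Fin n) ℂ)) [Finite F] :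
    ∃ B : Subgroup F, IsMulCommutative B ∧ B.index ≤ 5 ^ (2 * n ^ 2) := by
  obtain ⟨Q, hQ⟩ := Matrix.exists_conj_mem_unitaryGroup F.subtype
  have : Nonempty (Fin n) := ⟨⟨0, hn⟩⟩
  let ρ : F →* Matrix (Fin n) (Fin n) ℂ :=
    (Units.coeHom _).comp ((MulAut.conj Q).toMonoidHom.comp F.subtype)
  have hρ : Function.Injective ρ :=
    Units.val_injective.comp ((MulAut.conj Q).injective.comp F.subtype_injective)
  have hfin : Module.finrank ℝ (Matrix (Fin n) (Fin n) ℂ) = 2 * n ^ 2 := by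
    rw [finrank_real_of_complex, Module.finrank_matrix]
    simp [sq]
  obtain ⟨B, hB, hle⟩ := exists_isMulCommutative_index_le_of_norm_le_one ρ hρ
    fun f ↦ (CStarRing.norm_of_mem_unitary (hQ f)).le
  exact ⟨B, hB, hfin ▸ hle⟩

/-- Commuting semisimple complex matrices are simultaneously diagonalizable. -/
theorem Matrix.exists_conj_eq_diagonal_of_pairwise_commute {n : ℕ} {ι : Type*}
    (T : ι → Matrix (Fin n) (Fin n) ℂ) (hT : Pairwise fun i j ↦ Commute (T i) (T j))
    (hs : ∀ i, Module.End.IsSemisimple (Matrix.toLin' (T i))) :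
    ∃ P : GL (Fin n) ℂ, ∀ i, ∃ d : Fin n → ℂ,
      (P : Matrix (Fin n) (Fin n) ℂ) * T i * ((P⁻¹ : GL (Fin n) ℂ) : Matrix (Fin n) (Fin n) ℂ) =
        Matrix.diagonal d := by
  have htop := Module.End.iSup_iInf_maxGenEigenspace_eq_top_of_iSup_maxGenEigenspace_eq_top_of_commute
    (fun i ↦ Matrix.toLin' (T i)) (fun i j hij ↦ (hT hij).map Matrix.toLinAlgEquiv')
    fun i ↦ Module.End.iSup_maxGenEigenspace_eq_top _
  simp_rw [(hs _).isFinitelySemisimple.maxGenEigenspace_eq_eigenspace] at htop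
  set W : Set (Fin n → ℂ) := {v | ∃ χ : ι → ℂ, ∀ i, (T i).mulVec v = χ i • v}
  have hspan : ⊤ ≤ Submodule.span ℂ W := by
    rw [← htop]
    refine iSup_le fun χ v hv ↦ Submodule.subset_span ⟨χ, fun i ↦ ?_⟩
    simpa using Module.End.mem_eigenspace_iff.mp (Submodule.mem_iInf _ |>.mp hv i)
  let b₀ := Module.Basis.ofSpan hspan
  have : Finite _ := Module.Finite.finite_basis b₀
  have := Fintype.ofFinite ((linearIndepOn_empty ℂ id).extend (Set.empty_subset W))
  let b : Module.Basis (Fin n) ℂ (Fin n → ℂ) := b₀.reindex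
    (Fintype.equivFinOfCardEq (by rw [← Module.finrank_eq_card_basis b₀, Module.finrank_fin_fun]))
  have hb (j : Fin n) : b j ∈ W :=
    Module.Basis.ofSpan_subset hspan (by rw [Module.Basis.reindex_apply]; exact ⟨_, rfl⟩)
  choose χ hχ using hb
  let e := Pi.basisFun ℂ (Fin n)
  let P : GL (Fin n) ℂ := ⟨b.toMatrix e, e.toMatrix b, b.toMatrix_mul_toMatrix_flip e,
    e.toMatrix_mul_toMatrix_flip b⟩
  refine ⟨P, fun i ↦ ⟨fun j ↦ χ j i, ?_⟩⟩
  have hTi : T i = LinearMap.toMatrix e e (Matrix.toLin' (T i)) := by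
    rw [LinearMap.toMatrix_eq_toMatrix', LinearMap.toMatrix'_toLin']
  calc b.toMatrix e * T i * e.toMatrix b = LinearMap.toMatrix b b (Matrix.toLin' (T i)) := by
        rw [hTi, basis_toMatrix_mul_linearMap_toMatrix_mul_basis_toMatrix, ← hTi]
    _ = _ := by
        ext k j
        rw [LinearMap.toMatrix_apply, Matrix.toLin'_apply, hχ, map_smul, b.repr_self,
          Finsupp.smul_apply, Finsupp.single_apply, Matrix.diagonal_apply]
        by_cases h : j = k
        · simp [h]
        · simp [h, Ne.symm h]

theorem Matrix.isDiagonalizable_of_isSemisimple {n : ℕ} {M : Matrix (Fin n) (Fin n) ℂ}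
    (hM : Module.End.IsSemisimple (Matrix.toLin' M)) : Matrix.IsDiagonalizable M := by
  obtain ⟨P, hP⟩ := Matrix.exists_conj_eq_diagonal_of_pairwise_commute (fun _ : Unit ↦ M)
    (fun i j hij ↦ (hij (Subsingleton.elim i j)).elim) fun _ ↦ hM
  exact ⟨P, hP ()⟩

open Polynomial in
theorem Module.End.isSemisimple_of_isSemisimple_pow {K V : Type*} [Field K] [CharZero K]
    [AddCommGroup V] [Module K V] [FiniteDimensional K V] {f : Module.End K V} (hf : IsUnit f)
    {m : ℕ} (hm : 0 < m) (h : (f ^ m).IsSemisimple) : f.IsSemisimple := by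
  set p := minpoly K (f ^ m)
  have hsep : p.Separable := PerfectField.separable_iff_squarefree.mpr h.minpoly_squarefree
  have h0 : ¬ X ∣ p := by
    rw [X_dvd_iff, coeff_zero_eq_eval_zero]
    intro hroot
    obtain ⟨v, hv⟩ := ((f ^ m).hasEigenvalue_iff_isRoot.mpr hroot).exists_hasEigenvector
    have hinj := ((Module.End.isUnit_iff _).mp (hf.pow m)).injective
    exact hv.2 (hinj (by rw [hv.apply_eq_smul, zero_smul, map_zero]))
  refine isSemisimple_of_squarefree_aeval_eq_zero (p := expand K m p) ?_ ?_
  · refine Separable.squarefree ?_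
    rw [separable_def, derivative_expand]
    have h₁ : IsCoprime (expand K m p) (expand K m (derivative p)) :=
      IsCoprime.map hsep (expand K m).toRingHom
    have h₂ : IsCoprime (expand K m p) X := by
      refine ((irreducible_X.coprime_iff_not_dvd).mpr ?_).symm
      rwa [X_dvd_iff, coeff_expand hm, if_pos (dvd_zero m), Nat.zero_div, ← X_dvd_iff]
    have h₃ : IsCoprime (expand K m p) (m : K[X]) := by
      have hunit : IsUnit (m : K[X]) := by
        rw [← map_natCast (C : K →+* K[X]), isUnit_C]
        exact (Nat.cast_ne_zero.mpr hm.ne').isUnit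
      exact isCoprime_one_right.of_isCoprime_of_dvd_right hunit.dvd
    exact h₁.mul_right (h₃.mul_right h₂.pow_right)
  · rw [expand_aeval, minpoly.aeval]

theorem Matrix.IsDiagonalizable.isSemisimple {n : ℕ} {M : Matrix (Fin n) (Fin n) ℂ}
    (hM : Matrix.IsDiagonalizable M) : Module.End.IsSemisimple (Matrix.toLin' M) := by
  obtain ⟨P, d, h⟩ := hM
  have hd : Module.End.IsSemisimple (Matrix.toLin' (Matrix.diagonal d)) := by
    refine Module.End.isSemisimple_of_squarefree_aeval_eq_zero
      (p := ∏ μ ∈ Finset.univ.image d, (Polynomial.X - Polynomial.C μ)) ?_ ?_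
    · exact (Polynomial.separable_prod_X_sub_C_iff'.mpr fun _ _ _ _ h ↦ h).squarefree
    · have h₁ (q : Polynomial ℂ) :
          Polynomial.aeval (Matrix.toLin' (Matrix.diagonal d)) q =
            Matrix.toLin' (Matrix.diagonal (Polynomial.aeval d q)) := by
        have := Polynomial.aeval_algHom_apply (Matrix.toLinAlgEquiv'.toAlgHom.comp
          (Matrix.diagonalAlgHom ℂ)) d q
        exact this
      rw [h₁]
      have h₂ : Polynomial.aeval d (∏ μ ∈ Finset.univ.image d,
          (Polynomial.X - Polynomial.C μ)) = 0 := by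
        ext i
        rw [Polynomial.aeval_fn_apply, Pi.zero_apply, map_prod]
        exact Finset.prod_eq_zero (Finset.mem_image_of_mem d (Finset.mem_univ i)) (by simp)
      rw [h₂, Matrix.diagonal_zero', map_zero]
  let e : (Fin n → ℂ) ≃ₗ[ℂ] (Fin n → ℂ) := Matrix.toLin'OfInv P.inv_mul P.mul_inv
  refine (LinearEquiv.isSemisimple_iff _ _ e ?_).mpr hd
  change Matrix.toLin' _ ∘ₗ Matrix.toLin' _ = Matrix.toLin' _ ∘ₗ Matrix.toLin' _
  rw [← Matrix.toLin'_mul, ← Matrix.toLin'_mul, ← h, mul_assoc, P.inv_mul, mul_one]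

theorem Subgroup.finiteIndex_and_index_le_of_map_eq {G X : Type*} [Group G] [Finite X]
    (H : Subgroup G) (f : G → X) (hf : ∀ g h, f g = f h → g⁻¹ * h ∈ H) :
    H.FiniteIndex ∧ H.index ≤ Nat.card X := by
  have hinj : Function.Injective fun q : G ⧸ H ↦ f q.out := by
    intro p q hpq
    rw [← QuotientGroup.out_eq' p, ← QuotientGroup.out_eq' q]
    exact QuotientGroup.eq.mpr (hf _ _ hpq)
  have : Finite (G ⧸ H) := Finite.of_injective _ hinj
  exact ⟨Subgroup.finiteIndex_of_finite_quotient, Nat.card_le_card_of_injective _ hinj⟩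

theorem Subgroup.finiteIndex_and_index_centralizer_le {n : ℕ} {G : Type*} [Group G]
    (ρ : G →* GL (Fin n) ℂ) (hρ : Function.Injective ρ) (A : Subgroup G) [hN : A.Normal]
    (hA : ∀ a ∈ A, ∃ d, (ρ a : Matrix (Fin n) (Fin n) ℂ) = Matrix.diagonal d) :
    (Subgroup.centralizer (A : Set G)).FiniteIndex ∧
      (Subgroup.centralizer (A : Set G)).index ≤ n ^ n := by
  have hσ (g : G) (i : Fin n) : ∃ j, ∀ a ∈ A, (ρ (g * a * g⁻¹)).val i i = (ρ a).val j j := by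
    obtain ⟨j, hj⟩ : ∃ j, (ρ g).val i j ≠ 0 := by
      by_contra! hzero
      have h := congrFun (congrFun (ρ g).mul_inv i) i
      simp [Matrix.mul_apply, hzero] at h
    refine ⟨j, fun a ha ↦ ?_⟩
    obtain ⟨d, hd⟩ := hA a ha
    obtain ⟨e, he⟩ := hA _ (hN.conj_mem a ha g)
    have h : (ρ (g * a * g⁻¹)).val * (ρ g).val = (ρ g).val * (ρ a).val := by
      rw [← Units.val_mul, ← Units.val_mul, ← map_mul, ← map_mul, inv_mul_cancel_right]
    have h' := congrFun (congrFun h i) j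
    rw [hd, he, Matrix.diagonal_mul, Matrix.mul_diagonal, mul_comm] at h'
    rw [hd, he, Matrix.diagonal_apply_eq, Matrix.diagonal_apply_eq]
    exact mul_left_cancel₀ hj h'
  choose σ hσ using hσ
  have key := Subgroup.finiteIndex_and_index_le_of_map_eq (Subgroup.centralizer (A : Set G)) σ ?_
  · simpa using key
  intro g h hgh
  rw [Subgroup.mem_centralizer_iff]
  intro a ha
  have heq : g * a * g⁻¹ = h * a * h⁻¹ := by
    refine hρ (Units.ext ?_)
    obtain ⟨d, hd⟩ := hA _ (hN.conj_mem a ha g)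
    obtain ⟨e, he⟩ := hA _ (hN.conj_mem a ha h)
    rw [hd, he]
    congr 1
    ext i
    have h₁ := hσ g i a ha
    have h₂ := hσ h i a ha
    rw [hd, Matrix.diagonal_apply_eq] at h₁
    rw [he, Matrix.diagonal_apply_eq] at h₂
    rw [h₁, h₂, hgh]
  calc a * (g⁻¹ * h) = g⁻¹ * (g * a * g⁻¹) * h := by group
    _ = g⁻¹ * h * a := by rw [heq]; group

/-- The embedding of the group of invertible diagonal matrices. -/
noncomputable def Matrix.diagonalUnits (n : ℕ) : (Fin n → ℂˣ) →* GL (Fin n) ℂ :=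
  (Units.map (Matrix.diagonalRingHom (Fin n) ℂ).toMonoidHom).comp
    MulEquiv.piUnits.symm.toMonoidHom

theorem Matrix.coe_diagonalUnits {n : ℕ} (d : Fin n → ℂˣ) :
    (Matrix.diagonalUnits n d : Matrix (Fin n) (Fin n) ℂ) =
      Matrix.diagonal fun i ↦ (d i : ℂ) := rfl

theorem Matrix.diagonalUnits_injective (n : ℕ) : Function.Injective (Matrix.diagonalUnits n) := by
  intro d e h
  have h' := congrArg Units.val h
  rw [Matrix.coe_diagonalUnits, Matrix.coe_diagonalUnits] at h'
  exact funext fun i ↦ Units.ext (congrFun (Matrix.diagonal_injective h') i)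

theorem finite_setOf_pi_units_pow_eq {n m : ℕ} (hm : 0 < m) (c : Fin n → ℂˣ) :
    {d : Fin n → ℂˣ | d ^ m = c}.Finite := by
  have h (i : Fin n) : {u : ℂˣ | u ^ m = c i}.Finite := by
    refine ((Polynomial.nthRoots m (c i : ℂ)).toFinset.finite_toSet.preimage
      Units.val_injective.injOn).subset fun u hu ↦ ?_
    rw [Set.mem_preimage, Finset.mem_coe, Multiset.mem_toFinset, Polynomial.mem_nthRoots hm,
      ← Units.val_pow_eq_pow_val, show u ^ m = c i from hu]
  exact (Set.Finite.pi' h).subset fun d hd i ↦ congrFun (show d ^ m = c from hd) i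

theorem Subgroup.exists_commute_index_le_of_le_center {n : ℕ} (hn : 0 < n) {C : Type*} [Group C]
    (ρ : C →* GL (Fin n) ℂ) (hρ : Function.Injective ρ) (A : Subgroup C)
    (hAc : A ≤ Subgroup.center C) [A.FiniteIndex]
    (hA : ∀ a ∈ A, ∃ d, (ρ a : Matrix (Fin n) (Fin n) ℂ) = Matrix.diagonal d) :
    ∃ H : Subgroup C, (∀ a ∈ H, ∀ b ∈ H, a * b = b * a) ∧ H.FiniteIndex ∧
      H.index ≤ 5 ^ (2 * n ^ 2) := by
  have : (Subgroup.center C).FiniteIndex := Subgroup.finiteIndex_of_le hAc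
  have hN : A.Normal := ⟨fun a ha g ↦ by
    rwa [(Subgroup.mem_center_iff.mp (hAc ha) g), mul_inv_cancel_right]⟩
  let δ := Matrix.diagonalUnits n
  let D : Subgroup (Fin n → ℂˣ) :=
    { carrier := {d | ∀ i j, (∀ a ∈ A, (ρ a).val i i = (ρ a).val j j) → d i = d j}
      mul_mem' := fun hx hy i j h ↦ congrArg₂ (· * ·) (hx i j h) (hy i j h)
      one_mem' := fun _ _ _ ↦ rfl
      inv_mem' := fun hx i j h ↦ congrArg (·⁻¹) (hx i j h) }
  have hcomm (g : C) (d : D) : Commute (ρ g) (δ.comp D.subtype d) := by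
    refine Units.ext ?_
    change (ρ g).val * Matrix.diagonal (fun i ↦ (d.1 i : ℂ)) =
      Matrix.diagonal (fun i ↦ (d.1 i : ℂ)) * (ρ g).val
    ext i j
    rw [Matrix.mul_diagonal, Matrix.diagonal_mul, mul_comm]
    by_cases hij : (ρ g).val i j = 0
    · rw [hij, mul_zero, mul_zero]
    · rw [d.2 i j fun a ha ↦ ?_]
      obtain ⟨e, he⟩ := hA a ha
      have h : (ρ a).val * (ρ g).val = (ρ g).val * (ρ a).val := by
        rw [← Units.val_mul, ← Units.val_mul, ← map_mul, ← map_mul,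
          Subgroup.mem_center_iff.mp (hAc ha) g]
      have h' := congrFun (congrFun h i) j
      rw [he, Matrix.diagonal_mul, Matrix.mul_diagonal, mul_comm] at h'
      rw [he, Matrix.diagonal_apply_eq, Matrix.diagonal_apply_eq]
      exact mul_left_cancel₀ hij h'
  have hAD : ∀ a ∈ A, ∃ d : D, ρ a = δ d := by
    intro a ha
    obtain ⟨e, he⟩ := hA a ha
    obtain ⟨e', he'⟩ := hA _ (A.inv_mem ha)
    have hne (i : Fin n) : (ρ a).val i i ≠ 0 := by
      have h : (ρ a).val * (ρ a⁻¹).val = 1 := by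
        rw [← Units.val_mul, ← map_mul, mul_inv_cancel, map_one, Units.val_one]
      have h' := congrFun (congrFun h i) i
      rw [he', Matrix.mul_diagonal, Matrix.one_apply_eq] at h'
      exact left_ne_zero_of_mul_eq_one h'
    refine ⟨⟨fun i ↦ Units.mk0 _ (hne i), fun i j h ↦ Units.ext (h a ha)⟩, Units.ext ?_⟩
    rw [Matrix.coe_diagonalUnits]
    simp [he]
  let μ : C × D →* GL (Fin n) ℂ := ρ.noncommCoprod (δ.comp D.subtype) hcomm
  have hμ (g : C) (d : D) : μ (g, d) = ρ g * δ d := rfl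
  set m := (Subgroup.center C).index * A.index with hmdef
  have hm : 0 < m := Nat.pos_of_ne_zero
    (mul_ne_zero Subgroup.FiniteIndex.index_ne_zero Subgroup.FiniteIndex.index_ne_zero)
  have hmul (g h : C) : (g * h) ^ m = g ^ m * h ^ m := by
    have ht : (g * h) ^ (Subgroup.center C).index =
        g ^ (Subgroup.center C).index * h ^ (Subgroup.center C).index :=
      congrArg Subtype.val (map_mul (MonoidHom.transferCenterPow C) g h)
    rw [hmdef, pow_mul, ht, pow_mul, pow_mul]
    exact Commute.mul_pow
      (Subgroup.mem_center_iff.mp ((Subgroup.center C).pow_index_mem h) _) _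
  have hmA (g : C) : g ^ m ∈ A := by
    rw [hmdef, mul_comm, pow_mul]
    exact A.pow_mem (A.pow_index_mem g) _
  let F : Subgroup (GL (Fin n) ℂ) := Subgroup.map μ
    { carrier := {p | μ p ^ m = 1}
      mul_mem' := fun {p q} hp hq ↦ by
        have hpq : (p * q) ^ m = p ^ m * q ^ m :=
          Prod.ext (hmul p.1 q.1) (mul_pow p.2 q.2 m)
        rw [Set.mem_ofPred_eq, ← map_pow] at hp hq ⊢
        rw [hpq, map_mul, hp, hq, one_mul]
      one_mem' := by simp
      inv_mem' := fun {p} hp ↦ by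
        rw [Set.mem_ofPred_eq] at hp ⊢
        rw [map_inv, inv_pow, hp, inv_one] }
  have hF {p : C × D} (hp : μ p ^ m = 1) : μ p ∈ F := ⟨p, hp, rfl⟩
  have hfin (y : GL (Fin n) ℂ) : {d : Fin n → ℂˣ | δ (d ^ m) = y}.Finite := by
    rcases Set.eq_empty_or_nonempty {d : Fin n → ℂˣ | δ (d ^ m) = y} with h | ⟨d₀, hd₀⟩
    · rw [h]; exact Set.finite_empty
    · exact (finite_setOf_pi_units_pow_eq hm (d₀ ^ m)).subset fun d hd ↦
        Matrix.diagonalUnits_injective n (Eq.trans hd (Eq.symm hd₀))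
  have : Finite F := by
    refine ((Set.finite_iUnion fun q : C ⧸ A ↦ (hfin (ρ (q.out ^ m))⁻¹).image
      fun d ↦ ρ q.out * δ d).subset ?_)
    rintro _ ⟨⟨g, d⟩, hp, rfl⟩
    have hr : (g : C ⧸ A).out⁻¹ * g ∈ A := by
      rw [← QuotientGroup.eq, QuotientGroup.out_eq']
    obtain ⟨e, he⟩ := hAD _ hr
    have hx : μ (g, d) = μ ((g : C ⧸ A).out, e * d) := by
      rw [hμ, hμ, Subgroup.coe_mul, map_mul, ← he, ← mul_assoc, ← map_mul, mul_inv_cancel_left]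
    refine Set.mem_iUnion.mpr ⟨g, (e * d : D), ?_, hx.symm⟩
    have hp' : μ ((g : C ⧸ A).out, e * d) ^ m = 1 := hx ▸ hp
    rw [← map_pow] at hp'
    exact (inv_eq_of_mul_eq_one_right hp').symm
  have hroot (u : ℂˣ) : ∃ v : ℂˣ, v ^ m = u := by
    obtain ⟨z, hz⟩ := IsAlgClosed.exists_pow_nat_eq (u : ℂ) hm
    have hz0 : z ≠ 0 := by
      rintro rfl
      exact u.ne_zero (by rw [← hz, zero_pow hm.ne'])
    exact ⟨Units.mk0 z hz0, Units.ext (by simpa using hz)⟩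
  choose root hroot using hroot
  have hw (g : C) : ∃ d : D, μ (g, d) ∈ F := by
    obtain ⟨e, he⟩ := hAD _ (hmA g)
    refine ⟨⟨fun i ↦ root ((e⁻¹ : D).1 i), fun i j h ↦ congrArg root ((e⁻¹ : D).2 i j h)⟩, hF ?_⟩
    rw [← map_pow]
    change ρ (g ^ m) * δ _ = 1
    rw [he, ← map_mul, ← map_one δ]
    congr 1
    ext i
    simp [hroot]
  choose w hw using hw
  obtain ⟨B, hB, hBle⟩ := Matrix.exists_isMulCommutative_index_le hn F
  let H : Subgroup C := ((B.map F.subtype).comap μ).map (MonoidHom.fst C D)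
  have hH := H.finiteIndex_and_index_le_of_map_eq
    (fun g ↦ ((⟨μ (g, w g), hw g⟩ : F) : F ⧸ B)) fun g h hgh ↦
      ⟨(g, w g)⁻¹ * (h, w h), ⟨_, QuotientGroup.eq.mp hgh,
        ((map_mul μ _ _).trans (by rw [map_inv]; rfl)).symm⟩, rfl⟩
  refine ⟨H, ?_, hH.1, hH.2.trans hBle⟩
  rintro _ ⟨⟨g, d⟩, ⟨x, hx, hxμ⟩, rfl⟩ _ ⟨⟨h, e⟩, ⟨y, hy, hyμ⟩, rfl⟩
  have hxy : x * y = y * x := setLike_mul_comm hx hy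
  have hμc : μ (g * h, d * e) = μ (h * g, d * e) := by
    have h₁ : μ (g * h, d * e) = μ (g, d) * μ (h, e) := by rw [← map_mul]; rfl
    have h₂ : μ (h * g, d * e) = μ (h, e) * μ (g, d) := by rw [← map_mul, mul_comm d e]; rfl
    rw [h₁, h₂, ← hxμ, ← hyμ, ← map_mul, ← map_mul, hxy]
  rw [hμ, hμ] at hμc
  exact hρ (mul_right_cancel hμc)

theorem Subgroup.exists_commute_index_le_of_diagonal {n : ℕ} (hn : 0 < n) {G : Type*} [Group G]
    (ρ : G →* GL (Fin n) ℂ) (hρ : Function.Injective ρ) (A : Subgroup G) [A.Normal]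
    [A.FiniteIndex] (hA : ∀ a ∈ A, ∃ d, (ρ a : Matrix (Fin n) (Fin n) ℂ) = Matrix.diagonal d) :
    ∃ H : Subgroup G, (∀ a ∈ H, ∀ b ∈ H, a * b = b * a) ∧ H.FiniteIndex ∧
      H.index ≤ 5 ^ (2 * n ^ 2) * n ^ n := by
  set C := Subgroup.centralizer (A : Set G)
  obtain ⟨hC, hCle⟩ := Subgroup.finiteIndex_and_index_centralizer_le ρ hρ A hA
  have hAc : A.subgroupOf C ≤ Subgroup.center C := fun a ha ↦ Subgroup.mem_center_iff.mpr
    fun g ↦ Subtype.ext (Subgroup.mem_centralizer_iff.mp g.2 a ha).symm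
  obtain ⟨H, hcomm, hfin, hle⟩ := Subgroup.exists_commute_index_le_of_le_center hn
    (ρ.comp C.subtype) (hρ.comp C.subtype_injective) (A.subgroupOf C) hAc fun a ha ↦ hA a ha
  have hindex : (H.map C.subtype).index = H.index * C.index := Subgroup.index_map_subtype H
  refine ⟨H.map C.subtype, ?_, ⟨?_⟩, ?_⟩
  · rintro _ ⟨a, ha, rfl⟩ _ ⟨b, hb, rfl⟩
    exact congrArg Subtype.val (hcomm a ha b hb)
  · rw [hindex]
    exact mul_ne_zero hfin.index_ne_zero hC.index_ne_zero
  · rw [hindex]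
    exact Nat.mul_le_mul hle hCle

theorem Subgroup.index_normalCore_dvd_factorial {G : Type*} [Group G] (H : Subgroup G)
    [H.FiniteIndex] : H.normalCore.index ∣ H.index.factorial := by
  rw [Subgroup.normalCore_eq_ker, Subgroup.index_ker, Subgroup.index_eq_card, ← Nat.card_perm]
  exact Subgroup.card_subgroup_dvd_card _

/-- There is a function `f : ℕ → ℕ` such that every finitely generated subgroup of `GL n ℂ`
containing a normal abelian finite-index subgroup of diagonalizable matrices contains such a
subgroup of index at most `f n`. -/
theorem exists_bound_index_diagonalizable_abelian_subgroup :
    ∃ f : ℕ → ℕ, ∀ (n : ℕ), 0 < n → ∀ (Γ : Subgroup (GL (Fin n) ℂ)), Group.FG ↥Γ →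
      (∃ H : Subgroup ↥Γ, GoodSubgroup Γ H) →
      ∃ H : Subgroup ↥Γ, GoodSubgroup Γ H ∧ H.index ≤ f n := by
  refine ⟨fun n ↦ (5 ^ (2 * n ^ 2) * n ^ n).factorial,
    fun n hn Γ _ ⟨A, hN, hfin, hcomm, hdiag⟩ ↦ ?_⟩
  obtain ⟨P, hP⟩ := Matrix.exists_conj_eq_diagonal_of_pairwise_commute
    (fun a : A ↦ ((a : Γ) : GL (Fin n) ℂ).val)
    (fun a b _ ↦ congrArg (fun x : A ↦ ((x : Γ) : GL (Fin n) ℂ).val) (hcomm a b))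
    fun a ↦ (hdiag a).isSemisimple
  obtain ⟨H, hHcomm, hHfin, hHle⟩ := Subgroup.exists_commute_index_le_of_diagonal hn
    ((MulAut.conj P).toMonoidHom.comp Γ.subtype)
    ((MulAut.conj P).injective.comp Γ.subtype_injective) A fun a ha ↦ hP ⟨a, ha⟩
  refine ⟨H.normalCore, ⟨inferInstance, inferInstance, fun a b ↦ Subtype.ext
    (hHcomm a (H.normalCore_le a.2) b (H.normalCore_le b.2)), fun h ↦ ?_⟩, ?_⟩
  · refine Matrix.isDiagonalizable_of_isSemisimple
      (Module.End.isSemisimple_of_isSemisimple_pow ?_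
        (Nat.pos_of_ne_zero hfin.index_ne_zero) ?_)
    · exact (((h : Γ) : GL (Fin n) ℂ).isUnit).map Matrix.toLinAlgEquiv'
    · rw [← Matrix.toLin'_pow]
      exact (hdiag ⟨_, A.pow_index_mem (h : Γ)⟩).isSemisimple
  · exact (Nat.le_of_dvd (Nat.factorial_pos _) H.index_normalCore_dvd_factorial).trans
      (Nat.factorial_le hHle)
end

section
/- For every positive integer n there exists a positive integer M = M(n), depending only on n, such that for every virtually solvable subgroup G ≤ GL_n(ℂ), the subgroup of GL_n(ℂ) generated by { g^M : g ∈ G } can be conjugated into 𝓑. -/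
/-- A group is virtually solvable if it has a solvable finite-index subgroup. -/
def IsVirtSolvable (G : Type*) [Group G] : Prop :=
  ∃ H : Subgroup G, H.FiniteIndex ∧ IsSolvable ↥H

/-- `M` is an upper triangular matrix. -/
def UpperTri {n : ℕ} (M : Matrix (Fin n) (Fin n) ℂ) : Prop :=
  ∀ i j : Fin n, j < i → M i j = 0

/-- The subgroup `Γ ≤ GL n ℂ` can be conjugated into the group `𝓑` of invertible upper
triangular matrices. -/
def ConjIntoB {n : ℕ} (Γ : Subgroup (GL (Fin n) ℂ)) : Prop :=
  ∃ X : GL (Fin n) ℂ, ∀ g ∈ Γ,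
    UpperTri ((X * g * X⁻¹ : GL (Fin n) ℂ) : Matrix (Fin n) (Fin n) ℂ)

open Module

/-- `S` is simultaneously triangularizable. -/
def Triangularizable {V : Type*} [AddCommGroup V] [Module ℂ V] (S : Set (End ℂ V)) : Prop :=
  ∃ (m : ℕ) (b : Basis (Fin m) ℂ V), ∀ s ∈ S, ∀ i j, j < i → b.repr (s (b j)) i = 0

theorem Triangularizable.mono {V : Type*} [AddCommGroup V] [Module ℂ V] {S T : Set (End ℂ V)}
    (hT : Triangularizable T) (h : S ⊆ T) : Triangularizable S := by
  obtain ⟨m, b, hb⟩ := hT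
  exact ⟨m, b, fun s hs => hb s (h hs)⟩

theorem triangularizable_of_finrank_le_one {V : Type*} [AddCommGroup V] [Module ℂ V]
    [FiniteDimensional ℂ V] (h : finrank ℂ V ≤ 1) (S : Set (End ℂ V)) : Triangularizable S :=
  ⟨_, finBasis ℂ V, fun _ _ i j hij => by have := i.2; have := j.2; omega⟩

/-- Triangular bases of an invariant subspace and of the quotient by it glue together. -/
theorem triangularizable_of_submodule {V : Type*} [AddCommGroup V] [Module ℂ V] {ι : Type*}
    (f : ι → End ℂ V) (U : Submodule ℂ V) (hU : ∀ i, U ≤ U.comap (f i))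
    (h₁ : Triangularizable (Set.range fun i => (f i).restrict (hU i)))
    (h₂ : Triangularizable (Set.range fun i => U.mapQ U (f i) (hU i))) :
    Triangularizable (Set.range f) := by
  obtain ⟨k, b, hb⟩ := h₁
  obtain ⟨l, c, hc⟩ := h₂
  refine ⟨k + l, (Basis.sumQuot b c).reindex finSumFinEquiv, ?_⟩
  rintro _ ⟨s, rfl⟩ i j hij
  induction i using Fin.addCases with
  | left i =>
    induction j using Fin.addCases with
    | left j =>
      have := hb _ ⟨s, rfl⟩ i j (Fin.lt_def.2 (Fin.lt_def.1 hij))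
      simp only [Basis.repr_reindex_apply, Basis.reindex_apply, finSumFinEquiv_symm_apply_castAdd,
        Basis.sumQuot_inl]
      rw [Basis.sumQuot_repr_inl_of_mem b c _ (hU s (b j).2)]
      exact this
    | right j =>
      simp [Fin.lt_def] at hij
      have := i.2
      omega
  | right i =>
    simp only [Basis.repr_reindex_apply, Basis.reindex_apply, finSumFinEquiv_symm_apply_natAdd,
        Basis.sumQuot_repr_inr]
    induction j using Fin.addCases with
    | left j =>
      have : U.mkQ (f s (b j)) = 0 := by simpa using hU s (b j).2
      simp [Basis.sumQuot_inl, -Submodule.mkQ_apply, this]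
    | right j =>
      have := hc _ ⟨s, rfl⟩ i j
        (Fin.lt_def.2 (Nat.lt_of_add_lt_add_left (Fin.lt_def.1 hij)))
      simp only [← Basis.sumQuot_inr b c j, Submodule.mapQ_apply] at this
      simpa using this

/-- Commuting operators have a common eigenvector. -/
theorem exists_common_eigenvector {V : Type*} [AddCommGroup V] [Module ℂ V]
    [FiniteDimensional ℂ V] [Nontrivial V] {ι : Type*} (f : ι → End ℂ V)
    (hf : ∀ i j, Commute (f i) (f j)) : ∃ (χ : ι → ℂ) (v : V), v ≠ 0 ∧ ∀ i, f i v = χ i • v := by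
  obtain ⟨W, ⟨hW0, hW⟩, hmin⟩ := WellFounded.has_min (wellFounded_lt (α := Submodule ℂ V))
    {W | W ≠ ⊥ ∧ ∀ i, W ≤ W.comap (f i)} ⟨⊤, by simp, by simp⟩
  have key : ∀ i, ∃ c : ℂ, ∀ w ∈ W, f i w = c • w := by
    intro i
    have : Nontrivial W := Submodule.nontrivial_iff_ne_bot.2 hW0
    obtain ⟨c, hc⟩ := End.exists_eigenvalue ((f i).restrict (hW i))
    obtain ⟨w, hw, hw0⟩ := hc.exists_hasEigenvector
    have hle : W ⊓ End.eigenspace (f i) c = W := by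
      by_contra hne
      refine hmin (W ⊓ End.eigenspace (f i) c) ⟨?_, fun j => ?_⟩ (lt_of_le_of_ne inf_le_left hne)
      · refine (Submodule.ne_bot_iff _).2 ⟨w, ⟨w.2, ?_⟩, by simpa using hw0⟩
        simpa [Subtype.ext_iff] using End.mem_eigenspace_iff.1 hw
      · rintro x ⟨hx, hx'⟩
        refine ⟨hW j hx, ?_⟩
        have := LinearMap.congr_fun (hf i j) x
        simp only [SetLike.mem_coe, End.mem_eigenspace_iff, End.mul_apply] at hx' this ⊢
        rw [this, hx', map_smul]
    refine ⟨c, fun w hw => ?_⟩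
    rw [← hle] at hw
    exact End.mem_eigenspace_iff.1 hw.2
  choose χ hχ using key
  obtain ⟨v, hv, hv0⟩ := (Submodule.ne_bot_iff _).1 hW0
  exact ⟨χ, v, hv0, fun i => hχ i v hv⟩

/-- Common eigenvectors with pairwise distinct weights are linearly independent. -/
theorem linearIndependent_of_common_eigenvectors {V : Type*} [AddCommGroup V] [Module ℂ V]
    {ι κ : Type*} (f : ι → End ℂ V) (hf : ∀ i j, Commute (f i) (f j)) (χ : κ → ι → ℂ)
    (hχ : Function.Injective χ) (v : κ → V) (hv0 : ∀ k, v k ≠ 0)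
    (hv : ∀ k i, f i (v k) = χ k i • v k) : LinearIndependent ℂ v := by
  have h : iSupIndep fun χ : ι → ℂ => ⨅ i, (f i).maxGenEigenspace (χ i) :=
    End.independent_iInf_maxGenEigenspace_of_forall_mapsTo f
      fun i j c => End.mapsTo_maxGenEigenspace_of_comm (hf j i) c
  have h' : iSupIndep fun k => ⨅ i, (f i).maxGenEigenspace (χ k i) := h.comp hχ
  refine h'.linearIndependent _ (fun k => ?_) hv0
  refine (Submodule.mem_iInf _).2 fun i => ?_
  have : v k ∈ End.eigenspace (f i) (χ k i) := End.mem_eigenspace_iff.2 (hv k i)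
  exact (f i).genEigenspace_le_maximal _ 1 this

/-- A normal subgroup acting by commuting, not all scalar, operators forces a subgroup containing
all `(dim V)!`-th powers to act reducibly. -/
theorem exists_reducible_of_normal_commuting {Γ V : Type*} [Group Γ] [AddCommGroup V] [Module ℂ V]
    [FiniteDimensional ℂ V] (ρ : Representation ℂ Γ V) (A : Subgroup Γ) [hA : A.Normal]
    (hcomm : ∀ a ∈ A, ∀ b ∈ A, Commute (ρ a) (ρ b))
    {a : Γ} (ha : a ∈ A) (hns : ∀ c : ℂ, ρ a ≠ c • 1) :
    ∃ H : Subgroup Γ, (∀ g, g ^ (finrank ℂ V).factorial ∈ H) ∧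
      ∃ U : Submodule ℂ V, U ≠ ⊥ ∧ U ≠ ⊤ ∧ ∀ h ∈ H, U ≤ U.comap (ρ h) := by
  have : Nontrivial V := by
    by_contra hV
    rw [not_nontrivial_iff_subsingleton] at hV
    exact hns 0 (LinearMap.ext fun x => Subsingleton.elim _ _)
  have hf : ∀ i j : A, Commute (ρ i) (ρ j) := fun i j => hcomm i i.2 j j.2
  obtain ⟨χ, v, hv0, hv⟩ := exists_common_eigenvector (fun a : A => ρ a) hf
  let cj : Γ → A → A := fun g a => ⟨g⁻¹ * a * g, by simpa using hA.conj_mem a a.2 g⁻¹⟩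
  have cj_mul : ∀ g h a, cj (g * h) a = cj h (cj g a) := fun g h a => by
    simp [cj, mul_assoc]
  have cj_one : ∀ a, cj 1 a = a := fun a => by simp [cj]
  have hρ : ∀ g (a : A) w, ρ a (ρ g w) = ρ g (ρ (cj g a) w) := fun g a w => by
    simp only [cj, ← End.mul_apply, ← map_mul]
    congr 2
    group
  let H : Subgroup Γ :=
    { carrier := {g | ∀ a, χ (cj g a) = χ a}
      one_mem' := fun a => by rw [cj_one]
      mul_mem' := fun {g h} hg hh a => by rw [cj_mul, hh, hg]
      inv_mem' := fun {g} hg a => by rw [← hg, ← cj_mul, inv_mul_cancel, cj_one] }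
  refine ⟨H, fun g => ?_, ⨅ a : A, End.eigenspace (ρ a) (χ a), ?_, ?_, ?_⟩
  · have hninj : ¬ Function.Injective fun (k : Fin (finrank ℂ V + 1)) (a : A) =>
        χ (cj (g ^ (k : ℕ)) a) := by
      intro hinj
      have := (linearIndependent_of_common_eigenvectors (fun a : A => ρ a) hf _ hinj
        (fun k => ρ (g ^ (k : ℕ)) v) (fun k h0 => hv0 ?_)
        (fun k a => by rw [hρ, hv, map_smul])).fintype_card_le_finrank
      · simp at this
      · have := congrArg (ρ (g ^ (k : ℕ))⁻¹) h0
        simpa only [← End.mul_apply, ← map_mul, inv_mul_cancel, map_one, End.one_apply,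
          map_zero] using this
    have key : ∀ i j : ℕ, i < j → j ≤ finrank ℂ V →
        (∀ a, χ (cj (g ^ i) a) = χ (cj (g ^ j) a)) → g ^ (finrank ℂ V).factorial ∈ H := by
      intro i j hij hj h
      have hmem : g ^ (j - i) ∈ H := fun a => by
        have := h (cj (g ^ i)⁻¹ a)
        rw [← cj_mul, ← cj_mul, inv_mul_cancel, cj_one] at this
        rw [this]
        congr 2
        rw [eq_inv_mul_iff_mul_eq, ← pow_add]
        congr 1; omega
      obtain ⟨d, hd⟩ := Nat.dvd_factorial (show 0 < j - i by omega)
        (show j - i ≤ finrank ℂ V by omega)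
      rw [hd, pow_mul]
      exact H.pow_mem hmem d
    simp only [Function.Injective, not_forall] at hninj
    obtain ⟨i, j, hij, hne⟩ := hninj
    rcases lt_or_gt_of_ne hne with h | h
    · exact key i j h (by omega) fun a => congrFun hij a
    · exact key j i h (by omega) fun a => (congrFun hij a).symm
  · refine (Submodule.ne_bot_iff _).2 ⟨v, (Submodule.mem_iInf _).2 fun a => ?_, hv0⟩
    exact End.mem_eigenspace_iff.2 (hv a)
  · intro htop
    refine hns (χ ⟨a, ha⟩) (LinearMap.ext fun x => ?_)
    have hx : x ∈ ⨅ a : A, End.eigenspace (ρ a) (χ a) := htop ▸ Submodule.mem_top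
    simpa using End.mem_eigenspace_iff.1 ((Submodule.mem_iInf _).1 hx ⟨a, ha⟩)
  · intro h hh x hx
    refine (Submodule.mem_iInf _).2 fun a => End.mem_eigenspace_iff.2 ?_
    rw [hρ, End.mem_eigenspace_iff.1 ((Submodule.mem_iInf _).1 hx (cj h a)), map_smul, hh a]

section CentralFinite

variable {n : ℕ}

theorem exists_smul_of_mem_center {z : GL (Fin n) ℂ} (hz : z ∈ Subgroup.center (GL (Fin n) ℂ)) :
    ∃ c : ℂ, (z : Matrix (Fin n) (Fin n) ℂ) = c • 1 := by
  obtain ⟨c, hc⟩ := Matrix.GeneralLinearGroup.mem_center_iff_val_mem_range_scalar.1 hz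
  exact ⟨c, by rw [← hc, Matrix.scalar_apply, Matrix.smul_one_eq_diagonal]⟩

theorem mem_center_of_eq_smul {z : GL (Fin n) ℂ} {c : ℂ}
    (hz : (z : Matrix (Fin n) (Fin n) ℂ) = c • 1) : z ∈ Subgroup.center (GL (Fin n) ℂ) :=
  Matrix.GeneralLinearGroup.mem_center_iff_val_mem_range_scalar.2
    ⟨c, by rw [hz, Matrix.scalar_apply, Matrix.smul_one_eq_diagonal]⟩

/-- A coset of the center has finitely many elements of given determinant. -/
theorem finite_center_coset_det (hn : n ≠ 0) (g : GL (Fin n) ℂ) (δ : ℂ) :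
    {x : GL (Fin n) ℂ | (x : Matrix (Fin n) (Fin n) ℂ).det = δ ∧
      x * g⁻¹ ∈ Subgroup.center (GL (Fin n) ℂ)}.Finite := by
  have hg : (g : Matrix (Fin n) (Fin n) ℂ).det ≠ 0 := g.det_ne_zero
  have hfin : {c : ℂ | c ^ n = δ / (g : Matrix (Fin n) (Fin n) ℂ).det}.Finite := by
    refine (Polynomial.nthRootsFinset n (δ / (g : Matrix (Fin n) (Fin n) ℂ).det)).finite_toSet.subset
      fun c hc => ?_
    simpa [Polynomial.mem_nthRootsFinset (Nat.pos_of_ne_zero hn)] using hc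
  refine ((hfin.image fun c => c • (g : Matrix (Fin n) (Fin n) ℂ)).preimage
    (f := fun x : GL (Fin n) ℂ => (x : Matrix (Fin n) (Fin n) ℂ))
    Units.val_injective.injOn).subset ?_
  rintro x ⟨hx, hz⟩
  obtain ⟨c, hc⟩ := exists_smul_of_mem_center hz
  have hxg : (x : Matrix (Fin n) (Fin n) ℂ) = c • (g : Matrix (Fin n) (Fin n) ℂ) := by
    have : x = (x * g⁻¹) * g := by group
    rw [this, Units.val_mul, hc, smul_mul_assoc, one_mul]
  refine ⟨c, ?_, hxg.symm⟩
  rw [Set.mem_ofPred_eq, eq_div_iff hg, ← hx, hxg, Matrix.det_smul, Fintype.card_fin]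

end CentralFinite

/-- If `f` takes finitely many values on `N` and its fibres lie in left cosets of `K`, then `K` has
finite relative index in `N`. -/
theorem Subgroup.relIndex_ne_zero_of_finite_image {Γ α : Type*} [Group Γ] (K N : Subgroup Γ)
    (f : Γ → α) (hfin : (f '' N).Finite)
    (hf : ∀ a ∈ N, ∀ b ∈ N, f a = f b → a⁻¹ * b ∈ K) : K.relIndex N ≠ 0 := by
  have := hfin.to_subtype
  have hinj : Function.Injective fun q : N ⧸ K.subgroupOf N =>
      (⟨f (q.out : N), Set.mem_image_of_mem f (q.out : N).2⟩ : f '' N) := by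
    intro p q hpq
    rw [← p.out_eq', ← q.out_eq', QuotientGroup.eq]
    exact hf _ p.out.2 _ q.out.2 (congrArg Subtype.val hpq)
  have := Finite.of_injective _ hinj
  exact (Subgroup.finiteIndex_of_finite_quotient (H := K.subgroupOf N)).index_ne_zero

section SolvableModCenter

variable {Γ : Type*} [Group Γ] {n : ℕ} (ρ : Γ →* GL (Fin n) ℂ)

/-- The elements of `Γ` whose image under `ρ` commutes with `ρ x` for all `x ∈ D`. -/
def centralizerOf (D : Subgroup Γ) : Subgroup Γ :=
  (Subgroup.centralizer (D.map ρ : Set (GL (Fin n) ℂ))).comap ρ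

theorem mem_centralizerOf {D : Subgroup Γ} {c : Γ} :
    c ∈ centralizerOf ρ D ↔ ∀ d ∈ D, Commute (ρ d) (ρ c) := by
  simp [centralizerOf, Subgroup.mem_centralizer_iff, Commute, SemiconjBy]

instance centralizerOf_normal (D : Subgroup Γ) [hD : D.Normal] : (centralizerOf ρ D).Normal := by
  refine ⟨fun c hc g => (mem_centralizerOf ρ).2 fun d hd => ?_⟩
  have := (mem_centralizerOf ρ).1 hc _ (hD.conj_mem d hd g⁻¹)
  have h2 := congrArg (fun x => ρ g * x * ρ g⁻¹) this.eq
  simp only [← map_mul] at h2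
  simp only [Commute, SemiconjBy, ← map_mul]
  convert h2 using 2 <;> group

/-- The elements acting by scalars. -/
def scalarSubgroup : Subgroup Γ := (Subgroup.center (GL (Fin n) ℂ)).comap ρ

instance scalarSubgroup_normal : (scalarSubgroup ρ).Normal :=
  inferInstanceAs ((Subgroup.center (GL (Fin n) ℂ)).comap ρ).Normal

theorem det_map_conj (g x : Γ) : (ρ (g * x * g⁻¹) : Matrix (Fin n) (Fin n) ℂ).det =
    (ρ x : Matrix (Fin n) (Fin n) ℂ).det := by
  rw [map_mul, map_mul, map_inv]
  exact Matrix.det_units_conj (ρ g) _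

theorem mem_scalarSubgroup {z : Γ} : z ∈ scalarSubgroup ρ ↔ ρ z ∈ Subgroup.center _ := Iff.rfl

theorem commute_of_mem_scalarSubgroup {z : Γ} (hz : z ∈ scalarSubgroup ρ) (g : GL (Fin n) ℂ) :
    Commute g (ρ z) :=
  Subgroup.mem_center_iff.1 hz g

/-- If `D` is normal and finite modulo scalars, its centralizer has finite relative index. -/
theorem relIndex_centralizerOf_ne_zero (hn : n ≠ 0) (D N : Subgroup Γ) [hD : D.Normal]
    (hfin : (scalarSubgroup ρ).relIndex D ≠ 0) : (centralizerOf ρ D).relIndex N ≠ 0 := by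
  have : Finite (D ⧸ (scalarSubgroup ρ).subgroupOf D) := by
    have : ((scalarSubgroup ρ).subgroupOf D).FiniteIndex := ⟨hfin⟩
    infer_instance
  have hrep : ∀ d ∈ D, ∃ q : D ⧸ (scalarSubgroup ρ).subgroupOf D,
      (q.out : Γ)⁻¹ * d ∈ scalarSubgroup ρ := fun d hd =>
    ⟨QuotientGroup.mk ⟨d, hd⟩, by
      have := QuotientGroup.mk_out_eq_mul ((scalarSubgroup ρ).subgroupOf D) ⟨d, hd⟩
      obtain ⟨h, hh⟩ := this
      rw [hh]
      have h3 := (scalarSubgroup ρ).inv_mem (Subgroup.mem_subgroupOf.1 h.2)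
      simpa using h3⟩
  refine Subgroup.relIndex_ne_zero_of_finite_image _ N
    (fun g (q : D ⧸ (scalarSubgroup ρ).subgroupOf D) => ρ (g * q.out * g⁻¹)) ?_ ?_
  · refine (Set.Finite.pi' fun q : D ⧸ (scalarSubgroup ρ).subgroupOf D =>
      Set.finite_iUnion fun p : D ⧸ (scalarSubgroup ρ).subgroupOf D =>
        finite_center_coset_det hn (ρ p.out)
          (ρ q.out : Matrix (Fin n) (Fin n) ℂ).det).subset ?_
    rintro _ ⟨g, -, rfl⟩ q
    obtain ⟨p, hp⟩ := hrep _ (hD.conj_mem _ q.out.2 g)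
    refine Set.mem_iUnion.2 ⟨p, ?_, ?_⟩
    · exact det_map_conj ρ g _
    · simpa [mem_scalarSubgroup] using Subgroup.Normal.mem_comm inferInstance hp
  · intro a _ b _ hab
    refine (mem_centralizerOf ρ).2 fun d hd => ?_
    obtain ⟨q, hq⟩ := hrep d hd
    have h1 := congrFun hab q
    have h2 : Commute (ρ (q.out : Γ)) (ρ (a⁻¹ * b)) := by
      have h3 := congrArg (fun x => ρ a⁻¹ * x * ρ b) h1
      simp only [← map_mul] at h3
      simp only [Commute, SemiconjBy, ← map_mul]
      convert h3 using 2 <;> group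
    have h4 := h2.mul_left (commute_of_mem_scalarSubgroup ρ hq (ρ (a⁻¹ * b))).symm
    rwa [← map_mul, mul_inv_cancel_left] at h4

/-- A normal subgroup `C` commuting modulo scalars is finite modulo scalars, provided that its own
centralizer in `C` consists of scalars. -/
theorem relIndex_scalarSubgroup_ne_zero_of_commutator_le (hn : n ≠ 0) (C : Subgroup Γ)
    (hcomm : ⁅C, C⁆ ≤ scalarSubgroup ρ) (hcent : C ⊓ centralizerOf ρ C ≤ scalarSubgroup ρ) :
    (scalarSubgroup ρ).relIndex C ≠ 0 := by
  obtain ⟨T, hTC, hT⟩ := (Submodule.fg_span_iff_fg_span_finset_subset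
    ((fun c => (ρ c : Matrix (Fin n) (Fin n) ℂ)) '' C)).1
      (IsNoetherian.noetherian (R := ℂ) _)
  choose! t ht using fun x (hx : x ∈ T) => hTC hx
  refine Subgroup.relIndex_ne_zero_of_finite_image _ C
    (fun g (x : T) => ρ (g * t x * g⁻¹)) ?_ ?_
  · refine (Set.Finite.pi' fun x : T => finite_center_coset_det hn (ρ (t x))
      (ρ (t x) : Matrix (Fin n) (Fin n) ℂ).det).subset ?_
    rintro _ ⟨g, hg, rfl⟩ x
    refine ⟨det_map_conj ρ g _, ?_⟩
    rw [← map_inv, ← map_mul]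
    exact hcomm (Subgroup.commutator_mem_commutator hg (ht x x.2).1)
  · intro a ha b hb hab
    refine hcent ⟨C.mul_mem (C.inv_mem ha) hb, (mem_centralizerOf ρ).2 fun d hd => ?_⟩
    have hspan : (ρ d : Matrix (Fin n) (Fin n) ℂ) ∈ Submodule.span ℂ (T : Set _) :=
      hT ▸ Submodule.subset_span ⟨d, hd, rfl⟩
    suffices h : Commute (ρ d : Matrix (Fin n) (Fin n) ℂ) (ρ (a⁻¹ * b) : Matrix (Fin n) (Fin n) ℂ)
      from Units.ext h
    generalize (ρ d : Matrix (Fin n) (Fin n) ℂ) = y at hspan ⊢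
    induction hspan using Submodule.span_induction with
    | mem x hx =>
      rw [← (ht x hx).2]
      have h3 := congrArg (fun x => ρ a⁻¹ * x * ρ b) (congrFun hab ⟨x, hx⟩)
      simp only [← map_mul] at h3
      have h2 : Commute (ρ (t x)) (ρ (a⁻¹ * b)) := by
        simp only [Commute, SemiconjBy, ← map_mul]
        convert h3 using 2 <;> group
      exact congrArg Units.val h2
    | zero => exact Commute.zero_left _
    | add x y _ _ hx hy => exact hx.add_left hy
    | smul c x _ hx => exact hx.smul_left c

/-- If normal subgroups acting by commuting operators act by scalars, then the scalars have finite
index in a virtually solvable group. -/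
theorem index_scalarSubgroup_ne_zero (hn : n ≠ 0)
    (hA : ∀ A : Subgroup Γ, A.Normal → (∀ a ∈ A, ∀ b ∈ A, Commute (ρ a) (ρ b)) →
      A ≤ scalarSubgroup ρ)
    (H : Subgroup Γ) [H.Normal] [H.FiniteIndex] [hH : Group.IsSolvable H] :
    (scalarSubgroup ρ).index ≠ 0 := by
  have step : ∀ N : Subgroup Γ, N.Normal → (scalarSubgroup ρ).relIndex ⁅N, N⁆ ≠ 0 →
      (scalarSubgroup ρ).relIndex N ≠ 0 := by
    intro N hN hD
    have hCN : (N ⊓ centralizerOf ρ ⁅N, N⁆).relIndex N ≠ 0 := by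
      rw [Subgroup.inf_relIndex_left]
      exact relIndex_centralizerOf_ne_zero ρ hn _ N hD
    refine Subgroup.relIndex_ne_zero_trans ?_ hCN
    set C := N ⊓ centralizerOf ρ ⁅N, N⁆ with hC
    have hCnormal : C.Normal := inferInstance
    have h1 : ⁅C, C⁆ ≤ ⁅N, N⁆ := Subgroup.commutator_mono inf_le_left inf_le_left
    have h2 : ⁅C, C⁆ ≤ C := Subgroup.commutator_le_left C C
    refine relIndex_scalarSubgroup_ne_zero_of_commutator_le ρ hn C ?_ ?_
    · exact hA _ inferInstance fun a ha b hb =>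
        (mem_centralizerOf ρ).1 (h2 hb).2 a (h1 ha)
    · exact hA _ inferInstance fun a ha b hb => (mem_centralizerOf ρ).1 hb.2 a ha.1
  have hD : ∀ k, ((derivedSeries H k).map H.subtype).Normal := by
    intro k
    induction k with
    | zero => rwa [derivedSeries_zero, ← MonoidHom.range_eq_map, Subgroup.range_subtype]
    | succ k ih =>
      rw [derivedSeries_succ, Subgroup.map_commutator]
      infer_instance
  obtain ⟨k, hk⟩ := hH.solvable
  have key : ∀ j, j ≤ k → (scalarSubgroup ρ).relIndex ((derivedSeries H j).map H.subtype) ≠ 0 := by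
    intro j hj
    induction hj using Nat.decreasingInduction with
    | self => simp [hk]
    | of_succ j _ ih =>
      rw [derivedSeries_succ, Subgroup.map_commutator] at ih
      exact step _ (hD j) ih
  have h0 := key 0 (Nat.zero_le k)
  have h0' : (scalarSubgroup ρ).relIndex H ≠ 0 := by
    rwa [derivedSeries_zero, ← MonoidHom.range_eq_map, Subgroup.range_subtype] at h0
  have := Subgroup.relIndex_ne_zero_trans (L := ⊤) h0'
    (by simpa using Subgroup.FiniteIndex.index_ne_zero (H := H))
  simpa using this

end SolvableModCenter

/-- Some power with exponent at most `K` of any unitary element is close to `1`. -/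
theorem exists_pow_near_one {E : Type*} [NormedRing E] [StarRing E] [CStarRing E]
    [NormedAlgebra ℂ E] [FiniteDimensional ℂ E] {ε : ℝ} (hε : 0 < ε) :
    ∃ K : ℕ, ∀ u ∈ unitary E, ∃ k, 0 < k ∧ k ≤ K ∧ ‖u ^ k - 1‖ < ε := by
  have : ProperSpace E := FiniteDimensional.proper ℂ E
  obtain ⟨t, ht, hcov⟩ := Metric.totallyBounded_iff.1
    (isCompact_closedBall (0 : E) 1).totallyBounded (ε / 2) (half_pos hε)
  lift t to Finset E using ht
  refine ⟨t.card, fun u hu => ?_⟩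
  have hmem : ∀ i : ℕ, u ^ i ∈ unitary E := fun i => pow_mem hu i
  have hc : ∀ i : ℕ, ∃ y ∈ t, dist (u ^ i) y < ε / 2 := fun i => by
    have h1 : ‖u ^ i‖ ≤ 1 := by
      rcases subsingleton_or_nontrivial E with h | h
      · rw [Subsingleton.elim (u ^ i) 0, norm_zero]; exact zero_le_one
      · exact (CStarRing.norm_of_mem_unitary (hmem i)).le
    simpa using hcov (mem_closedBall_zero_iff.2 h1)
  choose y hyt hy using hc
  obtain ⟨i, hi, j, hj, hne, hij⟩ := Finset.exists_ne_map_eq_of_card_lt_of_maps_to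
    (s := Finset.range (t.card + 1)) (t := t) (by simp) (f := y) fun i _ => hyt i
  have key : ∀ i j : ℕ, i < j → j ≤ t.card → y i = y j →
      ∃ k, 0 < k ∧ k ≤ t.card ∧ ‖u ^ k - 1‖ < ε := by
    intro i j hij hj h
    refine ⟨j - i, by omega, by omega, ?_⟩
    have h1 : dist (u ^ j) (u ^ i) < ε := by
      have h2 := hy i
      rw [h] at h2
      linarith [hy j, dist_triangle_right (u ^ j) (u ^ i) (y j)]
    rw [dist_eq_norm] at h1
    rwa [← CStarRing.norm_mem_unitary_mul _ (hmem i), mul_sub, ← pow_add, mul_one,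
      Nat.add_sub_cancel' hij.le]
  simp only [Finset.mem_range] at hi hj
  rcases lt_or_gt_of_ne hne with h | h
  · exact key i j h (by omega) hij
  · exact key j i h (by omega) hij.symm

/-- `n`-th roots of unity close to `1` are equal to `1`. -/
theorem exists_root_of_unity_gap {n : ℕ} (hn : n ≠ 0) :
    ∃ ε : ℝ, 0 < ε ∧ ∀ ζ : ℂ, ζ ^ n = 1 → ‖ζ - 1‖ < ε → ζ = 1 := by
  let s := (Polynomial.nthRootsFinset n (1 : ℂ)).erase 1
  obtain ⟨ε, hε, h⟩ := Metric.isOpen_iff.1 s.finite_toSet.isClosed.isOpen_compl (1 : ℂ) (by simp [s])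
  refine ⟨ε, hε, fun ζ hζ hd => ?_⟩
  by_contra hne
  refine h (a := ζ) (by simpa [dist_eq_norm] using hd) ?_
  simp [s, hne, Polynomial.mem_nthRootsFinset (Nat.pos_of_ne_zero hn), hζ]

/-- In a C⋆-ring, the commutator of two unitaries close to `1` is closer to `1`. -/
theorem norm_unitary_commutator_sub_one_le {E : Type*} [NormedRing E] [StarRing E] [CStarRing E]
    (x h : Eˣ) (hx : (x : E) ∈ unitary E) (hh : (h : E) ∈ unitary E) :
    ‖((x * h * x⁻¹ * h⁻¹ : Eˣ) : E) - 1‖ ≤ 2 * ‖(x : E) - 1‖ * ‖(h : E) - 1‖ := by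
  have h1 : ‖((x * h * x⁻¹ * h⁻¹ : Eˣ) : E) - 1‖ = ‖(x : E) * h - h * x‖ := by
    rw [← CStarRing.norm_mul_mem_unitary _ (mul_mem hh hx)]
    congr 1
    rw [sub_mul, one_mul, ← Units.val_mul, ← Units.val_mul, ← Units.val_mul]
    congr 2
    group
  rw [h1, show (x : E) * h - h * x = (x - 1) * (h - 1) - (h - 1) * (x - 1) by noncomm_ring]
  linarith [norm_sub_le (((x : E) - 1) * (h - 1)) (((h : E) - 1) * (x - 1)),
    norm_mul_le ((x : E) - 1) (h - 1), norm_mul_le ((h : E) - 1) (x - 1)]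

section FiniteLinear

variable {n : ℕ}

open scoped Matrix.Norms.L2Operator in
/-- There is `K`, depending only on `n`, such that the `K`-th powers in a finite group of unitary
matrices of determinant one have a common non-scalar commuting matrix. -/
theorem exists_nonscalar_commute_pow_unitary (hn : 2 ≤ n) :
    ∃ K : ℕ, 0 < K ∧ ∀ F : Subgroup (GL (Fin n) ℂ), (F : Set (GL (Fin n) ℂ)).Finite →
      (∀ g ∈ F, (g : Matrix (Fin n) (Fin n) ℂ).det = 1) →
      (∀ g ∈ F, (g : Matrix (Fin n) (Fin n) ℂ) ∈ unitary (Matrix (Fin n) (Fin n) ℂ)) →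
      ∃ X : Matrix (Fin n) (Fin n) ℂ, (∀ c : ℂ, X ≠ c • 1) ∧
        ∀ g ∈ F, Commute X ((g : Matrix (Fin n) (Fin n) ℂ) ^ K) := by
  obtain ⟨ε₀, hε₀, hgap⟩ := exists_root_of_unity_gap (n := n) (by omega)
  set ε := min ε₀ (1 / 2) with hεdef
  have hε : 0 < ε := lt_min hε₀ (by norm_num)
  obtain ⟨K, hK⟩ := exists_pow_near_one (E := Matrix (Fin n) (Fin n) ℂ) hε
  have : Nontrivial (Matrix (Fin n) (Fin n) ℂ) := by
    have : Nonempty (Fin n) := ⟨⟨0, by omega⟩⟩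
    infer_instance
  refine ⟨K.factorial, K.factorial_pos, fun F hfin hdet hunit => ?_⟩
  have hpow : ∀ X : Matrix (Fin n) (Fin n) ℂ,
      (∀ g ∈ F, ‖(g : Matrix (Fin n) (Fin n) ℂ) - 1‖ < ε → Commute X g) →
      ∀ g ∈ F, Commute X ((g : Matrix (Fin n) (Fin n) ℂ) ^ K.factorial) := by
    intro X hX g hg
    obtain ⟨k, hk0, hkK, hk⟩ := hK _ (hunit g hg)
    obtain ⟨d, hd⟩ := Nat.dvd_factorial hk0 hkK
    rw [hd, pow_mul]
    refine Commute.pow_right ?_ d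
    have := hX (g ^ k) (F.pow_mem hg k) (by simpa using hk)
    simpa using this
  by_cases hall : ∀ g ∈ F, ‖(g : Matrix (Fin n) (Fin n) ℂ) - 1‖ < ε →
      ∃ c : ℂ, (g : Matrix (Fin n) (Fin n) ℂ) = c • 1
  · refine ⟨Matrix.single ⟨0, by omega⟩ ⟨1, by omega⟩ 1, fun c hc => ?_, hpow _ fun g hg hs => ?_⟩
    · have := congrFun (congrFun hc ⟨0, by omega⟩) ⟨1, by omega⟩
      simp at this
    · obtain ⟨c, hc⟩ := hall g hg hs
      rw [hc]
      exact (Commute.one_right _).smul_right c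
  push Not at hall
  obtain ⟨g₀, hg₀, hs₀, hns₀⟩ := hall
  obtain ⟨x, ⟨hxF, hxs, hxns⟩, hmin⟩ := Set.exists_min_image
    {g : GL (Fin n) ℂ | g ∈ F ∧ ‖(g : Matrix (Fin n) (Fin n) ℂ) - 1‖ < ε ∧
      ∀ c : ℂ, (g : Matrix (Fin n) (Fin n) ℂ) ≠ c • 1}
    (fun g => ‖(g : Matrix (Fin n) (Fin n) ℂ) - 1‖) (hfin.subset fun g hg => hg.1)
    ⟨g₀, hg₀, hs₀, hns₀⟩
  refine ⟨x, hxns, hpow _ fun h hh hhs => ?_⟩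
  have hx0 : 0 < ‖(x : Matrix (Fin n) (Fin n) ℂ) - 1‖ := by
    rw [norm_pos_iff, sub_ne_zero]
    simpa using hxns 1
  have hmem : x * h * x⁻¹ * h⁻¹ ∈ F :=
    F.mul_mem (F.mul_mem (F.mul_mem hxF hh) (F.inv_mem hxF)) (F.inv_mem hh)
  have hlt : ‖((x * h * x⁻¹ * h⁻¹ : GL (Fin n) ℂ) : Matrix (Fin n) (Fin n) ℂ) - 1‖ <
      ‖(x : Matrix (Fin n) (Fin n) ℂ) - 1‖ := by
    refine (norm_unitary_commutator_sub_one_le x h (hunit x hxF) (hunit h hh)).trans_lt ?_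
    have : ‖(h : Matrix (Fin n) (Fin n) ℂ) - 1‖ < 1 / 2 := hhs.trans_le (min_le_right _ _)
    nlinarith
  have hsc : ∃ c : ℂ, ((x * h * x⁻¹ * h⁻¹ : GL (Fin n) ℂ) : Matrix (Fin n) (Fin n) ℂ) = c • 1 := by
    by_contra hcon
    push Not at hcon
    exact absurd (hmin _ ⟨hmem, hlt.trans hxs, hcon⟩) (not_le.2 hlt)
  obtain ⟨ζ, hζ⟩ := hsc
  have hζ1 : ζ = 1 := by
    refine hgap ζ ?_ ?_
    · have := hdet _ hmem
      rw [hζ, Matrix.det_smul, Fintype.card_fin, Matrix.det_one, mul_one] at this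
      exact this
    · have h1 := (hlt.trans hxs).trans_le (min_le_left _ _)
      rw [hζ, show (ζ • (1 : Matrix (Fin n) (Fin n) ℂ)) - 1 = (ζ - 1) • 1 by
        rw [sub_smul, one_smul], norm_smul] at h1
      simpa using h1
  have h1 : x * h * x⁻¹ * h⁻¹ = 1 := Units.ext (by rw [hζ, hζ1, one_smul, Units.val_one])
  have h2 : x * h = h * x := by
    rwa [mul_inv_eq_one, mul_inv_eq_iff_eq_mul] at h1
  exact congrArg Units.val h2

open scoped MatrixOrder ComplexOrder in
open Matrix in
/-- Every finite group of matrices is conjugate to a group of unitary matrices. -/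
theorem exists_conj_mem_unitary (F : Subgroup (GL (Fin n) ℂ))
    (hF : (F : Set (GL (Fin n) ℂ)).Finite) :
    ∃ S : GL (Fin n) ℂ, ∀ g ∈ F, ((S * g * S⁻¹ : GL (Fin n) ℂ) : Matrix (Fin n) (Fin n) ℂ) ∈
      unitary (Matrix (Fin n) (Fin n) ℂ) := by
  have : Finite F := hF.to_subtype
  have := Fintype.ofFinite F
  let P : Matrix (Fin n) (Fin n) ℂ :=
    ∑ g : F, ((g : GL (Fin n) ℂ) : Matrix (Fin n) (Fin n) ℂ)ᴴ * (g : GL (Fin n) ℂ)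
  have hP : P.PosDef := by
    refine Matrix.posDef_sum ⟨1, Finset.mem_univ _⟩ fun g _ => ?_
    exact Matrix.PosDef.conjTranspose_mul_self _
      (Matrix.mulVec_injective_of_isUnit (g : GL (Fin n) ℂ).isUnit)
  have hinv : ∀ h ∈ F, (h : Matrix (Fin n) (Fin n) ℂ)ᴴ * P * h = P := by
    intro h hh
    simp only [P, Finset.mul_sum, Finset.sum_mul]
    refine Fintype.sum_equiv (Equiv.mulRight (⟨h, hh⟩ : F)) _ _ fun g => ?_
    simp [Matrix.mul_assoc]
  obtain ⟨S, hS⟩ := CStarAlgebra.nonneg_iff_eq_star_mul_self.1 hP.posSemidef.nonneg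
  have hSu : IsUnit S := by
    rw [Matrix.isUnit_iff_isUnit_det]
    have := (Matrix.isUnit_iff_isUnit_det _).1 hP.isUnit
    rw [hS, Matrix.det_mul] at this
    exact isUnit_of_mul_isUnit_right this
  obtain ⟨S, rfl⟩ := hSu
  refine ⟨S, fun g hg => ?_⟩
  have h1 : star ((S * g * S⁻¹ : GL (Fin n) ℂ) : Matrix (Fin n) (Fin n) ℂ) *
      ((S * g * S⁻¹ : GL (Fin n) ℂ) : Matrix (Fin n) (Fin n) ℂ) = 1 := by
    have h2 := hinv g hg
    rw [hS] at h2
    rw [Units.val_mul, Units.val_mul]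
    have h3 : (S : Matrix (Fin n) (Fin n) ℂ) * ((S⁻¹ : GL (Fin n) ℂ) : Matrix (Fin n) (Fin n) ℂ) = 1 :=
      S.mul_inv
    generalize ((S⁻¹ : GL (Fin n) ℂ) : Matrix (Fin n) (Fin n) ℂ) = T at h3
    generalize (S : Matrix (Fin n) (Fin n) ℂ) = S at h2 h3
    generalize (g : Matrix (Fin n) (Fin n) ℂ) = g at h2
    calc star (S * g * T) * (S * g * T) = star T * (star g * (star S * S) * g) * T := by
          simp only [star_mul, mul_assoc]
      _ = star (S * T) * (S * T) := by
          rw [← Matrix.star_eq_conjTranspose] at h2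
          rw [h2]
          simp only [star_mul, mul_assoc]
      _ = 1 := by rw [h3, star_one, one_mul]
  exact ⟨h1, mul_eq_one_comm.1 h1⟩

/-- There is `K`, depending only on `n`, such that the `K`-th powers in a finite group of matrices of
determinant one have a common non-scalar commuting matrix. -/
theorem exists_nonscalar_commute_pow (hn : 2 ≤ n) :
    ∃ K : ℕ, 0 < K ∧ ∀ F : Subgroup (GL (Fin n) ℂ), (F : Set (GL (Fin n) ℂ)).Finite →
      (∀ g ∈ F, (g : Matrix (Fin n) (Fin n) ℂ).det = 1) →
      ∃ X : Matrix (Fin n) (Fin n) ℂ, (∀ c : ℂ, X ≠ c • 1) ∧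
        ∀ g ∈ F, Commute X ((g : Matrix (Fin n) (Fin n) ℂ) ^ K) := by
  obtain ⟨K, hK0, hK⟩ := exists_nonscalar_commute_pow_unitary hn
  refine ⟨K, hK0, fun F hfin hdet => ?_⟩
  obtain ⟨S, hS⟩ := exists_conj_mem_unitary F hfin
  obtain ⟨X, hXns, hX⟩ := hK (F.map (MulAut.conj S).toMonoidHom)
    (by simpa using hfin.image _)
    (by
      rintro _ ⟨g, hg, rfl⟩
      exact (Matrix.det_units_conj S _).trans (hdet g hg))
    (by
      rintro _ ⟨g, hg, rfl⟩
      exact hS g hg)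
  have hinj : Function.Injective fun Y : Matrix (Fin n) (Fin n) ℂ =>
      (S : Matrix (Fin n) (Fin n) ℂ) * Y * (S⁻¹ : GL (Fin n) ℂ) := by
    intro Y Z h
    exact S.isUnit.mul_left_cancel ((S⁻¹).isUnit.mul_right_cancel h)
  refine ⟨(S⁻¹ : GL (Fin n) ℂ) * X * S, fun c hc => hXns c ?_, fun g hg => ?_⟩
  · have := congrArg (fun Y => (S : Matrix (Fin n) (Fin n) ℂ) * Y * (S⁻¹ : GL (Fin n) ℂ)) hc
    simpa [mul_assoc] using this
  · have h1 := hX _ ⟨g, hg, rfl⟩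
    refine hinj ?_
    have h2 : ((MulAut.conj S).toMonoidHom g : Matrix (Fin n) (Fin n) ℂ) ^ K =
        (S : Matrix (Fin n) (Fin n) ℂ) * (g : Matrix (Fin n) (Fin n) ℂ) ^ K *
          (S⁻¹ : GL (Fin n) ℂ) := by
      rw [← Units.val_pow_eq_pow_val, ← map_pow]
      simp
    rw [h2] at h1
    simpa [Commute, SemiconjBy, mul_assoc] using h1

end FiniteLinear

/-- Operators commuting with a non-scalar operator have a common invariant subspace. -/
theorem exists_invariant_of_commute {V : Type*} [AddCommGroup V] [Module ℂ V]
    [FiniteDimensional ℂ V] [Nontrivial V] (x : End ℂ V) (hx : ∀ c : ℂ, x ≠ c • 1) :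
    ∃ U : Submodule ℂ V, U ≠ ⊥ ∧ U ≠ ⊤ ∧ ∀ f : End ℂ V, Commute x f → U ≤ U.comap f := by
  obtain ⟨c, hc⟩ := End.exists_eigenvalue x
  refine ⟨End.eigenspace x c, hc, fun htop => hx c (LinearMap.ext fun v => ?_), fun f hf v hv => ?_⟩
  · have hv : v ∈ End.eigenspace x c := htop ▸ Submodule.mem_top
    simpa using End.mem_eigenspace_iff.1 hv
  · refine End.mem_eigenspace_iff.2 ?_
    have := LinearMap.congr_fun hf v
    simp only [End.mul_apply] at this
    rw [this, End.mem_eigenspace_iff.1 hv, map_smul]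

/-- If the scalars have finite index in `Γ`, the elements of determinant one that are scalar
multiples of elements of `ρ Γ` form a finite group. -/
theorem finite_detOne_inf_range_sup_center {Γ : Type*} [Group Γ] {n : ℕ} (hn : n ≠ 0)
    (ρ : Γ →* GL (Fin n) ℂ) (h : (scalarSubgroup ρ).index ≠ 0) :
    ((Matrix.GeneralLinearGroup.det.ker ⊓ (ρ.range ⊔ Subgroup.center _) :
      Subgroup (GL (Fin n) ℂ)) : Set (GL (Fin n) ℂ)).Finite := by
  have : (scalarSubgroup ρ).FiniteIndex := ⟨h⟩
  refine (Set.finite_iUnion fun q : Γ ⧸ scalarSubgroup ρ =>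
    finite_center_coset_det hn (ρ q.out) 1).subset ?_
  rintro x ⟨hx, hx'⟩
  obtain ⟨_, ⟨g, rfl⟩, z, hz, rfl⟩ := Subgroup.mem_sup_of_normal_right.1 hx'
  refine Set.mem_iUnion.2 ⟨g, ?_, ?_⟩
  · simpa using congrArg Units.val (MonoidHom.mem_ker.1 hx)
  · obtain ⟨s, hs⟩ := QuotientGroup.mk_out_eq_mul (scalarSubgroup ρ) g
    have hs' : ρ s ∈ Subgroup.center _ := s.2
    rw [hs, map_mul, mul_inv_rev, Subgroup.mem_center_iff.1 hz (ρ g)]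
    have : z * ρ g * ((ρ s)⁻¹ * (ρ g)⁻¹) = z * (ρ g * (ρ s)⁻¹ * (ρ g)⁻¹) := by group
    rw [this]
    exact Subgroup.mul_mem _ hz (Subgroup.Normal.conj_mem inferInstance _ (Subgroup.inv_mem _ hs') _)

/-- Every `ρ g` is a scalar multiple of an element of that group. -/
theorem exists_smul_mem_detOne {Γ : Type*} [Group Γ] {n : ℕ} (hn : n ≠ 0)
    (ρ : Γ →* GL (Fin n) ℂ) (g : Γ) :
    ∃ x ∈ (Matrix.GeneralLinearGroup.det.ker ⊓ (ρ.range ⊔ Subgroup.center _) :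
      Subgroup (GL (Fin n) ℂ)), ∃ c : ℂ, (ρ g : Matrix (Fin n) (Fin n) ℂ) = c • (x : Matrix _ _ ℂ) := by
  obtain ⟨c, hc⟩ := IsAlgClosed.exists_pow_nat_eq (ρ g : Matrix (Fin n) (Fin n) ℂ).det
    (Nat.pos_of_ne_zero hn)
  have hc0 : c ≠ 0 := by
    rintro rfl
    rw [zero_pow hn] at hc
    exact (ρ g).det_ne_zero hc.symm
  let z : GL (Fin n) ℂ := Matrix.GeneralLinearGroup.scalar (Fin n) (Units.mk0 c hc0)⁻¹
  have hz : (z : Matrix (Fin n) (Fin n) ℂ) = c⁻¹ • 1 := by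
    simp only [z, Matrix.smul_one_eq_diagonal]
    rfl
  refine ⟨ρ g * z, ⟨MonoidHom.mem_ker.2 (Units.ext ?_), Subgroup.mem_sup_of_normal_right.2
    ⟨_, ⟨g, rfl⟩, z, mem_center_of_eq_smul hz, rfl⟩⟩, c, ?_⟩
  · rw [Matrix.GeneralLinearGroup.val_det_apply, Units.val_mul, hz, mul_smul_comm, mul_one,
      Matrix.det_smul, Fintype.card_fin, ← hc, Units.val_one, inv_pow, inv_mul_cancel₀]
    exact pow_ne_zero n hc0
  · rw [Units.val_mul, hz, mul_smul_comm, mul_one, smul_smul, mul_inv_cancel₀ hc0, one_smul]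

/-- Uniformly in all virtually solvable groups acting on an `n`-dimensional space, a subgroup
containing all `M`-th powers acts reducibly. -/
theorem exists_reducible_pow {n : ℕ} (hn : 2 ≤ n) :
    ∃ M : ℕ, 0 < M ∧ ∀ (Γ V : Type) [Group Γ] [AddCommGroup V] [Module ℂ V]
      [FiniteDimensional ℂ V] (ρ : Representation ℂ Γ V), finrank ℂ V = n → IsVirtSolvable Γ →
      ∃ H : Subgroup Γ, (∀ g : Γ, g ^ M ∈ H) ∧
        ∃ U : Submodule ℂ V, U ≠ ⊥ ∧ U ≠ ⊤ ∧ ∀ h ∈ H, U ≤ U.comap (ρ h) := by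
  obtain ⟨K, hK0, hK⟩ := exists_nonscalar_commute_pow hn
  have hn0 : n ≠ 0 := by omega
  refine ⟨n.factorial * K, Nat.mul_pos n.factorial_pos hK0, ?_⟩
  intro Γ V _ _ _ _ ρ hV ⟨S, hSfin, hSsolv⟩
  have : Nontrivial V := Module.nontrivial_of_finrank_pos (R := ℂ) (by omega)
  let e := LinearMap.toMatrixAlgEquiv (finBasisOfFinrankEq ℂ V hV)
  let σ : Γ →* GL (Fin n) ℂ :=
    (Units.map (e : End ℂ V →* Matrix (Fin n) (Fin n) ℂ)).comp ρ.toHomUnits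
  have hσ : ∀ g, (σ g : Matrix (Fin n) (Fin n) ℂ) = e (ρ g) := fun g => rfl
  by_cases hA : ∀ A : Subgroup Γ, A.Normal → (∀ a ∈ A, ∀ b ∈ A, Commute (σ a) (σ b)) →
      A ≤ scalarSubgroup σ
  · have : Group.IsSolvable S.normalCore :=
      have : Group.IsSolvable S := hSsolv
      Group.isSolvable_of_isSolvable_injective (Subgroup.inclusion_injective S.normalCore_le)
    have hidx := index_scalarSubgroup_ne_zero σ hn0 hA S.normalCore
    obtain ⟨X, hXns, hX⟩ := hK _ (finite_detOne_inf_range_sup_center hn0 σ hidx) fun x hx =>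
      congrArg Units.val (MonoidHom.mem_ker.1 hx.1)
    have hXV : ∀ c : ℂ, e.symm X ≠ c • 1 := fun c hc =>
      hXns c (by rw [← e.apply_symm_apply X, hc, map_smul, map_one])
    obtain ⟨U, hU0, hU1, hU⟩ := exists_invariant_of_commute _ hXV
    let H : Subgroup Γ :=
      { carrier := {g | Commute (e.symm X) (ρ g)}
        one_mem' := by simp
        mul_mem' := fun {g h} hg hh => by
          rw [Set.mem_ofPred_eq, map_mul]
          exact Commute.mul_right hg hh
        inv_mem' := fun {g} hg =>
          Commute.units_inv_right (u := ρ.toHomUnits g) hg }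
    refine ⟨H, fun g => ?_, U, hU0, hU1, fun h hh => hU _ hh⟩
    have hgK : g ^ K ∈ H := by
      obtain ⟨x, hx, c, hc⟩ := exists_smul_mem_detOne hn0 σ g
      have h1 : Commute X (e (ρ (g ^ K))) := by
        rw [← hσ, map_pow, Units.val_pow_eq_pow_val, hc, smul_pow]
        exact (hX x hx).smul_right _
      exact e.injective (by simpa using h1.eq)
    rw [mul_comm, pow_mul]
    exact H.pow_mem hgK _
  · push Not at hA
    obtain ⟨A, hAn, hcomm, hns⟩ := hA
    obtain ⟨a, haA, ha⟩ := SetLike.not_le_iff_exists.1 hns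
    obtain ⟨H, hH, hU⟩ := exists_reducible_of_normal_commuting ρ A
      (fun a ha b hb => e.injective (by
        have := congrArg Units.val (hcomm a ha b hb).eq
        simpa [hσ] using this)) haA
      fun c hc => ha (mem_center_of_eq_smul (c := c) (by rw [hσ, hc, map_smul, map_one]))
    rw [hV] at hH
    exact ⟨H, fun g => by rw [pow_mul]; exact H.pow_mem (hH g) K, hU⟩

theorem IsVirtSolvable.subgroup {Γ : Type*} [Group Γ] (h : IsVirtSolvable Γ) (H : Subgroup Γ) :
    IsVirtSolvable H := by
  obtain ⟨S, hS, hsolv⟩ := h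
  have : Group.IsSolvable S := hsolv
  refine ⟨S.subgroupOf H, inferInstance, ?_⟩
  exact Group.isSolvable_of_isSolvable_injective
    (f := (H.subtype.comp (S.subgroupOf H).subtype).codRestrict S fun x => x.2)
    fun x y hxy => Subtype.ext (Subtype.ext (congrArg (fun s : S => (s : Γ)) hxy))

/-- Uniform simultaneous triangularization of powers, in every representation of dimension `n` of a
virtually solvable group. -/
theorem exists_pow_triangularizable (n : ℕ) :
    ∃ M : ℕ, 0 < M ∧ ∀ (Γ V : Type) [Group Γ] [AddCommGroup V] [Module ℂ V]
      [FiniteDimensional ℂ V] (ρ : Representation ℂ Γ V), finrank ℂ V = n → IsVirtSolvable Γ →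
      Triangularizable (Set.range fun g => ρ (g ^ M)) := by
  induction n using Nat.strong_induction_on with
  | _ n ih =>
  rcases Nat.lt_or_ge n 2 with hn | hn
  · exact ⟨1, one_pos, fun Γ V _ _ _ _ ρ hV _ =>
      triangularizable_of_finrank_le_one (by omega) _⟩
  choose! m hm0 hm using ih
  obtain ⟨M, hM0, hM⟩ := exists_reducible_pow hn
  set P := ∏ k ∈ Finset.range n, m k with hP
  have hP0 : 0 < P := Finset.prod_pos fun k hk => hm0 k (Finset.mem_range.1 hk)
  have hlow : ∀ (Γ V : Type) [Group Γ] [AddCommGroup V] [Module ℂ V]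
      [FiniteDimensional ℂ V] (ρ : Representation ℂ Γ V), finrank ℂ V < n → IsVirtSolvable Γ →
      Triangularizable (Set.range fun g => ρ (g ^ P)) := by
    intro Γ V _ _ _ _ ρ hV hΓ
    refine (hm _ hV Γ V ρ rfl hΓ).mono ?_
    rintro _ ⟨g, rfl⟩
    obtain ⟨d, hd⟩ := Finset.dvd_prod_of_mem m (Finset.mem_range.2 hV)
    exact ⟨g ^ d, by simp only [hP, hd, mul_comm (m _) d, pow_mul]⟩
  refine ⟨M * P, Nat.mul_pos hM0 hP0, fun Γ V _ _ _ _ ρ hV hΓ => ?_⟩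
  obtain ⟨H, hH, U, hU0, hU1, hU⟩ := hM Γ V ρ hV hΓ
  let τ : Representation ℂ H V := ρ.comp H.subtype
  have hτ : ∀ h : H, U ≤ U.comap (τ h) := fun h => hU h h.2
  have hfr := Submodule.finrank_quotient_add_finrank U
  have hUpos : 0 < finrank ℂ U :=
    have := Submodule.nontrivial_iff_ne_bot.2 hU0
    finrank_pos
  have hUlt : finrank ℂ U < n := hV ▸ Submodule.finrank_lt hU1
  have h := triangularizable_of_submodule (fun h : H => τ (h ^ P)) U (fun h => hτ _)
    (hlow H U (τ.subrepresentation U hτ) hUlt (hΓ.subgroup H))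
    (hlow H (V ⧸ U) (τ.quotient U hτ) (by omega) (hΓ.subgroup H))
  refine h.mono ?_
  rintro _ ⟨g, rfl⟩
  exact ⟨⟨g ^ M, hH g⟩, by simp [τ, pow_mul]⟩

/-- For every `n` there is `M = M(n)` such that for every virtually solvable subgroup
`G ≤ GL n ℂ`, the subgroup generated by the `M`-th powers of elements of `G` can be conjugated
into `𝓑`. -/
theorem exists_pow_conjIntoB (n : ℕ) (hn : 0 < n) :
    ∃ M : ℕ, 0 < M ∧ ∀ G : Subgroup (GL (Fin n) ℂ), IsVirtSolvable ↥G →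
      ConjIntoB (Subgroup.closure {x : GL (Fin n) ℂ | ∃ g ∈ G, x = g ^ M}) := by
  obtain ⟨M, hM0, hM⟩ := exists_pow_triangularizable n
  refine ⟨M, hM0, fun G hG => ?_⟩
  let ρ : Representation ℂ G (Fin n → ℂ) :=
    { toFun := fun g => Matrix.toLin' ((g : GL (Fin n) ℂ) : Matrix (Fin n) (Fin n) ℂ)
      map_one' := by simp [End.one_eq_id]
      map_mul' := fun g h => by simp [Matrix.toLin'_mul, End.mul_eq_comp] }
  obtain ⟨m, b, hb⟩ := hM G (Fin n → ℂ) ρ (by simp) hG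
  obtain rfl : m = n := by simpa using (finrank_eq_card_basis b).symm
  let c := Pi.basisFun ℂ (Fin m)
  let X : GL (Fin m) ℂ := ⟨b.toMatrix c, c.toMatrix b, b.toMatrix_mul_toMatrix_flip c,
    c.toMatrix_mul_toMatrix_flip b⟩
  have hX : ∀ g : GL (Fin m) ℂ, ((X * g * X⁻¹ : GL (Fin m) ℂ) : Matrix (Fin m) (Fin m) ℂ) =
      LinearMap.toMatrix b b (Matrix.toLin' (g : Matrix (Fin m) (Fin m) ℂ)) := by
    intro g
    rw [← basis_toMatrix_mul_linearMap_toMatrix_mul_basis_toMatrix b c b c, ← Matrix.toLin_eq_toLin',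
      LinearMap.toMatrix_toLin]
    rfl
  refine ⟨X, fun g hg => ?_⟩
  have tri : ∀ g ∈ G, UpperTri ((X * g ^ M * X⁻¹ : GL (Fin m) ℂ) : Matrix (Fin m) (Fin m) ℂ) := by
    intro g hg i j hij
    rw [hX, LinearMap.toMatrix_apply]
    exact hb _ ⟨⟨g, hg⟩, rfl⟩ i j hij
  induction hg using Subgroup.closure_induction'' with
  | mem x hx =>
    obtain ⟨g, hg, rfl⟩ := hx
    exact tri g hg
  | inv_mem x hx =>
    obtain ⟨g, hg, rfl⟩ := hx
    rw [← inv_pow]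
    exact tri _ (G.inv_mem hg)
  | one =>
    intro i j hij
    simp [Matrix.one_apply_ne hij.ne']
  | mul x y _ _ hx hy =>
    have h : X * (x * y) * X⁻¹ = (X * x * X⁻¹) * (X * y * X⁻¹) := by group
    rw [h, Units.val_mul]
    exact Matrix.BlockTriangular.mul (b := id) (fun i j hij => hx i j hij) fun i j hij => hy i j hij
end

section
/- Every virtually solvable subgroup G ≤ GL_n(ℂ) contains a normal subgroup G₀ of finite index such that G₀ can be conjugated into 𝓑. -/
open Module

/-- A subgroup is of finite index as soon as some function with finite range separates its left
cosets. -/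
lemma Subgroup.finiteIndex_of_finite_range {G X : Type*} [Group G] (H : Subgroup G) (f : G → X)
    (hf : (Set.range f).Finite) (h : ∀ a b, f a = f b → a⁻¹ * b ∈ H) : H.FiniteIndex := by
  have : Finite (Set.range f) := hf
  have : Finite (G ⧸ H) := by
    refine Finite.of_injective
      (fun q : G ⧸ H ↦ (⟨f q.out, Set.mem_range_self _⟩ : Set.range f)) fun a b hab ↦ ?_
    have := h _ _ (congrArg Subtype.val hab)
    rw [← QuotientGroup.eq] at this
    simpa using this
  exact Subgroup.finiteIndex_of_finite_quotient

/-- The image of a subgroup `D` under a homomorphism is finite if `H ⊓ D` has finite image for some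
subgroup `H` of finite relative index in `D`. -/
lemma Subgroup.finite_image_of_relIndex_ne_zero {G M : Type*} [Group G] [Monoid M] (ρ : G →* M)
    {H D : Subgroup G} (h : H.relIndex D ≠ 0) (hfin : (ρ '' (H ⊓ D : Subgroup G)).Finite) :
    (ρ '' D).Finite := by
  have : (H.subgroupOf D).FiniteIndex := ⟨h⟩
  refine ((Set.finite_range fun q : D ⧸ H.subgroupOf D ↦ ρ (q.out : D)).mul hfin).subset ?_
  rintro _ ⟨d, hd, rfl⟩
  obtain ⟨k, hk⟩ := QuotientGroup.mk_out_eq_mul (H.subgroupOf D) ⟨d, hd⟩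
  refine ⟨_, ⟨((⟨d, hd⟩ : D) : D ⧸ H.subgroupOf D), rfl⟩, _,
    ⟨((k : D) : G)⁻¹, H.mem_inf.2 ⟨H.inv_mem k.2, D.inv_mem k.1.2⟩, rfl⟩, ?_⟩
  change ρ ((((⟨d, hd⟩ : D) : D ⧸ H.subgroupOf D).out : D) : G) * ρ ((k : D) : G)⁻¹ = ρ d
  rw [hk]
  simp [← map_mul]

section

variable {K V : Type*} [Field K] [AddCommGroup V] [Module K V] [FiniteDimensional K V]

/-- Commuting endomorphisms over an algebraically closed field have a common eigenvector. -/
lemma Module.End.exists_common_eigenvector [IsAlgClosed K] [Nontrivial V] (S : Set (End K V))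
    (hS : ∀ f ∈ S, ∀ g ∈ S, Commute f g) :
    ∃ v : V, v ≠ 0 ∧ ∀ f ∈ S, ∃ c : K, f v = c • v := by
  obtain ⟨W, ⟨hW0, hW⟩, hmin⟩ := wellFounded_lt.has_min
    {W : Submodule K V | W ≠ ⊥ ∧ ∀ f ∈ S, ∀ w ∈ W, f w ∈ W} ⟨⊤, top_ne_bot, by simp⟩
  obtain ⟨v, hv, hv0⟩ := W.exists_mem_ne_zero_of_ne_bot hW0
  refine ⟨v, hv0, fun f hf ↦ ?_⟩
  have : Nontrivial W := W.nontrivial_iff_ne_bot.2 hW0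
  obtain ⟨c, hc⟩ := Module.End.exists_eigenvalue (f.restrict (hW f hf))
  obtain ⟨w, hw⟩ := hc.exists_hasEigenvector
  have hfw : f w = c • (w : V) := congrArg Subtype.val hw.apply_eq_smul
  refine ⟨c, ?_⟩
  by_contra hne
  refine hmin (W ⊓ End.eigenspace f c) ⟨?_, ?_⟩ ?_
  · refine (Submodule.ne_bot_iff _).2 ⟨w, ⟨w.2, End.mem_eigenspace_iff.2 hfw⟩, ?_⟩
    simpa using hw.2
  · rintro g hg u ⟨huW, hu⟩
    refine ⟨hW g hg u huW, End.mem_eigenspace_iff.2 ?_⟩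
    have hu : f u = c • u := End.mem_eigenspace_iff.1 hu
    have := LinearMap.congr_fun (hS f hf g hg).eq u
    simpa [hu] using this
  · refine lt_of_le_of_ne inf_le_left fun h ↦ hne ?_
    have : v ∈ W ⊓ End.eigenspace f c := h.symm.le hv
    exact End.mem_eigenspace_iff.1 this.2

/-- Joint eigenspaces of a family of endomorphisms for pairwise distinct characters are
independent, hence only finitely many of them are nonzero. -/
lemma Module.End.finite_iInf_eigenspace_ne_bot {ι : Type*} (f : ι → End K V)
    (hf : ∀ i j, Commute (f i) (f j)) :
    {χ : ι → K | ⨅ i, End.eigenspace (f i) (χ i) ≠ ⊥}.Finite := by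
  refine WellFoundedGT.finite_ne_bot_of_iSupIndep
    ((End.independent_iInf_maxGenEigenspace_of_forall_mapsTo f
      fun i j φ ↦ End.mapsTo_maxGenEigenspace_of_comm (hf j i) φ).mono fun χ ↦ ?_)
  exact iInf_mono fun i ↦ (End.genEigenspace (f i) (χ i)).monotone le_top

end

namespace Representation

variable {K G V : Type*} [Field K] [Group G] [AddCommGroup V] [Module K V]

/-- A representation is strongly irreducible if its restriction to every subgroup of finite index
has no proper nonzero invariant subspace. -/
def IsStronglyIrreducible (ρ : Representation K G V) : Prop :=
  ∀ H : Subgroup G, H.FiniteIndex → ∀ W : Submodule K V,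
    (∀ g ∈ H, ∀ w ∈ W, ρ g w ∈ W) → W = ⊥ ∨ W = ⊤

/-- The subgroup of elements acting by scalars. -/
def scalarSubgroup (ρ : Representation K G V) : Subgroup G where
  carrier := {g | ∃ c : K, ∀ v, ρ g v = c • v}
  one_mem' := ⟨1, by simp⟩
  mul_mem' := by
    rintro a b ⟨c, hc⟩ ⟨d, hd⟩
    exact ⟨c * d, fun v ↦ by simp [hc, hd, mul_smul]⟩
  inv_mem' := by
    rintro a ⟨c, hc⟩
    refine ⟨c⁻¹, fun v ↦ ?_⟩
    have h : c • ρ a⁻¹ v = v := by rw [← hc, self_inv_apply]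
    obtain rfl | h0 := eq_or_ne c 0
    · have : v = 0 := by simpa using h.symm
      simp [this]
    · nth_rewrite 2 [← h]
      rw [inv_smul_smul₀ h0]

lemma mem_scalarSubgroup {ρ : Representation K G V} {g : G} :
    g ∈ ρ.scalarSubgroup ↔ ∃ c : K, ∀ v, ρ g v = c • v := Iff.rfl

variable [FiniteDimensional K V]

/-- In a strongly irreducible representation, a normal subgroup with commutative image acts by
scalars. -/
lemma IsStronglyIrreducible.le_scalarSubgroup [IsAlgClosed K] [Nontrivial V]
    {ρ : Representation K G V} (hρ : ρ.IsStronglyIrreducible) (Z : Subgroup G) [hZ : Z.Normal]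
    (hcomm : ∀ a ∈ Z, ∀ b ∈ Z, Commute (ρ a) (ρ b)) : Z ≤ ρ.scalarSubgroup := by
  obtain ⟨v, hv0, hv⟩ := Module.End.exists_common_eigenvector (ρ '' Z) (by
    rintro _ ⟨a, ha, rfl⟩ _ ⟨b, hb, rfl⟩
    exact hcomm a ha b hb)
  choose χ hχ using fun z : Z ↦ hv _ ⟨z, z.2, rfl⟩
  let E : (Z → K) → Submodule K V := fun χ ↦ ⨅ z : Z, End.eigenspace (ρ z) (χ z)
  have hE : ∀ χ w, w ∈ E χ ↔ ∀ z : Z, ρ z w = χ z • w := fun χ w ↦ by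
    simp [E, Submodule.mem_iInf]
  have hfin : {χ | E χ ≠ ⊥}.Finite :=
    Module.End.finite_iInf_eigenspace_ne_bot _ fun a b ↦ hcomm a a.2 b b.2
  have hEχ : E χ ≠ ⊥ := (Submodule.ne_bot_iff _).2 ⟨v, (hE _ _).2 hχ, hv0⟩
  let tw : G → (Z → K) := fun g z ↦ χ ⟨g⁻¹ * z * g, by simpa using hZ.conj_mem z z.2 g⁻¹⟩
  have htw : ∀ g, ∀ w ∈ E χ, ρ g w ∈ E (tw g) := fun g w hw ↦ by
    refine (hE _ _).2 fun z ↦ ?_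
    have h := (hE _ _).1 hw ⟨g⁻¹ * z * g, by simpa using hZ.conj_mem z z.2 g⁻¹⟩
    rw [← map_smul, ← h]
    simp only [← Module.End.mul_apply, ← map_mul]
    congr 2
    group
  let H : Subgroup G :=
    { carrier := {g | ∀ z : Z, χ ⟨g * z * g⁻¹, hZ.conj_mem z z.2 g⟩ = χ z}
      one_mem' := by simp
      mul_mem' := fun {a b} ha hb z ↦ by
        rw [← hb z, ← ha ⟨b * z * b⁻¹, hZ.conj_mem z z.2 b⟩]
        congr 2
        simp [mul_assoc]
      inv_mem' := fun {a} ha z ↦ by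
        rw [← ha]
        congr 2
        simp [mul_assoc] }
  have hH : H.FiniteIndex := by
    refine H.finiteIndex_of_finite_range tw (hfin.subset ?_) fun a b hab z ↦ ?_
    · rintro _ ⟨g, rfl⟩
      refine (Submodule.ne_bot_iff _).2 ⟨ρ g v, htw g v ((hE _ _).2 hχ), fun h ↦ hv0 ?_⟩
      rw [← ρ.inv_self_apply g v, h, map_zero]
    · have := congrFun hab ⟨b * z * b⁻¹, hZ.conj_mem z z.2 b⟩
      simpa [tw, mul_assoc] using this
  obtain h | h := hρ H hH (E χ) fun g hg w hw ↦ by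
    have : tw g = χ := funext fun z ↦ by simpa [tw] using (H.inv_mem hg) z
    exact this ▸ htw g w hw
  · exact absurd h hEχ
  · exact fun z hz ↦ ⟨χ ⟨z, hz⟩, fun w ↦ (hE χ w).1 (h ▸ Submodule.mem_top) ⟨z, hz⟩⟩

/-- If the derived subgroup of `N` has finite image, then the elements of `N` commuting with the
image of `N` form a subgroup of finite index in `N`. -/
lemma exists_relIndex_ne_zero_of_finite_image_commutator (ρ : Representation K G V)
    (N : Subgroup G) [hN : N.Normal] (hfin : (ρ '' (⁅N, N⁆ : Subgroup G)).Finite) :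
    ∃ Z ≤ N, Z.Normal ∧ Z.relIndex N ≠ 0 ∧ ∀ z ∈ Z, ∀ m ∈ N, Commute (ρ z) (ρ m) := by
  let C : Set G → Subgroup G := fun S ↦
    { carrier := {g | ∀ m ∈ S, Commute (ρ g) (ρ m)}
      one_mem' := by simp
      mul_mem' := fun {a b} ha hb m hm ↦ by
        rw [map_mul]
        exact (ha m hm).mul_left (hb m hm)
      inv_mem' := fun {a} ha m hm ↦ by
        have h := (ha m hm).eq
        have h1 : ρ a⁻¹ * ρ a = 1 := by simp [← map_mul]
        have h2 : ρ a * ρ a⁻¹ = 1 := by simp [← map_mul]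
        calc ρ a⁻¹ * ρ m = ρ a⁻¹ * (ρ m * ρ a) * ρ a⁻¹ := by
              rw [mul_assoc, mul_assoc, h2, mul_one]
          _ = ρ m * ρ a⁻¹ := by rw [← h, ← mul_assoc, h1, one_mul] }
  have hC1 : ∀ m ∈ N, (C {m}).relIndex N ≠ 0 := fun m hm ↦ by
    have : ((C {m}).subgroupOf N).FiniteIndex := by
      refine Subgroup.finiteIndex_of_finite_range _ (fun g : N ↦ ρ (g * m * (g : G)⁻¹))
        ((hfin.mul (Set.finite_singleton (ρ m))).subset ?_) fun a b hab ↦ ?_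
      · rintro _ ⟨g, rfl⟩
        refine ⟨_, ⟨g * m * (g : G)⁻¹ * m⁻¹, Subgroup.commutator_mem_commutator g.2 hm, rfl⟩, _, rfl, ?_⟩
        simp [← map_mul]
      · rw [Subgroup.mem_subgroupOf]
        rintro _ rfl
        have h := congrArg (fun f ↦ ρ (a : G)⁻¹ * f * ρ (b : G)) hab
        simp only [← map_mul] at h
        simp only [commute_iff_eq, ← map_mul]
        simpa [mul_assoc] using h.symm
    exact this.index_ne_zero
  obtain ⟨F, hFN, hF⟩ : ∃ F : Set G, F ⊆ N ∧ F.Finite ∧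
      Submodule.span K (ρ '' N) ≤ Submodule.span K (ρ '' F) := by
    obtain ⟨b, hb, hbs, hbi⟩ := exists_linearIndependent K (ρ '' (N : Set G))
    obtain ⟨F, hFN, hFb⟩ := Set.exists_subset_bijOn (s := (ρ : G → _) ⁻¹' b ∩ N) (f := ρ)
    refine ⟨F, fun x hx ↦ (hFN hx).2, ?_, ?_⟩
    · refine Set.Finite.of_finite_image ?_ hFb.injOn
      rw [hFb.image_eq]
      exact hbi.setFinite.subset (by simp [Set.image_preimage_inter])
    · rw [← hbs, hFb.image_eq, Set.image_preimage_inter, Set.inter_eq_left.2 hb]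
  have hCF : C F ≤ C N := fun g hg m hm ↦ by
    have hm' := hF.2 (Submodule.subset_span ⟨m, hm, rfl⟩)
    generalize ρ m = f at hm'
    induction hm' using Submodule.span_induction with
    | mem x hx => obtain ⟨f, hf, rfl⟩ := hx; exact hg f hf
    | zero => exact Commute.zero_right _
    | add x y _ _ hx hy => exact hx.add_right hy
    | smul c x _ hx => exact hx.smul_right c
  have hCF' : (C F).relIndex N ≠ 0 := by
    have := hF.1.to_subtype
    have h : ⨅ m : F, C {(m : G)} ≤ C F := fun g hg m hm ↦
      Subgroup.mem_iInf.1 hg ⟨m, hm⟩ m rfl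
    exact fun h0 ↦ Subgroup.relIndex_iInf_ne_zero (fun m : F ↦ hC1 m (hFN m.2))
      (Subgroup.relIndex_eq_zero_of_le_left h h0)
  refine ⟨C N ⊓ N, inf_le_right, ⟨?_⟩, ?_, fun z hz ↦ hz.1⟩
  · rintro z ⟨hz, hzN⟩ g
    refine ⟨fun m hm ↦ ?_, hN.conj_mem z hzN g⟩
    have h := hz (g⁻¹ * m * g) (by simpa using hN.conj_mem m hm g⁻¹)
    have h := congrArg (fun f ↦ ρ g * f * ρ g⁻¹) h.eq
    simp only [commute_iff_eq, ← map_mul] at h ⊢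
    simpa [mul_assoc] using h
  · rw [Subgroup.inf_relIndex_right]
    exact fun h0 ↦ hCF' (Subgroup.relIndex_eq_zero_of_le_left hCF h0)

/-- Only finitely many endomorphisms arise from elements of the derived subgroup acting by
scalars, since these have determinant one. -/
lemma finite_image_scalarSubgroup_inf [Nontrivial V] (ρ : Representation K G V)
    {D : Subgroup G} (hD : D ≤ commutator G) :
    (ρ '' (ρ.scalarSubgroup ⊓ D : Subgroup G)).Finite := by
  classical
  refine ((Polynomial.nthRoots (finrank K V) (1 : K)).toFinset.finite_toSet.image
    fun c : K ↦ c • (1 : End K V)).subset ?_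
  rintro _ ⟨g, ⟨⟨c, hc⟩, hg⟩, rfl⟩
  have hgc : ρ g = c • (1 : End K V) := LinearMap.ext fun v ↦ by simp [hc]
  refine ⟨c, ?_, hgc.symm⟩
  have hdet : LinearMap.det (ρ g) = 1 := by
    have := Abelianization.commutator_subset_ker
      ((LinearMap.det : End K V →* K).comp ρ).toHomUnits (hD hg)
    simpa [MonoidHom.mem_ker, Units.ext_iff] using this
  rw [hgc] at hdet
  simpa [Polynomial.mem_nthRoots finrank_pos] using hdet

/-- A strongly irreducible representation of a solvable group is scalar on a subgroup of finite
index. -/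
lemma IsStronglyIrreducible.finiteIndex_scalarSubgroup [IsAlgClosed K] [Nontrivial V]
    [Group.IsSolvable G] {ρ : Representation K G V} (hρ : ρ.IsStronglyIrreducible) :
    ρ.scalarSubgroup.FiniteIndex := by
  have step : ∀ k, ρ.scalarSubgroup.relIndex (derivedSeries G (k + 1)) ≠ 0 →
      ρ.scalarSubgroup.relIndex (derivedSeries G k) ≠ 0 := fun k hk ↦ by
    have hD : derivedSeries G (k + 1) ≤ commutator G :=
      derivedSeries_one G ▸ derivedSeries_antitone G (by lia)
    obtain ⟨Z, hZN, hZ, hZi, hZc⟩ := exists_relIndex_ne_zero_of_finite_image_commutator ρ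
      (derivedSeries G k)
      (Subgroup.finite_image_of_relIndex_ne_zero ρ hk (ρ.finite_image_scalarSubgroup_inf hD))
    have := hρ.le_scalarSubgroup Z fun a ha b hb ↦ hZc a ha b (hZN hb)
    exact fun h0 ↦ hZi (Subgroup.relIndex_eq_zero_of_le_left this h0)
  obtain ⟨n, hn⟩ := Group.IsSolvable.solvable (G := G)
  have key : ρ.scalarSubgroup.relIndex (derivedSeries G 0) ≠ 0 := by
    have : ρ.scalarSubgroup.relIndex (derivedSeries G n) ≠ 0 := by simp [hn]
    clear hn
    induction n with
    | zero => exact this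
    | succ k ih => exact ih (step k this)
  exact ⟨by simpa using key⟩

/-- A solvable group of linear maps has a subgroup of finite index with a common eigenvector. -/
lemma exists_finiteIndex_common_eigenvector [IsAlgClosed K] [Nontrivial V] [Group.IsSolvable G]
    (ρ : Representation K G V) :
    ∃ H : Subgroup G, H.FiniteIndex ∧ ∃ v : V, v ≠ 0 ∧ ∀ g ∈ H, ∃ c : K, ρ g v = c • v := by
  obtain ⟨W, ⟨hW0, H, hH, hW⟩, hmin⟩ := wellFounded_lt.has_min
    {W : Submodule K V | W ≠ ⊥ ∧ ∃ H : Subgroup G, H.FiniteIndex ∧ ∀ g ∈ H, ∀ w ∈ W, ρ g w ∈ W}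
    ⟨⊤, top_ne_bot, ⊤, inferInstance, by simp⟩
  have : Nontrivial W := W.nontrivial_iff_ne_bot.2 hW0
  let σ : Representation K H W :=
    Representation.subrepresentation (ρ.comp H.subtype) W fun g w hw ↦ hW g g.2 w hw
  have hσ : σ.IsStronglyIrreducible := fun L hL U hU ↦ by
    by_contra! hne
    refine hmin (U.map W.subtype) ⟨?_, L.map H.subtype, ⟨?_⟩, ?_⟩ ?_
    · exact fun h ↦ hne.1 (Submodule.map_injective_of_injective W.injective_subtype
        (by rw [h, Submodule.map_bot]))
    · rw [Subgroup.index_map_subtype]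
      exact mul_ne_zero hL.index_ne_zero hH.index_ne_zero
    · rintro _ ⟨g, hg, rfl⟩ _ ⟨u, hu, rfl⟩
      exact ⟨σ g u, hU g hg u hu, rfl⟩
    · refine lt_of_le_of_ne (Submodule.map_subtype_le _ _) fun h ↦ hne.2 ?_
      apply Submodule.map_injective_of_injective W.injective_subtype
      rw [h, Submodule.map_top, Submodule.range_subtype]
  obtain ⟨w, hw⟩ := exists_ne (0 : W)
  have hS := hσ.finiteIndex_scalarSubgroup
  refine ⟨σ.scalarSubgroup.map H.subtype, ⟨?_⟩, w, by simpa using hw, ?_⟩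
  · rw [Subgroup.index_map_subtype]
    exact mul_ne_zero hS.index_ne_zero hH.index_ne_zero
  · rintro _ ⟨g, ⟨c, hc⟩, rfl⟩
    exact ⟨c, congrArg Subtype.val (hc w)⟩

end Representation

/-- A solvable group of linear maps has a subgroup of finite index that is simultaneously
triangularizable. -/
lemma Representation.exists_finiteIndex_triangular {K G : Type*} [Field K] [IsAlgClosed K]
    [Group G] [Group.IsSolvable G] (n : ℕ) {V : Type*} [AddCommGroup V] [Module K V]
    [FiniteDimensional K V] (hn : finrank K V = n) (ρ : Representation K G V) :
    ∃ H : Subgroup G, H.FiniteIndex ∧ ∃ b : Fin n → V, LinearIndependent K b ∧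
      ∀ g ∈ H, ∀ j, ρ g (b j) ∈ Submodule.span K (b '' Set.Iic j) := by
  induction n generalizing G V with
  | zero =>
    exact ⟨⊤, inferInstance, Fin.elim0, linearIndependent_empty_type, fun _ _ j ↦ j.elim0⟩
  | succ n ih =>
    have : Nontrivial V := Module.nontrivial_of_finrank_pos (R := K) (by lia)
    obtain ⟨H, hH, v, hv0, hv⟩ := ρ.exists_finiteIndex_common_eigenvector
    have hinv : ∀ g : H, K ∙ v ≤ (K ∙ v).comap ((ρ.comp H.subtype) g) := fun g ↦ by
      rw [Submodule.span_singleton_le_iff_mem, Submodule.mem_comap]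
      obtain ⟨c, hc⟩ := hv g g.2
      exact Submodule.mem_span_singleton.2 ⟨c, hc.symm⟩
    obtain ⟨L, hL, b, hbi, hb⟩ := ih
      (by have := (K ∙ v).finrank_quotient_add_finrank
          rw [finrank_span_singleton hv0] at this
          lia)
      (Representation.quotient (ρ.comp H.subtype) (K ∙ v) hinv)
    choose b' hb' using fun i ↦ (K ∙ v).mkQ_surjective (b i)
    have hbb : (K ∙ v).mkQ ∘ b' = b := funext hb'
    refine ⟨L.map H.subtype, ⟨?_⟩, Fin.cons v b', ?_, ?_⟩
    · rw [Subgroup.index_map_subtype]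
      exact mul_ne_zero hL.index_ne_zero hH.index_ne_zero
    · rw [linearIndependent_finCons]
      refine ⟨LinearIndependent.of_comp (K ∙ v).mkQ (hbb ▸ hbi), fun hmem ↦ hv0 ?_⟩
      obtain ⟨c, rfl⟩ := (Submodule.mem_span_range_iff_exists_fun K).1 hmem
      have h0 := (Submodule.Quotient.mk_eq_zero _).2 (Submodule.mem_span_singleton_self
        (R := K) (∑ i, c i • b' i))
      rw [← Submodule.mkQ_apply, map_sum] at h0
      simp only [map_smul, hb'] at h0
      simp [Fintype.linearIndependent_iff.1 hbi c h0]
    · rintro _ ⟨g, hg, rfl⟩ j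
      refine Fin.cases ?_ (fun j ↦ ?_) j
      · obtain ⟨c, hc⟩ := hv g g.2
        simp only [Fin.cons_zero, Subgroup.coe_subtype, hc]
        exact Submodule.smul_mem _ _ (Submodule.subset_span ⟨0, by simp, by simp⟩)
      · have h := hb g hg j
        have hle : (Submodule.span K (b' '' Set.Iic j)) ⊔ K ∙ v ≤
            Submodule.span K ((Fin.cons v b' : Fin (n + 1) → V) '' Set.Iic j.succ) := by
          rw [← Submodule.span_union]
          refine Submodule.span_mono ?_
          rintro _ (⟨i, hi, rfl⟩ | rfl)
          · exact ⟨i.succ, by simpa using hi, by simp⟩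
          · exact ⟨0, by simp, by simp⟩
        refine hle ?_
        rw [← hb' j, ← hbb, Set.image_comp, ← Submodule.map_span] at h
        rw [← (K ∙ v).ker_mkQ, ← Submodule.comap_map_eq, Submodule.mem_comap]
        exact h

/-- Every virtually solvable subgroup `G ≤ GL n ℂ` contains a normal finite-index subgroup `G₀`
that can be conjugated into `𝓑`. -/
theorem exists_normal_finiteIndex_conjIntoB {n : ℕ} (G : Subgroup (GL (Fin n) ℂ))
    (h : IsVirtSolvable ↥G) :
    ∃ G₀ : Subgroup ↥G, G₀.Normal ∧ G₀.FiniteIndex ∧ ConjIntoB (G₀.map G.subtype) := by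
  obtain ⟨H, hH, hs⟩ := h
  have : Group.IsSolvable H := hs
  let ρ : Representation ℂ H (Fin n → ℂ) :=
    (Matrix.toLinAlgEquiv' : Matrix (Fin n) (Fin n) ℂ ≃ₐ[ℂ] _).toMonoidHom.comp
      ((Units.coeHom _).comp (G.subtype.comp H.subtype))
  have hρ : ∀ h v, ρ h v = ((h : GL (Fin n) ℂ) : Matrix (Fin n) (Fin n) ℂ).mulVec v := fun _ _ ↦ rfl
  obtain ⟨L, hL, b, hbi, hb⟩ := ρ.exists_finiteIndex_triangular n (by simp)
  have hLfin : (L.map H.subtype).FiniteIndex := ⟨by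
    rw [Subgroup.index_map_subtype]
    exact mul_ne_zero hL.index_ne_zero hH.index_ne_zero⟩
  refine ⟨(L.map H.subtype).normalCore, inferInstance, inferInstance, ?_⟩
  have hunit : IsUnit (Matrix.of b).transpose :=
    Matrix.linearIndependent_cols_iff_isUnit.1 hbi
  obtain ⟨P, hP⟩ := hunit
  have hPcol : ∀ j, (P : Matrix (Fin n) (Fin n) ℂ).mulVec (Pi.single j 1) = b j := fun j ↦ by
    rw [hP, Matrix.mulVec_single_one]
    rfl
  have hPinv : ∀ j, ((P⁻¹ : GL (Fin n) ℂ) : Matrix (Fin n) (Fin n) ℂ).mulVec (b j)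
      = Pi.single j 1 := fun j ↦ by
    rw [← hPcol, Matrix.mulVec_mulVec, ← Units.val_mul, inv_mul_cancel, Units.val_one, Matrix.one_mulVec]
  refine ⟨P⁻¹, ?_⟩
  rintro _ ⟨g, hg, rfl⟩ i j hij
  obtain ⟨k, hk, rfl⟩ := (L.map H.subtype).normalCore_le hg
  have key : ∀ w ∈ Submodule.span ℂ (b '' Set.Iic j),
      ((P⁻¹ : GL (Fin n) ℂ) : Matrix (Fin n) (Fin n) ℂ).mulVec w i = 0 := fun w hw ↦ by
    induction hw using Submodule.span_induction with
    | mem x hx =>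
      obtain ⟨l, hl, rfl⟩ := hx
      rw [hPinv, Pi.single_eq_of_ne (lt_of_le_of_lt hl hij).ne']
    | zero => simp
    | add x y _ _ hx hy => rw [Matrix.mulVec_add, Pi.add_apply, hx, hy, add_zero]
    | smul c x _ hx => rw [Matrix.mulVec_smul, Pi.smul_apply, hx, smul_zero]
  have h := key _ (hb k hk j)
  rw [hρ, ← hPcol, Matrix.mulVec_mulVec, Matrix.mulVec_mulVec, Matrix.mulVec_single_one] at h
  simpa [Matrix.mul_assoc] using h
end

section
/- For every positive integer n there exists a positive integer M = M(n), depending only on n, with the following property: let G = ⟨a₁,…,a_m⟩ ≤ GL_n(ℂ) be a finitely generated virtually solvable subgroup, and suppose that for each i ∈ {1,…,m}, whenever λ and μ are eigenvalues of aᵢ with λ^k = μ^k for some integer 1 ≤ k ≤ M, one has λ = μ. Then G can be conjugated into 𝓑. -/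
section Triangularization

open Module Module.End Polynomial
open scoped Nat commutatorElement

section EigenvalueSeparation

variable {V : Type*} [AddCommGroup V] [Module ℂ V]

/-- No two distinct eigenvalues of `f` have equal `k`-th powers for some `1 ≤ k ≤ M`. -/
def EigenvaluesSeparated (M : ℕ) (f : End ℂ V) : Prop :=
  ∀ lam mu : ℂ, f.HasEigenvalue lam → f.HasEigenvalue mu →
    ∀ k : ℕ, 1 ≤ k → k ≤ M → lam ^ k = mu ^ k → lam = mu

variable [FiniteDimensional ℂ V]

lemma exists_hasEigenvalue_mul_of_mul_eq_smul_mul {f y : End ℂ V} {z : ℂ} (hy : y ≠ 0)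
    (h : f * y = z • (y * f)) :
    ∃ lam, f.HasEigenvalue lam ∧ f.HasEigenvalue (z * lam) := by
  obtain ⟨lam, hlam⟩ : ∃ lam, ¬ f.maxGenEigenspace lam ≤ LinearMap.ker y := by
    by_contra! hc
    refine hy (LinearMap.ker_eq_top.mp (top_le_iff.mp ?_))
    rw [← iSup_maxGenEigenspace_eq_top f]
    exact iSup_le hc
  obtain ⟨v, hv, hyv⟩ := SetLike.not_le_iff_exists.mp hlam
  rw [LinearMap.mem_ker] at hyv
  obtain ⟨k, hk⟩ := (mem_maxGenEigenspace f lam v).mp hv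
  have hex : ∃ j, y (((f - lam • (1 : End ℂ V)) ^ j) v) = 0 := ⟨k, by rw [hk, map_zero]⟩
  classical
  obtain ⟨j, hj⟩ : ∃ j, Nat.find hex = j + 1 := by
    refine Nat.exists_eq_succ_of_ne_zero fun h0 ↦ hyv ?_
    simpa [h0] using Nat.find_spec hex
  set u := ((f - lam • (1 : End ℂ V)) ^ j) v with hu
  have hyu : y u ≠ 0 := Nat.find_min hex (hj ▸ Nat.lt_succ_self j)
  have hfu : y (f u) = lam • y u := by
    have := Nat.find_spec hex
    rw [hj, pow_succ', Module.End.mul_apply, ← hu] at this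
    simpa [sub_eq_zero] using this
  refine ⟨lam, ?_, hasEigenvalue_of_hasEigenvector (x := y u) ⟨mem_eigenspace_iff.mpr ?_, hyu⟩⟩
  · refine hasEigenvalue_of_hasGenEigenvalue (k := k) ?_
    intro hbot
    have : v ∈ f.genEigenspace lam k := mem_genEigenspace_nat.mpr (LinearMap.mem_ker.mpr hk)
    rw [hbot, Submodule.mem_bot] at this
    simp [this] at hyv
  · rw [← Module.End.mul_apply, h, LinearMap.smul_apply, Module.End.mul_apply, hfu, smul_smul]

lemma EigenvaluesSeparated.commute_of_commute_pow {M : ℕ} {f x : End ℂ V}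
    (hf : EigenvaluesSeparated M f) (hu : IsUnit f) {k : ℕ} (hk : 1 ≤ k) (hkM : k ≤ M)
    (hx : Commute x (f ^ k)) : Commute x f := by
  obtain ⟨u, rfl⟩ := hu
  set T : End ℂ (End ℂ V) := LinearMap.mulLeft ℂ (u : End ℂ V) *
    LinearMap.mulRight ℂ ((u⁻¹ : (End ℂ V)ˣ) : End ℂ V) with hT
  have hTapp (y : End ℂ V) : T y = u * (y * (u⁻¹ : (End ℂ V)ˣ)) := rfl
  have hTpow (j : ℕ) (y : End ℂ V) :
      (T ^ j) y = (u ^ j : (End ℂ V)ˣ) * y * ((u ^ j)⁻¹ : (End ℂ V)ˣ) := by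
    induction j with
    | zero => simp
    | succ j ih =>
      rw [pow_succ', Module.End.mul_apply, ih, hTapp, pow_succ' u, mul_inv_rev]
      simp only [Units.val_mul, mul_assoc]
  by_contra hne
  have hy : T x - x ≠ 0 := by
    intro h0
    refine hne ?_
    rw [sub_eq_zero, hTapp, ← mul_assoc] at h0
    exact (Units.mul_inv_eq_iff_eq_mul u).mp h0 |>.symm
  have : Nontrivial (End ℂ V) := ⟨⟨_, _, hy⟩⟩
  have hkill : aeval T (∑ i ∈ Finset.range k, X ^ i : ℂ[X]) (T x - x) = 0 := by
    have h1 : aeval T (∑ i ∈ Finset.range k, X ^ i : ℂ[X]) * (T - 1) = T ^ k - 1 := by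
      simp only [map_sum, map_pow, aeval_X]
      exact geom_sum_mul T k
    have h2 := LinearMap.congr_fun h1 x
    rw [Module.End.mul_apply] at h2
    simp only [LinearMap.sub_apply, Module.End.one_apply] at h2
    rw [h2, hTpow, sub_eq_zero, Units.mul_inv_eq_iff_eq_mul]
    exact_mod_cast hx.eq.symm
  have hspec : (0 : ℂ) ∈ spectrum ℂ (aeval T (∑ i ∈ Finset.range k, X ^ i : ℂ[X])) := by
    rw [spectrum.zero_mem_iff]
    intro hunit
    exact hy (((Module.End.isUnit_iff _).mp hunit).1 (by rw [hkill, map_zero]))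
  rw [spectrum.map_polynomial_aeval_of_nonempty _ _
    (spectrum.nonempty_of_isAlgClosed_of_finiteDimensional ℂ T)] at hspec
  obtain ⟨z, hz, hz0⟩ := hspec
  simp only [eval_finsetSum, eval_pow, eval_X] at hz0
  have hz1 : z ≠ 1 := by
    rintro rfl
    simp at hz0
    omega
  have hzk : z ^ k = 1 := by
    have := geom_sum_mul z k
    rw [hz0, zero_mul] at this
    exact (sub_eq_zero.mp this.symm)
  obtain ⟨y, hy1, hy0⟩ := (hasEigenvalue_iff_mem_spectrum.mpr hz).exists_hasEigenvector
  rw [mem_eigenspace_iff, hTapp, ← mul_assoc, Units.mul_inv_eq_iff_eq_mul, smul_mul_assoc] at hy1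
  obtain ⟨lam, h1, h2⟩ := exists_hasEigenvalue_mul_of_mul_eq_smul_mul hy0 hy1
  have h3 := hf _ _ h2 h1 k hk hkM (by rw [mul_pow, hzk, one_mul])
  have h4 : lam ≠ 0 := by
    rintro rfl
    obtain ⟨v, hv, hv0⟩ := h1.exists_hasEigenvector
    rw [mem_eigenspace_iff, zero_smul] at hv
    exact hv0 (((Module.End.isUnit_iff _).mp u.isUnit).1 (by rw [hv, map_zero]))
  exact hz1 ((mul_eq_right₀ h4).mp h3)

end EigenvalueSeparation

section Scalars

variable {V : Type*} [AddCommGroup V] [Module ℂ V] [FiniteDimensional ℂ V]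
  {Γ : Type*} [Group Γ]

/-- The only invariant subspaces are `⊥` and `⊤`. -/
def HasNoInvariantSubspace (ρ : Γ →* End ℂ V) : Prop :=
  ∀ W : Submodule ℂ V, (∀ g, ∀ v ∈ W, ρ g v ∈ W) → W = ⊥ ∨ W = ⊤

lemma HasNoInvariantSubspace.exists_eq_smul_one [Nontrivial V] {ρ : Γ →* End ℂ V}
    (hρ : HasNoInvariantSubspace ρ) {x : End ℂ V} (hx : ∀ g, Commute x (ρ g)) :
    ∃ c : ℂ, x = c • 1 := by
  obtain ⟨c, hc⟩ := Module.End.exists_eigenvalue x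
  refine ⟨c, ?_⟩
  have htop := (hρ (x.eigenspace c) fun g v hv ↦ ?_).resolve_left hc
  · ext v
    have : v ∈ x.eigenspace c := htop ▸ Submodule.mem_top
    simpa using mem_eigenspace_iff.mp this
  · rw [mem_eigenspace_iff] at hv ⊢
    rw [← Module.End.mul_apply, (hx g).eq, Module.End.mul_apply, hv, map_smul]

lemma isUnit_monoidHom_apply {A : Type*} [Monoid A] (ρ : Γ →* A) (g : Γ) : IsUnit (ρ g) :=
  (Group.isUnit g).map ρ

lemma commute_map_inv {A : Type*} [Monoid A] (ρ : Γ →* A) {x : A} {g : Γ}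
    (h : Commute x (ρ g)) : Commute x (ρ g⁻¹) := by
  have h1 : ρ g * ρ g⁻¹ = 1 := by rw [← map_mul, mul_inv_cancel, map_one]
  have h2 : ρ g⁻¹ * ρ g = 1 := by rw [← map_mul, inv_mul_cancel, map_one]
  calc x * ρ g⁻¹ = ρ g⁻¹ * ρ g * x * ρ g⁻¹ := by rw [h2, one_mul]
    _ = ρ g⁻¹ * (x * ρ g) * ρ g⁻¹ := by rw [h.eq, mul_assoc (ρ g⁻¹)]
    _ = ρ g⁻¹ * x := by rw [mul_assoc, mul_assoc x, h1, mul_one]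

/-- An irreducible representation, with a generating set whose elements act with separated
eigenvalues. -/
structure IsSeparatedIrreducible (M : ℕ) (T : Set Γ) (ρ : Γ →* End ℂ V) : Prop where
  closure_eq_top : Subgroup.closure T = ⊤
  separated : ∀ t ∈ T, EigenvaluesSeparated M (ρ t)
  irreducible : HasNoInvariantSubspace ρ

lemma IsSeparatedIrreducible.exists_eq_smul_one [Nontrivial V] {M : ℕ} {T : Set Γ}
    {ρ : Γ →* End ℂ V} (hρ : IsSeparatedIrreducible M T ρ) {x : End ℂ V}
    (hx : ∀ t ∈ T, ∃ k, 1 ≤ k ∧ k ≤ M ∧ Commute x (ρ t ^ k)) :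
    ∃ c : ℂ, x = c • 1 := by
  refine hρ.irreducible.exists_eq_smul_one fun g ↦ ?_
  have hg : g ∈ Subgroup.closure T := hρ.closure_eq_top ▸ Subgroup.mem_top g
  induction hg using Subgroup.closure_induction with
  | mem t ht =>
    obtain ⟨k, hk, hkM, hc⟩ := hx t ht
    exact (hρ.separated t ht).commute_of_commute_pow (isUnit_monoidHom_apply ρ t) hk hkM hc
  | one => simp
  | mul a b _ _ ha hb => rw [map_mul]; exact ha.mul_right hb
  | inv a _ ha => exact commute_map_inv ρ ha

end Scalars

section Weights

variable {E : Type*} [AddCommGroup E] [Module ℂ E] {Γ : Type*} [Group Γ]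

/-- The simultaneous eigenspace of the elements of `N` for the eigenvalues `χ`. -/
def weightSpace (ψ : Γ →* End ℂ E) (N : Subgroup Γ) (χ : N → ℂ) : Submodule ℂ E :=
  ⨅ x : N, (ψ x).eigenspace (χ x)

lemma mem_weightSpace {ψ : Γ →* End ℂ E} {N : Subgroup Γ} {χ : N → ℂ} {v : E} :
    v ∈ weightSpace ψ N χ ↔ ∀ x : N, ψ x v = χ x • v := by
  simp [weightSpace, Submodule.mem_iInf]

/-- The action of `t` by conjugation on the functions on a normal subgroup. -/
def conjWeight (N : Subgroup Γ) [N.Normal] (t : Γ) : Equiv.Perm (N → ℂ) :=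
  (MulAut.conjNormal t).toEquiv.arrowCongr (Equiv.refl ℂ)

lemma map_mem_weightSpace (ψ : Γ →* End ℂ E) (N : Subgroup Γ) [N.Normal] (t : Γ) {χ : N → ℂ}
    {v : E} (hv : v ∈ weightSpace ψ N χ) :
    ψ t v ∈ weightSpace ψ N (conjWeight N t χ) := by
  rw [mem_weightSpace] at hv ⊢
  intro x
  have h := hv ((MulAut.conjNormal t).symm x)
  have h2 : (x : Γ) * t = t * ((MulAut.conjNormal t).symm x : N) := by
    rw [MulAut.conjNormal_symm_apply]; group
  rw [← Module.End.mul_apply, ← map_mul, h2, map_mul, Module.End.mul_apply, h, map_smul]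
  rfl

lemma conjWeight_symm (N : Subgroup Γ) [N.Normal] (t : Γ) :
    (conjWeight N t).symm = conjWeight N t⁻¹ := by
  ext χ x
  simp only [conjWeight, Equiv.arrowCongr_symm, Equiv.arrowCongr_apply, map_inv]
  rfl

lemma weightSpace_conjWeight_ne_bot (ψ : Γ →* End ℂ E) (N : Subgroup Γ) [N.Normal] (t : Γ)
    {χ : N → ℂ} (h : weightSpace ψ N χ ≠ ⊥) : weightSpace ψ N (conjWeight N t χ) ≠ ⊥ := by
  obtain ⟨v, hv, hv0⟩ := (Submodule.ne_bot_iff _).mp h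
  refine (Submodule.ne_bot_iff _).mpr ⟨ψ t v, map_mem_weightSpace ψ N t hv, fun h0 ↦ hv0 ?_⟩
  exact ((Module.End.isUnit_iff _).mp (isUnit_monoidHom_apply ψ t)).1 (by rw [h0, map_zero])

lemma iSupIndep_weightSpace {ψ : Γ →* End ℂ E} {N : Subgroup Γ}
    (hN : ∀ x ∈ N, ∀ y ∈ N, Commute (ψ x) (ψ y)) : iSupIndep (weightSpace ψ N) := by
  refine (independent_iInf_maxGenEigenspace_of_forall_mapsTo (fun x : N ↦ ψ x)
    fun x y c ↦ ?_).mono fun χ ↦ iInf_mono fun x ↦ ?_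
  · exact mapsTo_maxGenEigenspace_of_comm (hN y y.2 x x.2) c
  · exact (ψ x).genEigenspace (χ x) |>.mono le_top

variable [FiniteDimensional ℂ E]

/-- The nonzero weight spaces of a normal subgroup acting by commuting operators are permuted, so
the factorial of the dimension is an exponent for this permutation action. -/
lemma map_pow_factorial_mem_weightSpace {ψ : Γ →* End ℂ E} {N : Subgroup Γ} [N.Normal]
    (hN : ∀ x ∈ N, ∀ y ∈ N, Commute (ψ x) (ψ y)) (t : Γ) {χ : N → ℂ} {v : E}
    (hv : v ∈ weightSpace ψ N χ) : ψ (t ^ (finrank ℂ E)!) v ∈ weightSpace ψ N χ := by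
  classical
  by_cases hbot : weightSpace ψ N χ = ⊥
  · rw [hbot, Submodule.mem_bot] at hv
    simp [hv]
  have hind := iSupIndep_weightSpace hN
  have : Finite {χ : N → ℂ // weightSpace ψ N χ ≠ ⊥} :=
    WellFoundedGT.finite_ne_bot_of_iSupIndep hind
  have : Fintype {χ : N → ℂ // weightSpace ψ N χ ≠ ⊥} := Fintype.ofFinite _
  have hp : ∀ χ, weightSpace ψ N (conjWeight N t χ) ≠ ⊥ ↔ weightSpace ψ N χ ≠ ⊥ := by
    refine fun χ ↦ ⟨fun h ↦ ?_, weightSpace_conjWeight_ne_bot ψ N t⟩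
    have := weightSpace_conjWeight_ne_bot ψ N t⁻¹ h
    rwa [← conjWeight_symm, Equiv.symm_apply_apply] at this
  have hpow (j : ℕ) : ψ (t ^ j) v ∈ weightSpace ψ N ((conjWeight N t ^ j) χ) := by
    induction j with
    | zero => simpa using hv
    | succ j ih =>
      rw [pow_succ', pow_succ', map_mul, Module.End.mul_apply, Equiv.Perm.mul_apply]
      exact map_mem_weightSpace ψ N t ih
  have hone : ((conjWeight N t).subtypePerm (p := fun χ ↦ weightSpace ψ N χ ≠ ⊥) hp) ^
      (finrank ℂ E)! = 1 := by
    obtain ⟨c, hc⟩ := Nat.factorial_dvd_factorial hind.subtype_ne_bot_le_finrank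
    rw [hc, pow_mul, ← Fintype.card_perm, pow_card_eq_one, one_pow]
  have hfix : (conjWeight N t ^ (finrank ℂ E)!) χ = χ := by
    have := congr_arg (fun σ : Equiv.Perm _ ↦ ((σ ⟨χ, hbot⟩ : {χ // weightSpace ψ N χ ≠ ⊥}) :
      N → ℂ)) hone
    simpa [Equiv.Perm.subtypePerm_pow] using this
  simpa [hfix] using hpow (finrank ℂ E)!

end Weights

section NormalSubgroups

variable {V : Type*} [AddCommGroup V] [Module ℂ V] [FiniteDimensional ℂ V] [Nontrivial V]
  {Γ : Type*} [Group Γ]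

/-- Commuting operators have a common eigenvector. -/
lemma exists_weightSpace_ne_bot {ψ : Γ →* End ℂ V} {N : Subgroup Γ}
    (hN : ∀ x ∈ N, ∀ y ∈ N, Commute (ψ x) (ψ y)) : ∃ χ, weightSpace ψ N χ ≠ ⊥ := by
  obtain ⟨U, ⟨hU0, hU⟩, hmin⟩ := WellFounded.has_min
    (wellFounded_lt (α := Submodule ℂ V))
    {U | U ≠ ⊥ ∧ ∀ x ∈ N, ∀ v ∈ U, ψ x v ∈ U} ⟨⊤, top_ne_bot, by simp⟩
  have hscalar (x : N) : ∃ c : ℂ, ∀ v ∈ U, ψ x v = c • v := by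
    have : Nontrivial U := (Submodule.nontrivial_iff_ne_bot).mpr hU0
    obtain ⟨c, hc⟩ := Module.End.exists_eigenvalue ((ψ x).restrict (hU x x.2))
    obtain ⟨w, hw, hw0⟩ := hc.exists_hasEigenvector
    refine ⟨c, fun v hv ↦ ?_⟩
    by_contra hne
    refine hmin (U ⊓ (ψ x).eigenspace c) ⟨?_, fun y hy u hu ↦ ⟨hU y hy u hu.1, ?_⟩⟩ ?_
    · refine (Submodule.ne_bot_iff _).mpr ⟨w, ⟨w.2, ?_⟩, by simpa using hw0⟩
      rw [mem_eigenspace_iff] at hw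
      exact mem_eigenspace_iff.mpr (congr_arg Subtype.val hw)
    · have := mem_eigenspace_iff.mp hu.2
      refine mem_eigenspace_iff.mpr ?_
      rw [← Module.End.mul_apply, (hN x x.2 y hy).eq, Module.End.mul_apply, this, map_smul]
    · exact inf_le_left.lt_of_ne fun h ↦ hne
        (mem_eigenspace_iff.mp (inf_eq_left.mp h hv))
  choose χ hχ using hscalar
  refine ⟨χ, ne_bot_of_le_ne_bot hU0 fun v hv ↦ mem_weightSpace.mpr fun x ↦ hχ x v hv⟩

variable {M : ℕ} {T : Set Γ} {ρ : Γ →* End ℂ V}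

lemma IsSeparatedIrreducible.exists_eq_smul_one_of_commute (hρ : IsSeparatedIrreducible M T ρ)
    (hM : (finrank ℂ V)! ≤ M) (N : Subgroup Γ) [N.Normal]
    (hN : ∀ x ∈ N, ∀ y ∈ N, Commute (ρ x) (ρ y)) {x : Γ} (hx : x ∈ N) :
    ∃ c : ℂ, ρ x = c • 1 := by
  have htop : ⨆ χ, weightSpace ρ N χ = ⊤ := by
    obtain ⟨χ, hχ⟩ := exists_weightSpace_ne_bot hN
    refine (hρ.irreducible _ fun g v hv ↦ ?_).resolve_left
      (ne_bot_of_le_ne_bot hχ (le_iSup (weightSpace ρ N) χ))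
    have : ⨆ χ, weightSpace ρ N χ ≤ (⨆ χ, weightSpace ρ N χ).comap (ρ g) :=
      iSup_le fun χ v hv ↦ Submodule.mem_iSup_of_mem _ (map_mem_weightSpace ρ N g hv)
    exact this hv
  refine hρ.exists_eq_smul_one fun t _ ↦ ⟨(finrank ℂ V)!, Nat.factorial_pos _, hM, ?_⟩
  have hle : ⨆ χ, weightSpace ρ N χ ≤
      LinearMap.eqLocus (ρ x * ρ t ^ (finrank ℂ V)!) (ρ t ^ (finrank ℂ V)! * ρ x) := by
    refine iSup_le fun χ v hv ↦ ?_
    have h1 := mem_weightSpace.mp hv ⟨x, hx⟩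
    have h2 := mem_weightSpace.mp (map_pow_factorial_mem_weightSpace hN t hv) ⟨x, hx⟩
    rw [LinearMap.mem_eqLocus, ← map_pow]
    simp only at h1 h2
    rw [Module.End.mul_apply, Module.End.mul_apply, h1, h2, map_smul]
  ext v
  exact hle (htop ▸ Submodule.mem_top (x := v))

/-- The adjoint action of a representation on endomorphisms. -/
def adAction (ρ : Γ →* End ℂ V) : Γ →* End ℂ (End ℂ V) where
  toFun g := LinearMap.mulLeft ℂ (ρ g) * LinearMap.mulRight ℂ (ρ g⁻¹)
  map_one' := by ext; simp
  map_mul' a b := by ext; simp [mul_assoc]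

omit [FiniteDimensional ℂ V] [Nontrivial V] in
lemma adAction_apply (g : Γ) (y : End ℂ V) : adAction ρ g y = ρ g * (y * ρ g⁻¹) := rfl

omit [FiniteDimensional ℂ V] [Nontrivial V] in
lemma adAction_map (g x : Γ) : adAction ρ g (ρ x) = ρ (g * x * g⁻¹) := by
  rw [adAction_apply, map_mul, map_mul, mul_assoc]

omit [FiniteDimensional ℂ V] [Nontrivial V] in
lemma adAction_eq_one_of_eq_smul_one {g : Γ} {c : ℂ} (h : ρ g = c • 1) : adAction ρ g = 1 := by
  ext1 y
  have : Commute (ρ g) y := by rw [h]; exact (Commute.one_left y).smul_left c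
  rw [adAction_apply, ← mul_assoc, this.eq, mul_assoc, ← map_mul, mul_inv_cancel, map_one,
    mul_one, Module.End.one_apply]

omit [Nontrivial V] in
lemma pow_finrank_eq_one_of_mul_eq {a b : End ℂ V} (ha : IsUnit a) (hb : IsUnit b) {z : ℂ}
    (h : a * b = z • (b * a)) : z ^ finrank ℂ V = 1 := by
  have h1 := congr_arg LinearMap.det h
  rw [LinearMap.det_smul, map_mul, map_mul, mul_comm (LinearMap.det b)] at h1
  exact (mul_eq_right₀ (mul_ne_zero (ha.map LinearMap.det).ne_zero
    (hb.map LinearMap.det).ne_zero)).mp h1.symm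

omit [FiniteDimensional ℂ V] [Nontrivial V] in
lemma pow_mul_eq_of_mul_eq {a b : End ℂ V} {z : ℂ} (h : a * b = z • (b * a)) (k : ℕ) :
    a ^ k * b = z ^ k • (b * a ^ k) := by
  induction k with
  | zero => simp
  | succ k ih =>
    rw [pow_succ', mul_assoc, ih, mul_smul_comm, ← mul_assoc, h, smul_mul_assoc, smul_smul,
      pow_succ, mul_assoc]

lemma IsSeparatedIrreducible.exists_eq_smul_one_of_commutator
    (hρ : IsSeparatedIrreducible M T ρ) (hM : (finrank ℂ V)! ≤ M)
    (hM2 : (finrank ℂ V ^ 2)! * finrank ℂ V ≤ M) (N : Subgroup Γ) [hNn : N.Normal]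
    (hN : ∀ x ∈ N, ∀ y ∈ N, ∃ c : ℂ, ρ ⁅x, y⁆ = c • 1) {x : Γ} (hx : x ∈ N) :
    ∃ c : ℂ, ρ x = c • 1 := by
  have hcentral {z : Γ} (hz : z ∈ N) (hzN : ∀ y ∈ N, Commute (ρ z) (ρ y)) :
      ∃ c : ℂ, ρ z = c • 1 := by
    let Z : Subgroup Γ :=
      { carrier := {z | z ∈ N ∧ ∀ y ∈ N, Commute (ρ y) (ρ z)}
        one_mem' := ⟨N.one_mem, by simp⟩
        mul_mem' := fun ha hb ↦ ⟨N.mul_mem ha.1 hb.1, fun y hy ↦ by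
          rw [map_mul]; exact (ha.2 y hy).mul_right (hb.2 y hy)⟩
        inv_mem' := fun ha ↦ ⟨N.inv_mem ha.1, fun y hy ↦ commute_map_inv ρ (ha.2 y hy)⟩ }
    have hZ : Z.Normal := by
      refine ⟨fun a ha g ↦ ⟨hNn.conj_mem a ha.1 g, fun y hy ↦ ?_⟩⟩
      have h := ha.2 (g⁻¹ * y * g) (by simpa using hNn.conj_mem y hy g⁻¹)
      have h1 := congr_arg (fun w ↦ ρ g * w * ρ g⁻¹) h.eq
      simp only [← map_mul] at h1
      rw [Commute, SemiconjBy, ← map_mul, ← map_mul]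
      convert h1 using 2 <;> group
    exact hρ.exists_eq_smul_one_of_commute hM Z (fun a ha b hb ↦ hb.2 a ha.1)
      ⟨hz, fun y hy ↦ (hzN y hy).symm⟩
  have hAd : ∀ x ∈ N, ∀ y ∈ N, Commute (adAction ρ x) (adAction ρ y) := by
    intro x hx y hy
    obtain ⟨c, hc⟩ := hN x hx y hy
    have : x * y = ⁅x, y⁆ * (y * x) := by rw [commutatorElement_def]; group
    rw [Commute, SemiconjBy, ← map_mul, this, map_mul, adAction_eq_one_of_eq_smul_one hc, one_mul,
      map_mul]
  have hweight (x : N) : ∃ χ, ρ x ∈ weightSpace (adAction ρ) N χ := by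
    choose χ hχ using fun y : N ↦ hN y y.2 x x.2
    refine ⟨χ, mem_weightSpace.mpr fun y ↦ ?_⟩
    have : (y * x * (y : Γ)⁻¹ : Γ) = ⁅(y : Γ), (x : Γ)⁆ * x := by
      rw [commutatorElement_def]; group
    rw [adAction_map, this, map_mul, hχ, smul_mul_assoc, one_mul]
  refine hρ.exists_eq_smul_one fun t _ ↦ ⟨(finrank ℂ V ^ 2)! * finrank ℂ V,
    Nat.mul_pos (Nat.factorial_pos _) finrank_pos, hM2, ?_⟩
  obtain ⟨χ, hχ⟩ := hweight ⟨x, hx⟩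
  have hs := map_pow_factorial_mem_weightSpace hAd t hχ
  rw [finrank_linearMap, ← sq, adAction_map] at hs
  set s := t ^ (finrank ℂ V ^ 2)! with hs_def
  have hsx : s * x * s⁻¹ ∈ N := hNn.conj_mem x hx s
  obtain ⟨z, hz⟩ := hcentral (z := s * x * s⁻¹ * x⁻¹) (N.mul_mem hsx (N.inv_mem hx)) (by
    intro y hy
    have h1 := mem_weightSpace.mp hχ ⟨y, hy⟩
    have h2 := mem_weightSpace.mp hs ⟨y, hy⟩
    simp only [adAction_map] at h1 h2
    have h3 : ρ (y * (s * x * s⁻¹) * y⁻¹ * (s * x * s⁻¹)⁻¹) = ρ (y * x * y⁻¹ * x⁻¹) := by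
      rw [map_mul ρ _ x⁻¹, h1, map_mul ρ _ (s * x * s⁻¹)⁻¹, h2, smul_mul_assoc, ← map_mul,
        smul_mul_assoc, ← map_mul, mul_inv_cancel, mul_inv_cancel]
    rw [Commute, SemiconjBy, ← map_mul, ← map_mul]
    obtain ⟨c, hc⟩ := hN y hy x hx
    rw [commutatorElement_def] at hc
    rw [hc] at h3
    have h4 : ρ (y * (s * x * s⁻¹)) = c • ρ (s * x * s⁻¹ * y) := by
      have : y * (s * x * s⁻¹) =
        (y * (s * x * s⁻¹) * y⁻¹ * (s * x * s⁻¹)⁻¹) * (s * x * s⁻¹ * y) := by group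
      rw [this, map_mul, h3, smul_mul_assoc, one_mul]
    have h5 : ρ (y * x) = c • ρ (x * y) := by
      have : y * x = (y * x * y⁻¹ * x⁻¹) * (x * y) := by group
      rw [this, map_mul, hc, smul_mul_assoc, one_mul]
    have h6 : ρ (y * (s * x * s⁻¹ * x⁻¹)) = c • ρ (s * x * s⁻¹ * (y * x⁻¹)) := by
      have : y * (s * x * s⁻¹ * x⁻¹) = y * (s * x * s⁻¹) * x⁻¹ := by group
      rw [this, map_mul, h4, smul_mul_assoc, ← map_mul]
      simp only [mul_assoc]
    have h7 : c • ρ (y * x⁻¹) = ρ (x⁻¹ * y) := by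
      have e1 : y * x⁻¹ = x⁻¹ * (x * y) * x⁻¹ := by group
      have e2 : x⁻¹ * y = x⁻¹ * (y * x) * x⁻¹ := by group
      rw [e1, e2, map_mul, map_mul, map_mul _ (x⁻¹ * (y * x)), map_mul _ x⁻¹ (y * x), h5,
        mul_smul_comm, smul_mul_assoc]
    rw [h6, map_mul ρ _ (y * x⁻¹), ← mul_smul_comm, h7, ← map_mul]
    simp only [mul_assoc])
  have hcomm : ρ s * ρ x = z • (ρ x * ρ s) := by
    have : s * x = (s * x * s⁻¹ * x⁻¹) * (x * s) := by group
    rw [← map_mul, this, map_mul, hz, smul_mul_assoc, one_mul, ← map_mul]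
  have hz1 := pow_finrank_eq_one_of_mul_eq (isUnit_monoidHom_apply ρ s)
    (isUnit_monoidHom_apply ρ x) hcomm
  have hpow := pow_mul_eq_of_mul_eq hcomm (finrank ℂ V)
  rw [hz1, one_smul, hs_def, map_pow, ← pow_mul] at hpow
  exact hpow.symm

lemma IsSeparatedIrreducible.exists_eq_smul_one_of_isSolvable
    (hρ : IsSeparatedIrreducible M T ρ) (hM : (finrank ℂ V)! ≤ M)
    (hM2 : (finrank ℂ V ^ 2)! * finrank ℂ V ≤ M) (S : Subgroup Γ) [S.Normal]
    [hS : Group.IsSolvable S] {x : Γ} (hx : x ∈ S) : ∃ c : ℂ, ρ x = c • 1 := by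
  obtain ⟨l, hl⟩ := hS.solvable
  have key (l : ℕ) : ∀ S : Subgroup Γ, S.Normal → derivedSeries S l = ⊥ → ∀ x ∈ S,
      ∃ c : ℂ, ρ x = c • 1 := by
    induction l with
    | zero =>
      intro S _ hS x hx
      have : (⟨x, hx⟩ : S) ∈ derivedSeries S 0 := Subgroup.mem_top _
      rw [hS, Subgroup.mem_bot] at this
      exact ⟨1, by simp [show x = 1 from congr_arg Subtype.val this]⟩
    | succ l ih =>
      intro S hSn hS x hx
      refine hρ.exists_eq_smul_one_of_commutator hM hM2 S (fun a ha b hb ↦ ?_) hx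
      refine ih ⁅S, S⁆ inferInstance ?_ _ (Subgroup.commutator_mem_commutator ha hb)
      have hmap (j : ℕ) : (derivedSeries (⁅S, S⁆ : Subgroup Γ) j).map (Subgroup.subtype _) =
          (derivedSeries S (j + 1)).map S.subtype := by
        induction j with
        | zero =>
          simp [← MonoidHom.range_eq_map, Subgroup.map_subtype_commutator]
        | succ j ihj =>
          rw [derivedSeries_succ, Subgroup.map_commutator, ihj, derivedSeries_succ _ (j + 1),
            Subgroup.map_commutator]
      have := hmap l
      rw [hS, Subgroup.map_bot] at this
      exact (Subgroup.map_eq_bot_iff_of_injective _ (Subgroup.subtype_injective _)).mp this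
  exact key l S ‹_› hl x hx

end NormalSubgroups

section Isometric

variable {V : Type*} [NormedAddCommGroup V] [NormedSpace ℂ V] {Γ : Type*} [Group Γ]
  {ρ : Γ →* End ℂ V}

/-- The group elements acting at operator distance less than `1 / 2` from the identity. -/
def nearOne (ρ : Γ →* End ℂ V) : Set Γ :=
  {g | ∃ ε : ℝ, 0 ≤ ε ∧ ε < 1 / 2 ∧ ∀ v, ‖ρ g v - v‖ ≤ ε * ‖v‖}

lemma map_inv_apply_map_apply (ρ : Γ →* End ℂ V) (g : Γ) (v : V) : ρ g⁻¹ (ρ g v) = v := by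
  rw [← Module.End.mul_apply, ← map_mul, inv_mul_cancel, map_one, Module.End.one_apply]

lemma map_apply_map_inv_apply (ρ : Γ →* End ℂ V) (g : Γ) (v : V) : ρ g (ρ g⁻¹ v) = v := by
  rw [← Module.End.mul_apply, ← map_mul, mul_inv_cancel, map_one, Module.End.one_apply]

lemma norm_commutator_apply_sub_le (hiso : ∀ g v, ‖ρ g v‖ = ‖v‖) {a b : Γ} {r s : ℝ}
    (hr : 0 ≤ r) (hs : 0 ≤ s) (ha : ∀ v, ‖ρ a v - v‖ ≤ r * ‖v‖)
    (hb : ∀ v, ‖ρ b v - v‖ ≤ s * ‖v‖) (v : V) :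
    ‖ρ ⁅a, b⁆ v - v‖ ≤ 2 * r * s * ‖v‖ := by
  set w := ρ (b * a)⁻¹ v with hw
  have hv : v = ρ (b * a) w := by rw [hw, map_apply_map_inv_apply]
  have hnorm : ‖w‖ = ‖v‖ := hiso _ _
  have h1 : ρ ⁅a, b⁆ v = ρ a (ρ b w) := by
    have : ⁅a, b⁆ = a * b * (b * a)⁻¹ := by rw [commutatorElement_def]; group
    rw [this, map_mul, map_mul]
    rfl
  have h2 : ρ ⁅a, b⁆ v - v =
      (ρ a (ρ b w - w) - (ρ b w - w)) - (ρ b (ρ a w - w) - (ρ a w - w)) := by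
    rw [h1]
    nth_rewrite 1 [hv]
    rw [map_mul, Module.End.mul_apply, map_sub, map_sub]
    abel
  rw [h2]
  calc _ ≤ r * (s * ‖w‖) + s * (r * ‖w‖) :=
        (norm_sub_le _ _).trans <| add_le_add
          ((ha _).trans (mul_le_mul_of_nonneg_left (hb w) hr))
          ((hb _).trans (mul_le_mul_of_nonneg_left (ha w) hs))
    _ = 2 * r * s * ‖v‖ := by rw [hnorm]; ring

/-- Eigenvectors of an isometry for different eigenvalues whose ratio is a root of unity are far
apart. -/
lemma norm_le_norm_sub_of_eigen {f : End ℂ V} (hf : ∀ v, ‖f v‖ = ‖v‖) {lam mu : ℂ} {v w : V}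
    (hv : f v = lam • v) (hw : f w = mu • w) (hne : lam ≠ mu) {m : ℕ} (hm : 1 ≤ m)
    (hpow : lam ^ m = mu ^ m) : ‖v‖ ≤ ‖v - w‖ := by
  by_cases hv0 : v = 0
  · simp [hv0]
  have hlam : ‖lam‖ = 1 := by
    have := hf v
    rw [hv, norm_smul] at this
    exact (mul_eq_right₀ (norm_ne_zero_iff.mpr hv0)).mp this
  have hlam0 : lam ≠ 0 := by rintro rfl; simp at hlam
  set z := mu / lam with hz
  have hz1 : z ≠ 1 := fun h ↦ hne ((div_eq_one_iff_eq hlam0).mp h).symm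
  have hzm : z ^ m = 1 := by rw [hz, div_pow, hpow, div_self]; exact hpow ▸ pow_ne_zero m hlam0
  have hsum : ∑ i ∈ Finset.range m, z ^ i = 0 := by
    have := geom_sum_mul z m
    rw [hzm, sub_self] at this
    exact (mul_eq_zero.mp this).resolve_right (sub_ne_zero.mpr hz1)
  have hstep (i : ℕ) : ‖v - z ^ i • w‖ = ‖v - w‖ := by
    induction i with
    | zero => simp
    | succ i ih =>
      rw [← ih, ← hf (v - z ^ i • w), map_sub, map_smul, hv, hw, ← one_mul ‖v - _‖, ← hlam,
        ← norm_smul, smul_sub, smul_smul, smul_smul, hz, pow_succ]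
      congr 3
      field_simp
  have htot : ∑ i ∈ Finset.range m, (v - z ^ i • w) = (m : ℂ) • v := by
    rw [Finset.sum_sub_distrib, ← Finset.sum_smul, hsum, zero_smul, sub_zero, Finset.sum_const,
      Finset.card_range, Nat.cast_smul_eq_nsmul]
  have hle : ‖(m : ℂ) • v‖ ≤ ∑ i ∈ Finset.range m, ‖v - w‖ := by
    rw [← htot]
    exact (norm_sum_le _ _).trans (Finset.sum_le_sum fun i _ ↦ (hstep i).le)
  rw [norm_smul, Complex.norm_natCast, Finset.sum_const, Finset.card_range, nsmul_eq_mul] at hle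
  exact le_of_mul_le_mul_left hle (by exact_mod_cast hm)

variable [FiniteDimensional ℂ V]

lemma iSup_eigenspace_eq_top_of_pow_eq_smul_one {f : End ℂ V} {m : ℕ} (hm : 1 ≤ m) {c : ℂ}
    (hc : c ≠ 0) (h : f ^ m = c • 1) : ⨆ lam, f.eigenspace lam = ⊤ := by
  refine (isSemisimple_of_squarefree_aeval_eq_zero (p := X ^ m - C c) ?_ ?_).iSup_eigenspace_eq_top
  · exact (separable_X_pow_sub_C c (by exact_mod_cast (by omega : m ≠ 0)) hc).squarefree
  · simp [h, Algebra.algebraMap_eq_smul_one]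

/-- Frobenius's lemma on commutators with an element close to the identity. -/
lemma commute_of_commute_commutator_s12 (hiso : ∀ g v, ‖ρ g v‖ = ‖v‖) {a b : Γ}
    (hb : b ∈ nearOne ρ) {m : ℕ} (hm : 1 ≤ m) {c : ℂ} (hc : c ≠ 0) (ha : ρ a ^ m = c • 1)
    (h : Commute (ρ a) (ρ ⁅a, b⁆)) : Commute (ρ a) (ρ b) := by
  obtain ⟨ε, -, hε, hb⟩ := hb
  have htop := iSup_eigenspace_eq_top_of_pow_eq_smul_one hm hc ha
  have hconj : Commute (ρ a) (ρ (b * a * b⁻¹)) := by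
    have h1 : Commute (ρ a) (ρ (b * a⁻¹ * b⁻¹)) := by
      have : b * a⁻¹ * b⁻¹ = a⁻¹ * ⁅a, b⁆ := by rw [commutatorElement_def]; group
      rw [this, map_mul]
      exact (commute_map_inv ρ (Commute.refl _)).mul_right h
    have h2 : b * a * b⁻¹ = (b * a⁻¹ * b⁻¹)⁻¹ := by group
    rw [h2]
    exact commute_map_inv ρ h1
  have hpow {lam : ℂ} {v : V} (hv : ρ a v = lam • v) (hv0 : v ≠ 0) : lam ^ m = c := by
    have h1 (j : ℕ) : (ρ a ^ j) v = lam ^ j • v := by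
      induction j with
      | zero => simp
      | succ j ih => rw [pow_succ', Module.End.mul_apply, ih, map_smul, hv, smul_smul, pow_succ]
    have h2 := h1 m
    rw [ha] at h2
    exact (smul_left_injective ℂ hv0 h2).symm
  have hle (lam : ℂ) : (ρ (b * a * b⁻¹)).eigenspace lam ≤ (ρ a).eigenspace lam := by
    have hinv : ∀ x ∈ (ρ (b * a * b⁻¹)).eigenspace lam,
        ρ a x ∈ (ρ (b * a * b⁻¹)).eigenspace lam := fun x hx ↦ by
      rw [mem_eigenspace_iff] at hx ⊢
      rw [← Module.End.mul_apply, ← hconj.eq, Module.End.mul_apply, hx, map_smul]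
    have hdec := Submodule.inf_iSup_genEigenspace (f := ρ a)
      (p := (ρ (b * a * b⁻¹)).eigenspace lam) hinv 1
    have htop' : ⨆ mu, (ρ a).genEigenspace mu 1 = ⊤ := htop
    rw [htop', inf_top_eq] at hdec
    rw [hdec]
    refine iSup_le fun mu w hw ↦ ?_
    obtain ⟨hw1, hw2⟩ := hw
    by_cases hmu : lam = mu
    · exact hmu ▸ hw2
    by_cases hw0 : w = 0
    · rw [hw0]; exact Submodule.zero_mem _
    exfalso
    have hw1' : ρ (b * a * b⁻¹) w = lam • w := mem_eigenspace_iff.mp hw1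
    have hw2' : ρ a w = mu • w := mem_eigenspace_iff.mp hw2
    set v := ρ b⁻¹ w with hv
    have hbv : ρ b v = w := map_apply_map_inv_apply ρ b w
    have hv0 : v ≠ 0 := by
      intro h0
      rw [h0, map_zero] at hbv
      exact hw0 hbv.symm
    have hav : ρ a v = lam • v := by
      rw [map_mul, map_mul, Module.End.mul_apply, Module.End.mul_apply, ← hv] at hw1'
      rw [← map_inv_apply_map_apply ρ b (ρ a v), hw1', map_smul]
    have hdist := norm_le_norm_sub_of_eigen (hiso a) hav hw2' hmu hm
      ((hpow hav hv0).trans (hpow hw2' hw0).symm)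
    have hnear := hb v
    rw [hbv, norm_sub_rev] at hnear
    have : 0 < ‖v‖ := norm_pos_iff.mpr hv0
    nlinarith
  have heq : ⨆ lam, (ρ a).eigenspace lam ≤ LinearMap.eqLocus (ρ a * ρ b) (ρ b * ρ a) := by
    refine iSup_le fun lam v hv ↦ ?_
    rw [mem_eigenspace_iff] at hv
    have hbv : ρ b v ∈ (ρ (b * a * b⁻¹)).eigenspace lam := by
      rw [mem_eigenspace_iff, map_mul, map_mul, Module.End.mul_apply, Module.End.mul_apply,
        map_inv_apply_map_apply, hv, map_smul]
    rw [LinearMap.mem_eqLocus, Module.End.mul_apply, Module.End.mul_apply, hv, map_smul]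
    exact mem_eigenspace_iff.mp (hle lam hbv)
  ext v
  exact heq (htop ▸ Submodule.mem_top (x := v))

variable [Nontrivial V]

omit [FiniteDimensional ℂ V] in
lemma ne_zero_of_map_eq_smul_one {g : Γ} {c : ℂ} (h : ρ g = c • 1) : c ≠ 0 := by
  rintro rfl
  rw [zero_smul] at h
  exact (isUnit_monoidHom_apply ρ g).ne_zero h

omit [FiniteDimensional ℂ V] in
lemma finite_range_map_commutator {S : Subgroup Γ} [S.FiniteIndex]
    (hS : ∀ x ∈ S, ∃ c : ℂ, ρ x = c • 1) (a : Γ) : (Set.range fun h ↦ ρ ⁅a, h⁆).Finite := by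
  have hwell (h₁ h₂ : Γ) (hh : h₁⁻¹ * h₂ ∈ S) : ρ ⁅a, h₁⁆ = ρ ⁅a, h₂⁆ := by
    obtain ⟨c, hc⟩ := hS _ hh
    obtain ⟨c', hc'⟩ := hS _ (S.inv_mem hh)
    have hcc : c * c' = 1 := by
      have : ρ (h₁⁻¹ * h₂) * ρ (h₁⁻¹ * h₂)⁻¹ = 1 := by rw [← map_mul, mul_inv_cancel, map_one]
      rw [hc, hc', smul_mul_smul_comm, one_mul] at this
      obtain ⟨v, hv⟩ := exists_ne (0 : V)
      have h2 := LinearMap.congr_fun this v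
      rw [LinearMap.smul_apply, Module.End.one_apply] at h2
      exact smul_left_injective ℂ hv (by simpa using h2)
    have h3 : ⁅a, h₂⁆ =
        a * h₁ * (h₁⁻¹ * h₂) * a⁻¹ * (h₁⁻¹ * h₂)⁻¹ * h₁⁻¹ := by
      rw [commutatorElement_def]; group
    rw [h3, commutatorElement_def]
    simp only [map_mul _ _ h₁⁻¹, map_mul _ _ (h₁⁻¹ * h₂)⁻¹, map_mul _ _ a⁻¹,
      map_mul _ _ (h₁⁻¹ * h₂), hc, hc', mul_smul_comm, smul_mul_assoc, mul_one, smul_smul,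
      mul_comm c', hcc, one_smul]
  refine (Set.finite_range (fun q : Γ ⧸ S ↦ ρ ⁅a, q.out⁆)).subset ?_
  rintro _ ⟨h, rfl⟩
  refine ⟨(h : Γ ⧸ S), hwell _ _ ?_⟩
  exact QuotientGroup.eq.mp (QuotientGroup.out_eq' _)

/-- The iterated commutators of two elements close to the identity converge to the identity, so
by finiteness modulo scalars they become trivial. -/
lemma commute_of_mem_nearOne (hiso : ∀ g v, ‖ρ g v‖ = ‖v‖) {S : Subgroup Γ} [S.Normal]
    [S.FiniteIndex] (hS : ∀ x ∈ S, ∃ c : ℂ, ρ x = c • 1) {a b : Γ} (ha : a ∈ nearOne ρ)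
    (hb : b ∈ nearOne ρ) : Commute (ρ a) (ρ b) := by
  obtain ⟨c, hc⟩ := hS _ (S.pow_index_mem a)
  rw [map_pow] at hc
  have hc0 : c ≠ 0 := ne_zero_of_map_eq_smul_one (g := a ^ S.index) (by rw [map_pow, hc])
  have hm : 1 ≤ S.index := Nat.one_le_iff_ne_zero.mpr Subgroup.FiniteIndex.index_ne_zero
  let d : ℕ → Γ := fun k ↦ (fun h ↦ ⁅a, h⁆)^[k] b
  have hd (k : ℕ) : d (k + 1) = ⁅a, d k⁆ := Function.iterate_succ_apply' _ _ _
  obtain ⟨r, hr0, hr, har⟩ := ha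
  obtain ⟨s, hs0, hs, hbs⟩ := hb
  have hr1 : 2 * r < 1 := by linarith
  have hbound (k : ℕ) : ∀ v, ‖ρ (d k) v - v‖ ≤ (2 * r) ^ k * s * ‖v‖ := by
    induction k with
    | zero => intro v; simpa [d] using hbs v
    | succ k ih =>
      intro v
      rw [hd]
      refine (norm_commutator_apply_sub_le hiso hr0 (by positivity) har ih v).trans_eq ?_
      ring
  have hnear (k : ℕ) : d k ∈ nearOne ρ := by
    refine ⟨(2 * r) ^ k * s, by positivity, ?_, hbound k⟩
    exact (mul_le_of_le_one_left hs0 (pow_le_one₀ (by positivity) hr1.le)).trans_lt hs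
  obtain ⟨K, hK⟩ : ∃ K, ρ (d K) = 1 := by
    have := (finite_range_map_commutator hS a).to_subtype
    obtain ⟨⟨f, hf⟩, hinf⟩ := Finite.exists_infinite_fiber
      (fun k ↦ (⟨ρ ⁅a, d k⁆, d k, rfl⟩ : Set.range fun h ↦ ρ ⁅a, h⁆))
    have hinf' : {k | ρ (d (k + 1)) = f}.Infinite := by
      rw [← Set.infinite_coe_iff]
      convert hinf using 2
      ext k
      simp [hd, Subtype.ext_iff]
    obtain ⟨k, hk⟩ := hinf'.nonempty
    refine ⟨k + 1, ?_⟩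
    rw [hk.out]
    ext v
    rw [Module.End.one_apply, ← sub_eq_zero, ← norm_le_zero_iff]
    have hne : (Filter.atTop ⊓ Filter.principal {k | ρ (d (k + 1)) = f}).NeBot :=
      Filter.frequently_mem_iff_neBot.mp (Nat.frequently_atTop_iff_infinite.mpr hinf')
    have hlim : Filter.Tendsto (fun k ↦ (2 * r) ^ (k + 1) * s * ‖v‖)
        (Filter.atTop ⊓ Filter.principal {k | ρ (d (k + 1)) = f}) (nhds 0) := by
      have h1 := tendsto_pow_atTop_nhds_zero_of_lt_one (by positivity) hr1
      have h2 := ((h1.comp (Filter.tendsto_add_atTop_nat 1)).mul_const s).mul_const ‖v‖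
      rw [zero_mul, zero_mul] at h2
      exact h2.mono_left inf_le_left
    refine ge_of_tendsto hlim (Filter.eventually_inf_principal.mpr
      (Filter.Eventually.of_forall fun j hj ↦ ?_))
    have := hbound (j + 1) v
    rwa [hj.out] at this
  have hback : ∀ k ≤ K, Commute (ρ a) (ρ (d (K - k))) := by
    intro k hk
    induction k with
    | zero => rw [Nat.sub_zero, hK]; exact Commute.one_right _
    | succ k ih =>
      refine commute_of_commute_commutator_s12 hiso (hnear _) hm hc0 hc ?_
      rw [← hd, show K - (k + 1) + 1 = K - k by omega]
      exact ih (by omega)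
  simpa [d] using hback K le_rfl

omit [Nontrivial V] in
lemma exists_pow_mem_nearOne (hiso : ∀ g v, ‖ρ g v‖ = ‖v‖) (g : Γ) :
    ∃ k, 1 ≤ k ∧ k ≤ 5 ^ (2 * finrank ℂ V ^ 2) ∧ g ^ k ∈ nearOne ρ := by
  classical
  let F : ℕ → V →L[ℂ] V := fun i ↦ (2 : ℂ) • LinearMap.toContinuousLinearMap (ρ (g ^ i))
  have hFapp (i : ℕ) (v : V) : F i v = (2 : ℂ) • ρ (g ^ i) v := rfl
  have hrank : finrank ℝ (V →L[ℂ] V) = 2 * finrank ℂ V ^ 2 := by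
    rw [finrank_real_of_complex,
      ← (LinearMap.toContinuousLinearMap (𝕜 := ℂ) (E := V) (F' := V)).finrank_eq,
      finrank_linearMap, sq]
  set K := 5 ^ (2 * finrank ℂ V ^ 2) with hK
  by_contra! hc
  have hsep (i j : ℕ) (hij : i < j) (hj : j ≤ K) : 1 ≤ ‖F i - F j‖ := by
    by_contra! hlt
    refine hc (j - i) (by omega) (by omega) ⟨‖F i - F j‖ / 2, by positivity, by linarith,
      fun v ↦ ?_⟩
    have h1 := (F i - F j).le_opNorm v
    have h2 : (F i - F j) v = (2 : ℂ) • ρ (g ^ i) (v - ρ (g ^ (j - i)) v) := by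
      rw [sub_apply, hFapp, hFapp, ← smul_sub, map_sub,
        ← Module.End.mul_apply, ← map_mul, ← pow_add, Nat.add_sub_cancel' hij.le]
    rw [h2, norm_smul, hiso, norm_sub_rev, Complex.norm_ofNat] at h1
    linarith
  have hsep' (i j : ℕ) (hij : i ≠ j) (hi : i ≤ K) (hj : j ≤ K) : 1 ≤ ‖F i - F j‖ := by
    rcases lt_or_gt_of_ne hij with h | h
    · exact hsep i j h hj
    · rw [norm_sub_rev]; exact hsep j i h hi
  have hcard : ((Finset.range (K + 1)).image F).card = K + 1 := by
    rw [Finset.card_image_of_injOn, Finset.card_range]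
    intro i hi j hj hij
    by_contra hne
    have := hsep' i j hne (by simpa [Nat.lt_succ_iff] using hi)
      (by simpa [Nat.lt_succ_iff] using hj)
    rw [hij, sub_self, norm_zero] at this
    linarith
  have hle := Besicovitch.card_le_of_separated ((Finset.range (K + 1)).image F) (by
      intro f hf
      obtain ⟨i, -, rfl⟩ := Finset.mem_image.mp hf
      refine ContinuousLinearMap.opNorm_le_bound _ (by norm_num) fun v ↦ ?_
      rw [hFapp, norm_smul, hiso, Complex.norm_ofNat])
    (by
      intro f hf f' hf' hne
      obtain ⟨i, hi, rfl⟩ := Finset.mem_image.mp hf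
      obtain ⟨j, hj, rfl⟩ := Finset.mem_image.mp hf'
      rw [Finset.mem_range, Nat.lt_succ_iff] at hi hj
      exact hsep' i j (fun h ↦ hne (h ▸ rfl)) hi hj)
  rw [hcard, hrank] at hle
  omega

lemma IsSeparatedIrreducible.exists_eq_smul_one_of_isometric {M : ℕ} {T : Set Γ}
    (hρ : IsSeparatedIrreducible M T ρ) (hM : (finrank ℂ V)! ≤ M)
    (hM2 : 5 ^ (2 * finrank ℂ V ^ 2) ≤ M) (hiso : ∀ g v, ‖ρ g v‖ = ‖v‖) {S : Subgroup Γ}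
    [S.Normal] [S.FiniteIndex] (hS : ∀ x ∈ S, ∃ c : ℂ, ρ x = c • 1) (x : Γ) :
    ∃ c : ℂ, ρ x = c • 1 := by
  have hnormal : (Subgroup.closure (nearOne ρ)).Normal := by
    have hconj : Group.conjugatesOfSet (nearOne ρ) ⊆ nearOne ρ := by
      intro y hy
      obtain ⟨g, ⟨ε, hε0, hε, hg⟩, hgy⟩ := Group.mem_conjugatesOfSet_iff.mp hy
      obtain ⟨h, rfl⟩ := isConj_iff.mp hgy
      refine ⟨ε, hε0, hε, fun v ↦ ?_⟩
      have h1 : ρ (h * g * h⁻¹) v - v = ρ h (ρ g (ρ h⁻¹ v) - ρ h⁻¹ v) := by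
        rw [map_sub, map_apply_map_inv_apply, map_mul, map_mul]
        rfl
      rw [h1, hiso, ← hiso h⁻¹ v]
      exact hg _
    have heq : Subgroup.closure (nearOne ρ) = Subgroup.normalClosure (nearOne ρ) :=
      le_antisymm Subgroup.closure_le_normalClosure (Subgroup.closure_mono hconj)
    rw [heq]
    infer_instance
  have hcomm : ∀ x ∈ Subgroup.closure (nearOne ρ), ∀ y ∈ Subgroup.closure (nearOne ρ),
      Commute (ρ x) (ρ y) := by
    intro x hx y hy
    induction hx, hy using Subgroup.closure_induction₂ with
    | mem x y hx hy => exact commute_of_mem_nearOne hiso hS hx hy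
    | one_left => simp
    | one_right => simp
    | mul_left x y z _ _ _ h1 h2 => rw [map_mul]; exact h1.mul_left h2
    | mul_right x y z _ _ _ h1 h2 => rw [map_mul]; exact h1.mul_right h2
    | inv_left x y _ _ h => exact (commute_map_inv ρ h.symm).symm
    | inv_right x y _ _ h => exact commute_map_inv ρ h
  refine hρ.exists_eq_smul_one fun t _ ↦ ?_
  obtain ⟨k, hk, hkM, hkn⟩ := exists_pow_mem_nearOne hiso t
  obtain ⟨c, hc⟩ := hρ.exists_eq_smul_one_of_commute hM _ hcomm (Subgroup.subset_closure hkn)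
  refine ⟨k, hk, hkM.trans hM2, ?_⟩
  rw [← map_pow, hc]
  exact (Commute.one_right _).smul_right c

end Isometric

section Normalization

variable {V : Type*} [AddCommGroup V] [Module ℂ V] {Γ : Type*} [Group Γ]

/-- The representation rescaled so that all determinants have absolute value one. -/
noncomputable def normalizedRep (ρ : Γ →* End ℂ V) : Γ →* End ℂ V where
  toFun g := ((‖LinearMap.det (ρ g)‖ ^ (-(finrank ℂ V : ℝ)⁻¹) : ℝ) : ℂ) • ρ g
  map_one' := by simp
  map_mul' a b := by
    rw [map_mul, map_mul, norm_mul, Real.mul_rpow (norm_nonneg _) (norm_nonneg _),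
      smul_mul_smul_comm, Complex.ofReal_mul]

variable [FiniteDimensional ℂ V] {ρ : Γ →* End ℂ V}

omit [FiniteDimensional ℂ V] in
lemma exists_normalizedRep_apply_eq (ρ : Γ →* End ℂ V) (g : Γ) :
    ∃ c : ℂ, c ≠ 0 ∧ normalizedRep ρ g = c • ρ g := by
  refine ⟨_, ?_, rfl⟩
  have : 0 < ‖LinearMap.det (ρ g)‖ :=
    norm_pos_iff.mpr ((isUnit_monoidHom_apply ρ g).map LinearMap.det).ne_zero
  exact_mod_cast (Real.rpow_pos_of_pos this _).ne'

lemma norm_det_normalizedRep [Nontrivial V] (ρ : Γ →* End ℂ V) (g : Γ) :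
    ‖LinearMap.det (normalizedRep ρ g)‖ = 1 := by
  have hpos : 0 < ‖LinearMap.det (ρ g)‖ :=
    norm_pos_iff.mpr ((isUnit_monoidHom_apply ρ g).map LinearMap.det).ne_zero
  have hn : (finrank ℂ V : ℝ) ≠ 0 := by exact_mod_cast (finrank_pos (R := ℂ) (M := V)).ne'
  change ‖LinearMap.det (((‖LinearMap.det (ρ g)‖ ^ (-(finrank ℂ V : ℝ)⁻¹) : ℝ) : ℂ) • ρ g)‖ = 1
  rw [LinearMap.det_smul, norm_mul, norm_pow, Complex.norm_real, Real.norm_eq_abs,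
    abs_of_pos (Real.rpow_pos_of_pos hpos _), ← Real.rpow_natCast, ← Real.rpow_mul hpos.le,
    neg_mul, inv_mul_cancel₀ hn, Real.rpow_neg_one, inv_mul_cancel₀ hpos.ne']

omit [FiniteDimensional ℂ V] in
lemma EigenvaluesSeparated.smul {M : ℕ} {f : End ℂ V} (hf : EigenvaluesSeparated M f) {c : ℂ}
    (hc : c ≠ 0) : EigenvaluesSeparated M (c • f) := by
  have key {lam : ℂ} (h : (c • f).HasEigenvalue lam) : f.HasEigenvalue (lam / c) := by
    obtain ⟨v, hv, hv0⟩ := h.exists_hasEigenvector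
    refine hasEigenvalue_of_hasEigenvector (x := v) ⟨mem_eigenspace_iff.mpr ?_, hv0⟩
    rw [mem_eigenspace_iff, LinearMap.smul_apply] at hv
    rw [div_eq_inv_mul, mul_smul, ← hv, smul_smul, inv_mul_cancel₀ hc, one_smul]
  intro lam mu hlam hmu k hk hkM h
  exact (div_left_inj' hc).mp (hf _ _ (key hlam) (key hmu) k hk hkM (by rw [div_pow, div_pow, h]))

omit [FiniteDimensional ℂ V] in
lemma IsSeparatedIrreducible.normalizedRep {M : ℕ} {T : Set Γ}
    (hρ : IsSeparatedIrreducible M T ρ) : IsSeparatedIrreducible M T (normalizedRep ρ) where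
  closure_eq_top := hρ.closure_eq_top
  separated t ht := by
    obtain ⟨c, hc, h⟩ := exists_normalizedRep_apply_eq ρ t
    rw [h]
    exact (hρ.separated t ht).smul hc
  irreducible W hW := by
    refine hρ.irreducible W fun g v hv ↦ ?_
    obtain ⟨c, hc, h⟩ := exists_normalizedRep_apply_eq ρ g
    have h1 := hW g v hv
    rw [h, LinearMap.smul_apply] at h1
    exact (W.smul_mem_iff hc).mp h1

lemma IsSeparatedIrreducible.exists_eq_smul_one_of_finiteIndex [Nontrivial V] {M : ℕ} {T : Set Γ}
    (hρ : IsSeparatedIrreducible M T ρ) (hM : (finrank ℂ V)! ≤ M)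
    (hM2 : 5 ^ (2 * finrank ℂ V ^ 2) ≤ M) {S : Subgroup Γ}
    [S.Normal] [S.FiniteIndex] (hS : ∀ x ∈ S, ∃ c : ℂ, ρ x = c • 1) (x : Γ) :
    ∃ c : ℂ, ρ x = c • 1 := by
  have hS' : ∀ x ∈ S, ∃ c : ℂ, _root_.normalizedRep ρ x = c • 1 := by
    intro x hx
    obtain ⟨c, hc⟩ := hS x hx
    obtain ⟨d, -, hd⟩ := exists_normalizedRep_apply_eq ρ x
    exact ⟨d * c, by rw [hd, hc, smul_smul]⟩
  have hnorm : ∀ x ∈ S, ∃ c : ℂ, ‖c‖ = 1 ∧ _root_.normalizedRep ρ x = c • 1 := by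
    intro x hx
    obtain ⟨c, hc⟩ := hS' x hx
    refine ⟨c, ?_, hc⟩
    have := norm_det_normalizedRep ρ x
    rw [hc, LinearMap.det_smul, map_one, mul_one, norm_pow] at this
    exact (pow_eq_one_iff_of_nonneg (norm_nonneg c) finrank_pos.ne').mp this
  set τ := _root_.normalizedRep ρ with hτ
  let L := (finBasis ℂ V).equivFun
  let F : V → Γ → ℝ := fun v g ↦ ‖L (τ g v)‖
  have hbdd (v : V) : BddAbove (Set.range (F v)) := by
    refine ((Set.finite_range fun q : Γ ⧸ S ↦ F v q.out⁻¹).subset ?_).bddAbove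
    rintro _ ⟨g, rfl⟩
    refine ⟨(g⁻¹ : Γ), ?_⟩
    obtain ⟨c, hc, hcx⟩ := hnorm _ (QuotientGroup.eq.mp (QuotientGroup.out_eq' ((g⁻¹ : Γ) : Γ ⧸ S)))
    have hq : τ (((g⁻¹ : Γ) : Γ ⧸ S).out⁻¹) = c • τ g := by
      rw [← mul_inv_cancel_right (((g⁻¹ : Γ) : Γ ⧸ S).out⁻¹) g⁻¹, inv_inv, map_mul,
        hcx, smul_mul_assoc, one_mul]
    simp only [F, hq, LinearMap.smul_apply, map_smul, norm_smul, hc, one_mul]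
  let : Norm V := ⟨fun v ↦ ⨆ g, F v g⟩
  have hdef (v : V) : ‖v‖ = ⨆ g, F v g := rfl
  have hcore : NormedSpace.Core ℂ V :=
    { norm_nonneg := fun v ↦ Real.iSup_nonneg fun g ↦ norm_nonneg _
      norm_smul := fun c v ↦ by
        simp only [hdef, F, map_smul, norm_smul]
        exact (Real.mul_iSup_of_nonneg (norm_nonneg c) _).symm
      norm_triangle := fun v w ↦ by
        rw [hdef, hdef, hdef]
        refine ciSup_le fun g ↦ ?_
        refine le_trans ?_ <| add_le_add (le_ciSup (hbdd v) g) (le_ciSup (hbdd w) g)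
        simp only [F, map_add]
        exact norm_add_le _ _
      norm_eq_zero_iff := fun v ↦ by
        refine ⟨fun h ↦ ?_, fun h ↦ by simp [hdef, F, h]⟩
        have h1 := le_ciSup (hbdd v) 1
        rw [← hdef, h] at h1
        simpa [F] using h1 }
  let : NormedAddCommGroup V := NormedAddCommGroup.ofCore hcore
  let : NormedSpace ℂ V := NormedSpace.ofCore hcore
  have hiso (g : Γ) (v : V) : ‖τ g v‖ = ‖v‖ := by
    change ⨆ h, F (τ g v) h = ⨆ h, F v h
    refine Equiv.iSup_congr (Equiv.mulRight g) fun h ↦ ?_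
    simp only [F, Equiv.coe_mulRight, map_mul, Module.End.mul_apply]
  obtain ⟨c, hc⟩ := hρ.normalizedRep.exists_eq_smul_one_of_isometric hM hM2 hiso hS' x
  obtain ⟨d, hd0, hd⟩ := exists_normalizedRep_apply_eq ρ x
  refine ⟨d⁻¹ * c, ?_⟩
  rw [mul_smul, ← hc, hd, smul_smul, inv_mul_cancel₀ hd0, one_smul]

end Normalization

section Flags

/-- A bound on the exponents that suffices in dimension `d`. -/
def exponentBound (d : ℕ) : ℕ := d ! + (d ^ 2)! * d + 5 ^ (2 * d ^ 2)

lemma exponentBound_mono : Monotone exponentBound := by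
  intro a b h
  unfold exponentBound
  gcongr
  norm_num

variable {V : Type*} [AddCommGroup V] [Module ℂ V] [FiniteDimensional ℂ V]
  {Γ : Type*} [Group Γ] {ρ : Γ →* End ℂ V}

lemma IsSeparatedIrreducible.finrank_eq_one [Nontrivial V] {M : ℕ} {T : Set Γ}
    (hρ : IsSeparatedIrreducible M T ρ) (hM : exponentBound (finrank ℂ V) ≤ M) {S : Subgroup Γ}
    [S.Normal] [S.FiniteIndex] [Group.IsSolvable S] : finrank ℂ V = 1 := by
  have h1 : (finrank ℂ V)! ≤ M := le_trans (le_add_right (Nat.le_add_right _ _)) hM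
  have h2 : (finrank ℂ V ^ 2)! * finrank ℂ V ≤ M :=
    le_trans (le_add_right (Nat.le_add_left _ _)) hM
  have h3 : 5 ^ (2 * finrank ℂ V ^ 2) ≤ M := le_trans (Nat.le_add_left _ _) hM
  have hscalar (x : Γ) : ∃ c : ℂ, ρ x = c • 1 :=
    hρ.exists_eq_smul_one_of_finiteIndex (S := S) h1 h3
      (fun x hx ↦ hρ.exists_eq_smul_one_of_isSolvable h1 h2 S hx) x
  obtain ⟨v, hv⟩ := exists_ne (0 : V)
  refine _root_.finrank_eq_one v hv fun w ↦ ?_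
  refine Submodule.mem_span_singleton.mp ?_
  refine ((hρ.irreducible (Submodule.span ℂ {v}) fun g w hw ↦ ?_).resolve_left
    (by simpa using hv)) ▸ Submodule.mem_top
  obtain ⟨c, hc⟩ := hscalar g
  rw [hc]
  exact Submodule.smul_mem _ c hw

/-- The subrepresentation on an invariant subspace. -/
def restrictRep (ρ : Γ →* End ℂ V) (W : Submodule ℂ V) (hW : ∀ g, ∀ v ∈ W, ρ g v ∈ W) :
    Γ →* End ℂ W where
  toFun g := (ρ g).restrict (hW g)
  map_one' := by ext; simp
  map_mul' a b := by ext; simp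

/-- The quotient representation by an invariant subspace. -/
def quotientRep (ρ : Γ →* End ℂ V) (W : Submodule ℂ V) (hW : ∀ g, ∀ v ∈ W, ρ g v ∈ W) :
    Γ →* End ℂ (V ⧸ W) where
  toFun g := W.mapQ W (ρ g) (hW g)
  map_one' := by ext; simp
  map_mul' a b := by ext; simp

omit [FiniteDimensional ℂ V] in
lemma EigenvaluesSeparated.restrict {M : ℕ} {f : End ℂ V} (hf : EigenvaluesSeparated M f)
    {W : Submodule ℂ V} (hW : ∀ v ∈ W, f v ∈ W) : EigenvaluesSeparated M (f.restrict hW) := by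
  have key {lam : ℂ} (h : HasEigenvalue (f.restrict hW : End ℂ W) lam) : f.HasEigenvalue lam := by
    obtain ⟨v, hv, hv0⟩ := h.exists_hasEigenvector
    rw [mem_eigenspace_iff] at hv
    exact hasEigenvalue_of_hasEigenvector (x := (v : V))
      ⟨mem_eigenspace_iff.mpr (congr_arg Subtype.val hv), by simpa using hv0⟩
  exact fun lam mu hlam hmu ↦ hf lam mu (key hlam) (key hmu)

lemma EigenvaluesSeparated.mapQ {M : ℕ} {f : End ℂ V} (hf : EigenvaluesSeparated M f)
    {W : Submodule ℂ V} (hW : W ≤ W.comap f) : EigenvaluesSeparated M (W.mapQ W f hW) := by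
  have key {lam : ℂ} (h : HasEigenvalue (W.mapQ W f hW : End ℂ (V ⧸ W)) lam) :
      f.HasEigenvalue lam := by
    by_contra hlam
    have hker : LinearMap.ker (f - lam • (1 : End ℂ V)) = ⊥ := by
      rw [hasEigenvalue_iff, not_not] at hlam
      rwa [eigenspace_def] at hlam
    have hsurj : Function.Surjective (f - lam • (1 : End ℂ V)) :=
      LinearMap.injective_iff_surjective.mp (LinearMap.ker_eq_bot.mp hker)
    have hsurj' : Function.Surjective
        ((W.mapQ W f hW : End ℂ (V ⧸ W)) - lam • (1 : End ℂ (V ⧸ W))) := by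
      intro q
      obtain ⟨w, rfl⟩ := W.mkQ_surjective q
      obtain ⟨v, rfl⟩ := hsurj w
      exact ⟨W.mkQ v, by simp⟩
    obtain ⟨q, hq, hq0⟩ := h.exists_hasEigenvector
    rw [mem_eigenspace_iff] at hq
    exact hq0 (LinearMap.injective_iff_surjective.mpr hsurj' (by simp [hq]))
  exact fun lam mu hlam hmu ↦ hf lam mu (key hlam) (key hmu)

lemma exists_invariant_hyperplane [Nontrivial V] {M : ℕ} {T : Set Γ}
    (hT : Subgroup.closure T = ⊤) (hsep : ∀ t ∈ T, EigenvaluesSeparated M (ρ t))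
    (hM : exponentBound (finrank ℂ V) ≤ M) {S : Subgroup Γ}
    [S.Normal] [S.FiniteIndex] [Group.IsSolvable S] :
    ∃ W : Submodule ℂ V, (∀ g, ∀ v ∈ W, ρ g v ∈ W) ∧ finrank ℂ W + 1 = finrank ℂ V := by
  obtain ⟨W, ⟨hWtop, hW⟩, hmax⟩ := WellFounded.has_min
    (wellFounded_gt (α := Submodule ℂ V))
    {W | W ≠ ⊤ ∧ ∀ g, ∀ v ∈ W, ρ g v ∈ W} ⟨⊥, bot_ne_top, by simp⟩
  refine ⟨W, hW, ?_⟩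
  have : Nontrivial (V ⧸ W) := Submodule.Quotient.nontrivial_iff.mpr hWtop
  have hirr : IsSeparatedIrreducible M T (quotientRep ρ W hW) :=
    { closure_eq_top := hT
      separated := fun t ht ↦ (hsep t ht).mapQ (hW t)
      irreducible := fun U hU ↦ by
        by_cases hUtop : U = ⊤
        · exact Or.inr hUtop
        left
        have hle : W ≤ U.comap W.mkQ := fun w hw ↦ by
          have : W.mkQ w = 0 := (Submodule.Quotient.mk_eq_zero W).mpr hw
          rw [Submodule.mem_comap, this]
          exact U.zero_mem
        have hcomap : U.comap W.mkQ = W := by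
          refine (hle.eq_or_lt.resolve_right
            (hmax _ ⟨fun h ↦ hUtop ?_, fun g v hv ↦ hU g _ hv⟩)).symm
          rw [← Submodule.map_comap_eq_of_surjective W.mkQ_surjective U, h, Submodule.map_top,
            Submodule.range_mkQ]
        rw [← Submodule.map_comap_eq_of_surjective W.mkQ_surjective U, hcomap,
          Submodule.mkQ_map_self] }
  have h1 := hirr.finrank_eq_one (S := S)
    ((exponentBound_mono (Submodule.finrank_quotient_le W)).trans hM)
  have h2 := W.finrank_quotient_add_finrank
  omega

omit [FiniteDimensional ℂ V] in
theorem exists_triangularizing_family {M : ℕ} {T : Set Γ} (hT : Subgroup.closure T = ⊤)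
    {S : Subgroup Γ} [S.Normal] [S.FiniteIndex] [Group.IsSolvable S] {n : ℕ}
    [FiniteDimensional ℂ V] (hn : finrank ℂ V = n) (hM : exponentBound n ≤ M)
    (hsep : ∀ t ∈ T, EigenvaluesSeparated M (ρ t)) :
    ∃ e : Fin n → V, LinearIndependent ℂ e ∧
      ∀ g j, ρ g (e j) ∈ Submodule.span ℂ (e '' Set.Iic j) := by
  induction n generalizing V with
  | zero => exact ⟨Fin.elim0, linearIndependent_empty_type, fun g j ↦ j.elim0⟩
  | succ n ih =>
    have : Nontrivial V := nontrivial_of_finrank_pos (R := ℂ) (by omega)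
    obtain ⟨W, hW, hdim⟩ := exists_invariant_hyperplane (S := S) hT hsep (hn ▸ hM)
    obtain ⟨e, he, hspan⟩ := ih (ρ := restrictRep ρ W hW) (by omega)
      ((exponentBound_mono n.le_succ).trans hM) (fun t ht ↦ (hsep t ht).restrict (hW t))
    obtain ⟨x, hx⟩ : ∃ x, x ∉ W := by
      by_contra! h
      have : W = ⊤ := eq_top_iff.mpr fun v _ ↦ h v
      rw [this, finrank_top] at hdim
      omega
    have hli : LinearIndependent ℂ (Fin.snoc (fun i ↦ (e i : V)) x : Fin (n + 1) → V) := by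
      refine LinearIndependent.finSnoc (he.map' W.subtype W.ker_subtype) fun h ↦ hx ?_
      refine Submodule.span_le.mpr ?_ h
      rintro _ ⟨i, rfl⟩
      exact (e i).2
    refine ⟨_, hli, fun g j ↦ ?_⟩
    induction j using Fin.lastCases with
    | last =>
      have : Set.Iic (Fin.last n) = Set.univ := Set.eq_univ_of_forall Fin.le_last
      rw [this, Set.image_univ, hli.span_eq_top_of_card_eq_finrank' (by simp [hn])]
      exact Submodule.mem_top
    | cast j =>
      have h1 := Submodule.mem_map_of_mem (f := W.subtype) (hspan g j)
      rw [Submodule.map_span, ← Set.image_comp] at h1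
      rw [Fin.snoc_castSucc]
      refine Submodule.span_mono ?_ h1
      rintro _ ⟨i, hi, rfl⟩
      exact ⟨i.castSucc, by simpa using hi, by simp⟩

end Flags

lemma exists_upperTri_conj_of_mem_span {n : ℕ} {e : Fin n → Fin n → ℂ}
    (he : LinearIndependent ℂ e) :
    ∃ X : GL (Fin n) ℂ, ∀ g : GL (Fin n) ℂ,
      (∀ j, (g : Matrix (Fin n) (Fin n) ℂ).mulVec (e j) ∈ Submodule.span ℂ (e '' Set.Iic j)) →
      UpperTri ((X * g * X⁻¹ : GL (Fin n) ℂ) : Matrix (Fin n) (Fin n) ℂ) := by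
  have hunit : IsUnit (Matrix.of e).transpose := by
    rw [← Matrix.linearIndependent_cols_iff_isUnit]
    exact he
  obtain ⟨P, hP⟩ := hunit
  have hPe (k : Fin n) : (P : Matrix (Fin n) (Fin n) ℂ).mulVec (Pi.single k 1) = e k := by
    rw [hP]
    ext i
    simp
  refine ⟨P⁻¹, fun g hg i j hji ↦ ?_⟩
  let f : (Fin n → ℂ) →ₗ[ℂ] ℂ :=
    LinearMap.proj i ∘ₗ Matrix.toLin' ((P⁻¹ : GL (Fin n) ℂ) : Matrix (Fin n) (Fin n) ℂ)
  have hle : Submodule.span ℂ (e '' Set.Iic j) ≤ LinearMap.ker f := by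
    refine Submodule.span_le.mpr ?_
    rintro _ ⟨k, hk, rfl⟩
    have hik : i ≠ k := fun h ↦ absurd (h ▸ hk : i ≤ j) hji.not_ge
    simp only [SetLike.mem_coe, LinearMap.mem_ker, f, LinearMap.comp_apply, Matrix.toLin'_apply,
      LinearMap.proj_apply]
    rw [← hPe k, Matrix.mulVec_mulVec, ← Units.val_mul, inv_mul_cancel, Units.val_one,
      Matrix.one_mulVec, Pi.single_eq_of_ne hik]
  have h := hle (hg j)
  simp only [LinearMap.mem_ker, f, LinearMap.comp_apply, Matrix.toLin'_apply,
      LinearMap.proj_apply] at h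
  rw [inv_inv, Units.val_mul, Units.val_mul, ← h, ← hPe j, Matrix.mulVec_mulVec,
    Matrix.mulVec_mulVec, Matrix.mulVec_single_one]
  rfl

end Triangularization

/-- For every `n` there is `M = M(n)` such that any finitely generated virtually solvable
subgroup `⟨a₁,…,a_m⟩ ≤ GL n ℂ` whose generators have no two distinct eigenvalues `λ ≠ μ` with
`λ^k = μ^k` for some `1 ≤ k ≤ M` can be conjugated into `𝓑`. -/
theorem exists_bound_conjIntoB_of_eigenvalues (n : ℕ) (hn : 0 < n) :
    ∃ M : ℕ, 0 < M ∧ ∀ (m : ℕ) (a : Fin m → GL (Fin n) ℂ),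
      IsVirtSolvable ↥(Subgroup.closure (Set.range a)) →
      (∀ i : Fin m, ∀ lam mu : ℂ,
        ((a i : Matrix (Fin n) (Fin n) ℂ).charpoly.IsRoot lam) →
        ((a i : Matrix (Fin n) (Fin n) ℂ).charpoly.IsRoot mu) →
        ∀ k : ℕ, 1 ≤ k → k ≤ M → lam ^ k = mu ^ k → lam = mu) →
      ConjIntoB (Subgroup.closure (Set.range a)) := by
  refine ⟨exponentBound n, ?_, ?_⟩
  · exact lt_of_lt_of_le (Nat.factorial_pos n) (le_add_right (Nat.le_add_right _ _))
  rintro m a ⟨H, hH, hsol⟩ ha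
  have : Group.IsSolvable H := hsol
  let G := Subgroup.closure (Set.range a)
  let ρ : G →* Module.End ℂ (Fin n → ℂ) :=
    ((Matrix.toLinAlgEquiv' : Matrix (Fin n) (Fin n) ℂ ≃ₐ[ℂ] _) : _ →* _).comp
      ((Units.coeHom (Matrix (Fin n) (Fin n) ℂ)).comp G.subtype)
  have hS : Group.IsSolvable H.normalCore :=
    Group.isSolvable_of_isSolvable_injective (Subgroup.inclusion_injective H.normalCore_le)
  obtain ⟨e, he, hspan⟩ := exists_triangularizing_family (ρ := ρ) (S := H.normalCore)
    (M := exponentBound n) Subgroup.closure_closure_coe_preimage (by simp) le_rfl (by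
      rintro t ⟨i, hi⟩ lam mu hlam hmu
      rw [Module.End.hasEigenvalue_iff_isRoot_charpoly] at hlam hmu
      have hρ : ρ t = Matrix.toLin' (a i : Matrix (Fin n) (Fin n) ℂ) := by rw [hi]; rfl
      rw [hρ, Matrix.charpoly_toLin'] at hlam hmu
      exact ha i lam mu hlam hmu)
  obtain ⟨X, hX⟩ := exists_upperTri_conj_of_mem_span he
  exact ⟨X, fun g hg ↦ hX g (hspan ⟨g, hg⟩)⟩
end
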